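/- Let φ_i : ℝⁿ × ℝˡ → ℝ, i = 1,…,s, be C² around (x̄,p̄), C(p) := {x ∈ ℝⁿ : φ_i(x,p) ≤ 0, i = 1,…,s}, let f : ℝⁿ × ℝˡ × ℝᵐ → ℝⁿ be Lipschitz continuous around (x̄,p̄,q̄) and Fréchet differentiable in x around (x̄,p̄,q̄) uniformly in (p,q) with ∇_x f continuous at (x̄,p̄,q̄), and let x̄ ∈ S̆(v̄,p̄,q̄). Then: (i) if the partial MFCQ and partial CRCQ hold at (x̄,p̄) and the general strong second-order sufficient condition (GSSOSC) holds at (x̄,p̄,q̄,v̄), then x̄ is a Lipschitzian fully stable solution of the parametric variational condition v ∈ f(x,p,q) + N_{C(p)}(x) corresponding to (v̄,p̄,q̄); (ii) if the partial LICQ holds at (x̄,p̄), then GSSOSC is necessary and sufficient for x̄ to be a Lipschitzian fully stable solution corresponding to (v̄,p̄,q̄). -/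

import Mathlib

noncomputable section

open Filter Topology Metric Set MeasureTheory
open scoped RealInnerProductSpace Pointwise

namespace PVS

variable {X : Type*} [NormedAddCommGroup X] [InnerProductSpace ℝ X]
variable {Y : Type*} [NormedAddCommGroup Y] [InnerProductSpace ℝ Y]
variable {W : Type*} [NormedAddCommGroup W] [InnerProductSpace ℝ W]
variable {P : Type*} [MetricSpace P]
variable {Q : Type*} [MetricSpace Q]

/-- Regular (Fréchet) subdifferential of an extended-real-valued function. -/
def regSubdiff (h : X → EReal) (x : X) : Set X :=
  {v | h x ≠ ⊤ ∧ h x ≠ ⊥ ∧ ∀ ε > (0:ℝ), ∀ᶠ u in 𝓝 x,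
      h x + ((⟪v, u - x⟫ - ε * ‖u - x‖ : ℝ) : EReal) ≤ h u}

/-- Weak sequential convergence in an inner product space. -/
def WeakTendsto (xs : ℕ → X) (x : X) : Prop :=
  ∀ z : X, Tendsto (fun k => ⟪xs k, z⟫) atTop (𝓝 ⟪x, z⟫)

/-- Limiting (Mordukhovich) subdifferential. -/
def limSubdiff (h : X → EReal) (x : X) : Set X :=
  {v | ∃ xs vs : ℕ → X, Tendsto xs atTop (𝓝 x) ∧
      Tendsto (fun k => h (xs k)) atTop (𝓝 (h x)) ∧
      (∀ k, vs k ∈ regSubdiff h (xs k)) ∧ WeakTendsto vs v}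

/-- Partial limiting subdifferential with respect to the first variable. -/
def pSubdiff {PP : Type*} (g : X → PP → EReal) (x : X) (p : PP) : Set X :=
  limSubdiff (fun x' => g x' p) x

/-- Graph of a set-valued map. -/
def gph (F : X → Set Y) : Set (X × Y) := {t | t.2 ∈ F t.1}

/-- Regular normal cone. -/
def regNC (Ω : Set X) (x : X) : Set X :=
  {v | ∀ ε > (0:ℝ), ∀ᶠ y in 𝓝[Ω] x, ⟪v, y - x⟫ ≤ ε * ‖y - x‖}

/-- Limiting normal cone. -/
def limNC (Ω : Set X) (x : X) : Set X :=
  {v | ∃ xs vs : ℕ → X, (∀ k, xs k ∈ Ω) ∧ Tendsto xs atTop (𝓝 x) ∧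
      (∀ k, vs k ∈ regNC Ω (xs k)) ∧ Tendsto vs atTop (𝓝 v)}

/-- Regular normal cone to a subset of a product of two inner product spaces,
with the Euclidean product norm. -/
def regNC2 (Ω : Set (X × Y)) (ω : X × Y) : Set (X × Y) :=
  {ζ | ∀ ε > (0:ℝ), ∀ᶠ y in 𝓝[Ω] ω,
      ⟪ζ.1, y.1 - ω.1⟫ + ⟪ζ.2, y.2 - ω.2⟫
        ≤ ε * Real.sqrt (‖y.1 - ω.1‖ ^ 2 + ‖y.2 - ω.2‖ ^ 2)}

/-- Limiting normal cone in a product of two spaces. -/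
def limNC2 (Ω : Set (X × Y)) (ω : X × Y) : Set (X × Y) :=
  {ζ | ∃ ωs ζs : ℕ → X × Y, (∀ k, ωs k ∈ Ω) ∧ Tendsto ωs atTop (𝓝 ω) ∧
      (∀ k, ζs k ∈ regNC2 Ω (ωs k)) ∧ Tendsto ζs atTop (𝓝 ζ)}

/-- Regular coderivative of a set-valued map. -/
def regCoderiv (F : X → Set Y) (u : X) (v : Y) (w : Y) : Set X :=
  {z | (z, -w) ∈ regNC2 (gph F) (u, v)}

/-- Limiting coderivative of a set-valued map. -/
def limCoderiv (F : X → Set Y) (u : X) (v : Y) (w : Y) : Set X :=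
  {z | (z, -w) ∈ limNC2 (gph F) (u, v)}

/-- Regular normal cone in a product of three inner product spaces. -/
def regNC3 (Ω : Set (X × W × Y)) (ω : X × W × Y) : Set (X × W × Y) :=
  {ζ | ∀ ε > (0:ℝ), ∀ᶠ y in 𝓝[Ω] ω,
      ⟪ζ.1, y.1 - ω.1⟫ + ⟪ζ.2.1, y.2.1 - ω.2.1⟫ + ⟪ζ.2.2, y.2.2 - ω.2.2⟫
        ≤ ε * Real.sqrt (‖y.1 - ω.1‖ ^ 2 + ‖y.2.1 - ω.2.1‖ ^ 2 + ‖y.2.2 - ω.2.2‖ ^ 2)}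

/-- Limiting normal cone in a product of three inner product spaces. -/
def limNC3 (Ω : Set (X × W × Y)) (ω : X × W × Y) : Set (X × W × Y) :=
  {ζ | ∃ ωs ζs : ℕ → X × W × Y, (∀ k, ωs k ∈ Ω) ∧ Tendsto ωs atTop (𝓝 ω) ∧
      (∀ k, ζs k ∈ regNC3 Ω (ωs k)) ∧ Tendsto ζs atTop (𝓝 ζ)}

/-- Limiting coderivative of the full partial subdifferential map (x,p) ↦ ∂ₓ g(x,p). -/
def limCoderivFull (g : X → W → EReal) (xb : X) (pb : W) (vh : X) (w : X) : Set (X × W) :=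
  {zs | (zs.1, zs.2, -w) ∈ limNC3 {t : X × W × X | t.2.2 ∈ pSubdiff g t.1 t.2.1} (xb, pb, vh)}

/-- Lipschitz-like (Aubin) property of a set-valued map around a graph point. -/
def LipschitzLike {α Z : Type*} [MetricSpace α] [SeminormedAddCommGroup Z]
    (F : α → Set Z) (ab : α) (zb : Z) : Prop :=
  ∃ ℓ > (0:ℝ), ∃ U ∈ 𝓝 ab, ∃ V ∈ 𝓝 zb,
    ∀ a ∈ U, ∀ a' ∈ U, ∀ z ∈ F a ∩ V, ∃ z' ∈ F a', ‖z - z'‖ ≤ ℓ * dist a a'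

/-- Epigraph of g(·,p). -/
def epi {PP : Type*} (g : X → PP → EReal) (p : PP) : Set (X × ℝ) :=
  {q | g q.1 p ≤ (q.2 : EReal)}

/-- (A1): Lipschitz continuity of the base around the reference point. -/
def A1 (f : X → P → Q → X) (xb : X) (pb : P) (qb : Q) : Prop :=
  ∃ L > (0:ℝ), ∃ ε > (0:ℝ), ∀ x₁ x₂ p₁ p₂ q₁ q₂,
    ‖x₁ - xb‖ < ε → ‖x₂ - xb‖ < ε → dist p₁ pb < ε → dist p₂ pb < ε →
    dist q₁ qb < ε → dist q₂ qb < ε →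
    ‖f x₁ p₁ q₁ - f x₂ p₂ q₂‖ ≤ L * (‖x₁ - x₂‖ + dist p₁ p₂ + dist q₁ q₂)

/-- Parametric prox-regularity with prox-parameter r. -/
def ProxRegWith (g : X → P → EReal) (xb : X) (pb : P) (vh : X) (r : ℝ) : Prop :=
  ∃ ε > (0:ℝ), ∀ x u p v, ‖x - xb‖ < ε → ‖u - xb‖ < ε → dist p pb < ε → ‖v - vh‖ < ε →
    v ∈ pSubdiff g u p →
    g u p + ((⟪v, x - u⟫ - r / 2 * ‖x - u‖ ^ 2 : ℝ) : EReal) ≤ g x p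

/-- Subdifferential continuity with compatible parameterization. -/
def SubdiffCont (g : X → P → EReal) (xb : X) (pb : P) (vh : X) : Prop :=
  Tendsto (fun t : X × P × X => g t.1 t.2.1)
    (𝓝[{t : X × P × X | t.2.2 ∈ pSubdiff g t.1 t.2.1}] (xb, pb, vh)) (𝓝 (g xb pb))

/-- (A2): parametric continuous prox-regularity. -/
def A2 (g : X → P → EReal) (xb : X) (pb : P) (vh : X) : Prop :=
  (∃ r > (0:ℝ), ProxRegWith g xb pb vh r) ∧ SubdiffCont g xb pb vh

/-- Threshold of prox-regularity. -/
def proxThreshold (g : X → P → EReal) (xb : X) (pb : P) (vh : X) : ℝ :=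
  sInf {r : ℝ | 0 < r ∧ ProxRegWith g xb pb vh r}

/-- (A3): basic constraint qualification. -/
def A3 (g : X → P → EReal) (xb : X) (pb : P) : Prop :=
  LipschitzLike (fun p => epi g p) pb (xb, (g xb pb).toReal)

/-- (A4): uniform partial differentiability with partial Jacobian continuous at the point. -/
def A4 (f : X → P → Q → X) (Df : X → P → Q → X →L[ℝ] X) (xb : X) (pb : P) (qb : Q) : Prop :=
  (∃ η > (0:ℝ), ∀ ε > (0:ℝ), ∃ δ > (0:ℝ), ∀ x p q,
      ‖x - xb‖ < η → dist p pb < η → dist q qb < η →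
      ∀ x', ‖x' - x‖ < δ →
        ‖f x' p q - f x p q - Df x p q (x' - x)‖ ≤ ε * ‖x' - x‖) ∧
  Tendsto (fun t : X × P × Q => Df t.1 t.2.1 t.2.2) (𝓝 (xb, pb, qb)) (𝓝 (Df xb pb qb))

/-- Solution map of the parametric variational system. -/
def SolMap (f : X → P → Q → X) (g : X → P → EReal) (v : X) (p : P) (q : Q) : Set X :=
  {x | v - f x p q ∈ pSubdiff g x p}

/-- Single-valued localization of a three-parametric solution map. -/
def Localizes3 (S : X → P → Q → Set X) (V : Set X) (Pn : Set P) (Qn : Set Q) (U : Set X)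
    (ϑ : X → P → Q → X) : Prop :=
  ∀ v ∈ V, ∀ p ∈ Pn, ∀ q ∈ Qn,
    ϑ v p q ∈ U ∧ ϑ v p q ∈ S v p q ∧ ∀ x ∈ U, x ∈ S v p q → x = ϑ v p q

/-- Lipschitzian full stability. -/
def LipFullStable (S : X → P → Q → Set X) (xb vb : X) (pb : P) (qb : Q) : Prop :=
  ∃ V ∈ 𝓝 vb, ∃ Pn ∈ 𝓝 pb, ∃ Qn ∈ 𝓝 qb, ∃ U ∈ 𝓝 xb, ∃ ϑ : X → P → Q → X,
    Localizes3 S V Pn Qn U ϑ ∧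
    ∃ κ > (0:ℝ), ∃ ℓ > (0:ℝ), ∀ v₁ ∈ V, ∀ p₁ ∈ Pn, ∀ q₁ ∈ Qn, ∀ v₂ ∈ V, ∀ p₂ ∈ Pn, ∀ q₂ ∈ Qn,
      ‖(v₁ - v₂) - (2 * κ) • (ϑ v₁ p₁ q₁ - ϑ v₂ p₂ q₂)‖
        ≤ ‖v₁ - v₂‖ + ℓ * (dist p₁ p₂ + dist q₁ q₂)

/-- Hölderian full stability with given moduli. -/
def HolderFullStableWith (S : X → P → Q → Set X) (xb vb : X) (pb : P) (qb : Q) (κ ℓ : ℝ) : Prop :=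
  ∃ V ∈ 𝓝 vb, ∃ Pn ∈ 𝓝 pb, ∃ Qn ∈ 𝓝 qb, ∃ U ∈ 𝓝 xb, ∃ ϑ : X → P → Q → X,
    Localizes3 S V Pn Qn U ϑ ∧
    ∀ v₁ ∈ V, ∀ p₁ ∈ Pn, ∀ q₁ ∈ Qn, ∀ v₂ ∈ V, ∀ p₂ ∈ Pn, ∀ q₂ ∈ Qn,
      ‖(v₁ - v₂) - (2 * κ) • (ϑ v₁ p₁ q₁ - ϑ v₂ p₂ q₂)‖
        ≤ ‖v₁ - v₂‖ + ℓ * (Real.sqrt (dist p₁ p₂) + dist q₁ q₂)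

/-- Hölderian full stability. -/
def HolderFullStable (S : X → P → Q → Set X) (xb vb : X) (pb : P) (qb : Q) : Prop :=
  ∃ κ > (0:ℝ), ∃ ℓ > (0:ℝ), HolderFullStableWith S xb vb pb qb κ ℓ

/-- Neighborhood second-order condition via the regular coderivative of ∂g_p. -/
def SOC (g : X → P → EReal) (A : X →L[ℝ] X) (xb : X) (pb : P) (vh : X) (η κ₀ : ℝ) : Prop :=
  ∀ u p v, ‖u - xb‖ ≤ η → dist p pb ≤ η → ‖v - vh‖ ≤ η → v ∈ pSubdiff g u p →
    ∀ w z, z ∈ regCoderiv (fun y => pSubdiff g y p) u v w →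
      κ₀ * ‖w‖ ^ 2 ≤ ⟪A w, w⟫ + ⟪z, w⟫

/-- The graphical map p ↦ gph ∂ₓ g(·,p). -/
def gphMap (g : X → P → EReal) (p : P) : Set (X × X) := {t | t.2 ∈ pSubdiff g t.1 p}

/-- Local strong monotonicity of f in x with modulus σ. -/
def StrongMono (f : X → P → Q → X) (xb : X) (pb : P) (qb : Q) (σ : ℝ) : Prop :=
  ∃ ε > (0:ℝ), ∀ x₁ x₂ p q, ‖x₁ - xb‖ < ε → ‖x₂ - xb‖ < ε → dist p pb < ε → dist q qb < ε →
    σ * ‖x₁ - x₂‖ ^ 2 ≤ ⟪f x₁ p q - f x₂ p q, x₁ - x₂⟫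

/-- The proximal mapping P_λ(v,p) = {x : v ∈ x + λ ∂ₓ g(x,p)}. -/
def proxMap (g : X → P → EReal) (lam : ℝ) (v : X) (p : P) : Set X :=
  {x | ∃ s ∈ pSubdiff g x p, v = x + lam • s}

/-- Single-valued localization of a two-parametric solution map. -/
def Localizes2 (S : X → P → Set X) (V : Set X) (Pn : Set P) (U : Set X) (ϑ : X → P → X) : Prop :=
  ∀ v ∈ V, ∀ p ∈ Pn, ϑ v p ∈ U ∧ ϑ v p ∈ S v p ∧ ∀ x ∈ U, x ∈ S v p → x = ϑ v p

/-- (Lipschitzian) full stability of a two-parametric system. -/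
def FullStable2 (S : X → P → Set X) (xb vb : X) (pb : P) : Prop :=
  ∃ V ∈ 𝓝 vb, ∃ Pn ∈ 𝓝 pb, ∃ U ∈ 𝓝 xb, ∃ ϑ : X → P → X,
    Localizes2 S V Pn U ϑ ∧
    ∃ κ > (0:ℝ), ∃ ℓ > (0:ℝ), ∀ v₁ ∈ V, ∀ p₁ ∈ Pn, ∀ v₂ ∈ V, ∀ p₂ ∈ Pn,
      ‖(v₁ - v₂) - (2 * κ) • (ϑ v₁ p₁ - ϑ v₂ p₂)‖ ≤ ‖v₁ - v₂‖ + ℓ * dist p₁ p₂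

/-- Normal cone of convex analysis. -/
def convNC (C : Set X) (x : X) : Set X := {v | x ∈ C ∧ ∀ y ∈ C, ⟪v, y - x⟫ ≤ 0}

/-- Solution map of a parametric variational inequality. -/
def SolMapVI (f : X → P → X) (C : Set X) (v : X) (p : P) : Set X :=
  {x | v - f x p ∈ convNC C x}

/-- Radial cone. -/
def radialCone (C : Set X) (x : X) : Set X := {w | ∃ t > (0:ℝ), x + t • w ∈ C}

/-- Tangent cone (closure of the radial cone). -/
def tangentC (C : Set X) (x : X) : Set X := closure (radialCone C x)

/-- Critical cone. -/
def criticalCone (C : Set X) (x v : X) : Set X := tangentC C x ∩ {w | ⟪v, w⟫ = 0}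

/-- Polyhedricity of a closed convex set. -/
def Polyhedric (C : Set X) : Prop :=
  ∀ x ∈ C, ∀ v ∈ convNC C x,
    criticalCone C x v = closure (radialCone C x ∩ {w | ⟪v, w⟫ = 0})

/-- Weak sequential outer limit of critical cones. -/
def Hw (C : Set X) (xb vh : X) : Set X :=
  {w | ∃ xs vs ws : ℕ → X, (∀ k, vs k ∈ convNC C (xs k)) ∧
      Tendsto xs atTop (𝓝 xb) ∧ Tendsto vs atTop (𝓝 vh) ∧
      (∀ k, ws k ∈ criticalCone C (xs k) (vs k)) ∧ WeakTendsto ws w}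

/-- Strong sequential outer limit of critical cones. -/
def Hs (C : Set X) (xb vh : X) : Set X :=
  {w | ∃ xs vs ws : ℕ → X, (∀ k, vs k ∈ convNC C (xs k)) ∧
      Tendsto xs atTop (𝓝 xb) ∧ Tendsto vs atTop (𝓝 vh) ∧
      (∀ k, ws k ∈ criticalCone C (xs k) (vs k)) ∧ Tendsto ws atTop (𝓝 w)}

/-- Convex polyhedron: finite intersection of closed half-spaces. -/
def IsPolyhedron (C : Set X) : Prop :=
  ∃ (k : ℕ) (a : Fin k → X) (b : Fin k → ℝ), C = {x | ∀ i, ⟪a i, x⟫ ≤ b i}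

/-- Legendre form. -/
def LegendreForm (Qf : X → ℝ) : Prop :=
  (∃ A : X →L[ℝ] X, ∀ x, Qf x = ⟪A x, x⟫) ∧
  (∀ (xs : ℕ → X) (x : X), WeakTendsto xs x → Qf x ≤ liminf (fun k => Qf (xs k)) atTop) ∧
  (∀ (xs : ℕ → X) (x : X), WeakTendsto xs x →
     Tendsto (fun k => Qf (xs k)) atTop (𝓝 (Qf x)) → Tendsto xs atTop (𝓝 x))

/-- (A1) for a two-parametric base mapping. -/
def A1two (f : X → P → X) (xb : X) (pb : P) : Prop :=
  ∃ L > (0:ℝ), ∃ ε > (0:ℝ), ∀ x₁ x₂ p₁ p₂,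
    ‖x₁ - xb‖ < ε → ‖x₂ - xb‖ < ε → dist p₁ pb < ε → dist p₂ pb < ε →
    ‖f x₁ p₁ - f x₂ p₂‖ ≤ L * (‖x₁ - x₂‖ + dist p₁ p₂)

/-- (A4) for a two-parametric base mapping. -/
def A4two (f : X → P → X) (Df : X → P → X →L[ℝ] X) (xb : X) (pb : P) : Prop :=
  (∃ η > (0:ℝ), ∀ ε > (0:ℝ), ∃ δ > (0:ℝ), ∀ x p,
      ‖x - xb‖ < η → dist p pb < η →
      ∀ x', ‖x' - x‖ < δ → ‖f x' p - f x p - Df x p (x' - x)‖ ≤ ε * ‖x' - x‖) ∧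
  Tendsto (fun t : X × P => Df t.1 t.2) (𝓝 (xb, pb)) (𝓝 (Df xb pb))

/-- Euclidean distance in X × ℝ. -/
def pairDist (a b : X × ℝ) : ℝ := Real.sqrt (‖a.1 - b.1‖ ^ 2 + |a.2 - b.2| ^ 2)

/-- Pompeiu–Hausdorff distance between subsets of X × ℝ (Euclidean product norm). -/
def hausPH (C₁ C₂ : Set (X × ℝ)) : ℝ :=
  sInf {η : ℝ | 0 ≤ η ∧ (∀ a ∈ C₁, ∃ b ∈ C₂, pairDist a b ≤ η) ∧
                 ∀ b ∈ C₂, ∃ a ∈ C₁, pairDist a b ≤ η}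

/-- Nonparametric prox-regularity with parameter r. -/
def ProxRegWithNP (g : X → EReal) (xb vh : X) (r : ℝ) : Prop :=
  ∃ ε > (0:ℝ), ∀ x u v, ‖x - xb‖ < ε → ‖u - xb‖ < ε → ‖v - vh‖ < ε →
    v ∈ limSubdiff g u → g u ≤ g xb + (ε : EReal) →
    g u + ((⟪v, x - u⟫ - r / 2 * ‖x - u‖ ^ 2 : ℝ) : EReal) ≤ g x

/-- Nonparametric subdifferential continuity. -/
def SubdiffContNP (g : X → EReal) (xb vh : X) : Prop :=
  Tendsto (fun t : X × X => g t.1) (𝓝[gph (limSubdiff g)] (xb, vh)) (𝓝 (g xb))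

/-- Nonparametric threshold of prox-regularity. -/
def proxThresholdNP (g : X → EReal) (xb vh : X) : ℝ :=
  sInf {r : ℝ | 0 < r ∧ ProxRegWithNP g xb vh r}

section VariationalStability

set_option linter.unusedSectionVars false
variable {ι : Type*} [Fintype ι]
variable {E : Type*} [NormedAddCommGroup E] [InnerProductSpace ℝ E] [FiniteDimensional ℝ E]
variable {F : Type*} [NormedAddCommGroup F] [NormedSpace ℝ F]

/-- Gradient of `h` with respect to its first variable. -/
def pgrad (h : E → F → ℝ) (x : E) (p : F) : E := gradient (fun y => h y p) x

/-- Partial Hessian of `h` with respect to its first variable. -/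
def phess (h : E → F → ℝ) (x : E) (p : F) (u : E) : E :=
  fderiv ℝ (fun t : E × F => pgrad h t.1 t.2) (x, p) (u, 0)

section Smoothness

variable {h : E → F → ℝ} {xb : E} {pb : F}

theorem hasFDerivAt_fst_slice {t : E × F}
    (hd : DifferentiableAt ℝ (fun t : E × F => h t.1 t.2) t) :
    HasFDerivAt (fun y => h y t.2)
      ((fderiv ℝ (fun t : E × F => h t.1 t.2) t).comp (ContinuousLinearMap.inl ℝ E F)) t.1 :=
  HasFDerivAt.comp (f := fun y : E => (y, t.2)) (g := fun t : E × F => h t.1 t.2) t.1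
    hd.hasFDerivAt (hasFDerivAt_prodMk_left t.1 t.2)

theorem hasGradientAt_pgrad {t : E × F}
    (hd : DifferentiableAt ℝ (fun t : E × F => h t.1 t.2) t) :
    HasGradientAt (fun y => h y t.2) (pgrad h t.1 t.2) t.1 :=
  (hasFDerivAt_fst_slice hd).differentiableAt.hasGradientAt

theorem fderiv_inl_eq_inner_pgrad {t : E × F}
    (hd : DifferentiableAt ℝ (fun t : E × F => h t.1 t.2) t) (u : E) :
    fderiv ℝ (fun t : E × F => h t.1 t.2) t (u, 0) = ⟪pgrad h t.1 t.2, u⟫ := by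
  have h1 := (hasGradientAt_pgrad hd).hasFDerivAt.unique (hasFDerivAt_fst_slice hd)
  have h2 := congrArg (fun L : E →L[ℝ] ℝ => L u) h1
  simpa using h2.symm

theorem eventually_differentiableAt_of_contDiffAt
    (hh : ContDiffAt ℝ 2 (fun t : E × F => h t.1 t.2) (xb, pb)) :
    ∀ᶠ t in 𝓝 (xb, pb), DifferentiableAt ℝ (fun t : E × F => h t.1 t.2) t :=
  (hh.eventually (by simp)).mono fun _ ht => ht.differentiableAt (by simp)

theorem contDiffAt_pgrad (hh : ContDiffAt ℝ 2 (fun t : E × F => h t.1 t.2) (xb, pb)) :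
    ContDiffAt ℝ 1 (fun t : E × F => pgrad h t.1 t.2) (xb, pb) := by
  have h1 : ContDiffAt ℝ 1 (fderiv ℝ (fun t : E × F => h t.1 t.2)) (xb, pb) :=
    hh.fderiv_right (by norm_num)
  have h2 : ContDiffAt ℝ 1 (fun t : E × F => (InnerProductSpace.toDual ℝ E).symm
      ((fderiv ℝ (fun t : E × F => h t.1 t.2) t).comp (ContinuousLinearMap.inl ℝ E F)))
      (xb, pb) := by
    have h3 : ContDiffAt ℝ 1 (fun t : E × F =>
      ((fderiv ℝ (fun t : E × F => h t.1 t.2) t).comp (ContinuousLinearMap.inl ℝ E F)))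
      (xb, pb) := h1.clm_comp contDiffAt_const
    exact ((InnerProductSpace.toDual ℝ E).symm.contDiff.contDiffAt).comp _ h3
  refine h2.congr_of_eventuallyEq ?_
  filter_upwards [eventually_differentiableAt_of_contDiffAt hh] with t ht
  rw [pgrad, gradient, (hasFDerivAt_fst_slice ht).fderiv]

theorem hasStrictFDerivAt_pgrad (hh : ContDiffAt ℝ 2 (fun t : E × F => h t.1 t.2) (xb, pb)) :
    HasStrictFDerivAt (fun t : E × F => pgrad h t.1 t.2)
      (fderiv ℝ (fun t : E × F => pgrad h t.1 t.2) (xb, pb)) (xb, pb) :=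
  (contDiffAt_pgrad hh).hasStrictFDerivAt (by simp)

theorem eventually_continuousAt_pgrad
    (hh : ContDiffAt ℝ 2 (fun t : E × F => h t.1 t.2) (xb, pb)) :
    ∀ᶠ t in 𝓝 (xb, pb), ContinuousAt (fun t : E × F => pgrad h t.1 t.2) t :=
  ((contDiffAt_pgrad hh).eventually (by simp)).mono fun _ ht => ht.continuousAt

theorem iteratedFDeriv_two_eq_inner_phess
    (hh : ContDiffAt ℝ 2 (fun t : E × F => h t.1 t.2) (xb, pb)) (u : E) :
    iteratedFDeriv ℝ 2 (fun y => h y pb) xb ![u, u] = ⟪phess h xb pb u, u⟫ := by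
  rw [iteratedFDeriv_two_apply]
  simp only [Matrix.cons_val_zero, Matrix.cons_val_one]
  have h1 : HasFDerivAt (fun y => pgrad h y pb)
      ((fderiv ℝ (fun t : E × F => pgrad h t.1 t.2) (xb, pb)).comp
        (ContinuousLinearMap.inl ℝ E F)) xb :=
    HasFDerivAt.comp (f := fun y : E => (y, pb)) (g := fun t : E × F => pgrad h t.1 t.2) xb
      (hasStrictFDerivAt_pgrad hh).hasFDerivAt (hasFDerivAt_prodMk_left xb pb)
  have h2 : fderiv ℝ (fun y => h y pb) = fun y => InnerProductSpace.toDual ℝ E (pgrad h y pb) := by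
    funext y
    simp [pgrad, gradient]
  have h3 : HasFDerivAt (fun y => InnerProductSpace.toDual ℝ E (pgrad h y pb)) _ xb :=
    ((InnerProductSpace.toDual ℝ E).toContinuousLinearEquiv.hasFDerivAt).comp xb h1
  rw [h2, h3.fderiv]
  simp [phess]

end Smoothness

/-- Difference quotients of a strictly differentiable map with moving base points. -/
theorem tendsto_smul_sub_of_hasStrictFDerivAt {V V' κ : Type*} [NormedAddCommGroup V]
    [NormedSpace ℝ V] [NormedAddCommGroup V'] [NormedSpace ℝ V'] {g : V → V'} {g' : V →L[ℝ] V'}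
    {a : V} (hg : HasStrictFDerivAt g g' a) {l : Filter κ} {a₁ a₂ : κ → V} {c : κ → ℝ} {w : V}
    (h₁ : Tendsto a₁ l (𝓝 a)) (h₂ : Tendsto a₂ l (𝓝 a))
    (hc : Tendsto (fun k => c k • (a₁ k - a₂ k)) l (𝓝 w)) :
    Tendsto (fun k => c k • (g (a₁ k) - g (a₂ k))) l (𝓝 (g' w)) := by
  have h3 := (hg.isLittleO.comp_tendsto (h₁.prodMk_nhds h₂))
  have h4 : (fun k => c k • (g (a₁ k) - g (a₂ k) - g' (a₁ k - a₂ k)))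
      =o[l] fun k => c k • (a₁ k - a₂ k) :=
    (Asymptotics.isBigO_refl c l).smul_isLittleO h3
  have h5 := (h4.trans_isBigO (hc.isBigO_one ℝ))
  rw [Asymptotics.isLittleO_one_iff] at h5
  have h6 := h5.add ((g'.continuous.tendsto w).comp hc)
  simp only [zero_add] at h6
  refine h6.congr fun k => ?_
  simp [smul_sub]

section Taylor

variable {h : E → F → ℝ} {xb : E} {pb : F}

theorem isLittleO_second_order_taylor
    (hh : ContDiffAt ℝ 2 (fun t : E × F => h t.1 t.2) (xb, pb)) :
    (fun t : E × E × F => h t.1 t.2.2 - h t.2.1 t.2.2 - ⟪pgrad h t.2.1 t.2.2, t.1 - t.2.1⟫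
      - ⟪phess h xb pb (t.1 - t.2.1), t.1 - t.2.1⟫ / 2)
      =o[𝓝 (xb, xb, pb)] fun t => ‖t.1 - t.2.1‖ ^ 2 := by
  rw [Asymptotics.isLittleO_iff]
  intro ε hε
  have h1 := (hasStrictFDerivAt_pgrad hh).isLittleO.def hε
  have h2 := eventually_differentiableAt_of_contDiffAt hh
  rw [nhds_prod_eq, (nhds_basis_ball.prod_self).eventually_iff] at h1
  rw [nhds_basis_ball.eventually_iff] at h2
  obtain ⟨δ₁, hδ₁, h1⟩ := h1
  obtain ⟨δ₂, hδ₂, h2⟩ := h2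
  have hδ : 0 < min δ₁ δ₂ := lt_min hδ₁ hδ₂
  have hx1 : ∀ᶠ t : E × E × F in 𝓝 (xb, xb, pb), t.1 ∈ ball xb (min δ₁ δ₂) :=
    (continuous_fst.tendsto' _ _ rfl).eventually (ball_mem_nhds _ hδ)
  have hx2 : ∀ᶠ t : E × E × F in 𝓝 (xb, xb, pb), t.2.1 ∈ ball xb (min δ₁ δ₂) :=
    ((continuous_fst.comp continuous_snd).tendsto' _ _ rfl).eventually (ball_mem_nhds _ hδ)
  have hp : ∀ᶠ t : E × E × F in 𝓝 (xb, xb, pb), t.2.2 ∈ ball pb (min δ₁ δ₂) :=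
    ((continuous_snd.comp continuous_snd).tendsto' _ _ rfl).eventually (ball_mem_nhds _ hδ)
  filter_upwards [hx1, hx2, hp] with ⟨x₁, x₂, p⟩ hx₁ hx₂ hp
  dsimp only at hx₁ hx₂ hp ⊢
  set d := x₁ - x₂ with hd
  have hseg : ∀ t ∈ Icc (0 : ℝ) 1, (x₂ + t • d, p) ∈ ball (xb, pb) (min δ₁ δ₂) := by
    intro t ht
    rw [← ball_prod_same]
    refine ⟨?_, hp⟩
    exact (convex_ball xb (min δ₁ δ₂)).add_smul_sub_mem hx₂ hx₁ ht
  let γ : ℝ → ℝ := fun t => h (x₂ + t • d) p - t * ⟪pgrad h x₂ p, d⟫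
    - t ^ 2 * (⟪phess h xb pb d, d⟫ / 2)
  have hγ : ∀ t ∈ Icc (0 : ℝ) 1, HasDerivWithinAt γ
      (⟪pgrad h (x₂ + t • d) p, d⟫ - ⟪pgrad h x₂ p, d⟫ - t * ⟪phess h xb pb d, d⟫)
      (Icc 0 1) t := by
    intro t ht
    have hdiff := h2 (ball_subset_ball (min_le_right _ _) (hseg t ht))
    have hg := (hasGradientAt_pgrad hdiff).hasFDerivAt
    have hl : HasDerivAt (fun t : ℝ => x₂ + t • d) d t := by
      simpa using ((hasDerivAt_id t).smul_const d).const_add x₂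
    have h3 := hg.comp_hasDerivAt t hl
    have h4 := (h3.sub ((hasDerivAt_id t).mul_const ⟪pgrad h x₂ p, d⟫)).sub
      (((hasDerivAt_id t).pow 2).mul_const (⟪phess h xb pb d, d⟫ / 2))
    refine (h4.congr_deriv ?_).hasDerivWithinAt
    simp
    ring
  have hbound : ∀ t ∈ Ico (0 : ℝ) 1,
      ‖⟪pgrad h (x₂ + t • d) p, d⟫ - ⟪pgrad h x₂ p, d⟫ - t * ⟪phess h xb pb d, d⟫‖
        ≤ ε * ‖d‖ ^ 2 := by
    intro t ht
    have ht' : t ∈ Icc (0 : ℝ) 1 := ⟨ht.1, ht.2.le⟩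
    have h0 : ((x₂ : E), p) ∈ ball (xb, pb) (min δ₁ δ₂) := by
      simpa using hseg 0 (by simp)
    have h3 := @h1 ((x₂ + t • d, p), (x₂, p))
      ⟨ball_subset_ball (min_le_left _ _) (hseg t ht'), ball_subset_ball (min_le_left _ _) h0⟩
    have e1 : ((x₂ + t • d, p) : E × F) - (x₂, p) = t • (d, 0) := by simp
    simp only [e1, map_smul] at h3
    have e2 : ⟪pgrad h (x₂ + t • d) p, d⟫ - ⟪pgrad h x₂ p, d⟫ - t * ⟪phess h xb pb d, d⟫
        = ⟪pgrad h (x₂ + t • d) p - pgrad h x₂ p - t • phess h xb pb d, d⟫ := by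
      simp [inner_sub_left, inner_smul_left]
    rw [e2]
    refine (norm_inner_le_norm _ _).trans ?_
    have h4 : ‖t • ((d, 0) : E × F)‖ ≤ ‖d‖ := by
      rw [norm_smul, Prod.norm_mk]
      simp only [norm_zero, norm_nonneg, sup_of_le_left, Real.norm_eq_abs, abs_of_nonneg ht.1]
      nlinarith [norm_nonneg d, ht.2]
    have h5 : ‖pgrad h (x₂ + t • d) p - pgrad h x₂ p - t • phess h xb pb d‖ ≤ ε * ‖d‖ :=
      h3.trans (mul_le_mul_of_nonneg_left h4 hε.le)
    nlinarith [norm_nonneg d]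
  have h6 := norm_image_sub_le_of_norm_deriv_le_segment_01' hγ hbound
  have e3 : x₂ + d = x₁ := by simp [hd]
  simp only [γ, one_smul, zero_smul, e3] at h6
  convert h6 using 1
  · congr 1
    simp
    ring
  · simp

theorem tendsto_sq_mul_taylor {κ : Type*}
    (hh : ContDiffAt ℝ 2 (fun t : E × F => h t.1 t.2) (xb, pb)) {l : Filter κ}
    {x₁ x₂ : κ → E} {p : κ → F} {c : κ → ℝ} {u : E} (h₁ : Tendsto x₁ l (𝓝 xb))
    (h₂ : Tendsto x₂ l (𝓝 xb)) (hp : Tendsto p l (𝓝 pb))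
    (hc : Tendsto (fun k => c k • (x₁ k - x₂ k)) l (𝓝 u)) :
    Tendsto (fun k => c k ^ 2 * (h (x₁ k) (p k) - h (x₂ k) (p k)
      - ⟪pgrad h (x₂ k) (p k), x₁ k - x₂ k⟫)) l (𝓝 (⟪phess h xb pb u, u⟫ / 2)) := by
  have h3 := (isLittleO_second_order_taylor hh).comp_tendsto
    (h₁.prodMk_nhds (h₂.prodMk_nhds hp))
  have h4 := (Asymptotics.isBigO_refl (fun k => c k ^ 2) l).mul_isLittleO h3
  have h5 : (fun k => c k ^ 2 * ‖x₁ k - x₂ k‖ ^ 2) =O[l] fun _ => (1 : ℝ) := by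
    have := (hc.norm.pow 2).isBigO_one ℝ
    refine this.congr_left fun k => ?_
    rw [norm_smul, mul_pow, Real.norm_eq_abs, sq_abs]
  have h6 := h4.trans_isBigO h5
  rw [Asymptotics.isLittleO_one_iff] at h6
  have hcont : Continuous fun u : E => ⟪phess h xb pb u, u⟫ / 2 := by
    unfold phess
    fun_prop
  have h7 := h6.add ((hcont.tendsto u).comp hc)
  simp only [zero_add] at h7
  refine h7.congr fun k => ?_
  have e : phess h xb pb (c k • (x₁ k - x₂ k)) = c k • phess h xb pb (x₁ k - x₂ k) := by
    unfold phess
    rw [← map_smul]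
    simp
  simp only [Function.comp, e, inner_smul_left, inner_smul_right, RCLike.conj_to_real]
  ring

end Taylor

/-- Feasible set of the inequality system `φ i x p ≤ 0`. -/
def feas (φ : ι → E → F → ℝ) (p : F) : Set E := {x | ∀ i, φ i x p ≤ 0}

/-- `lam` is a multiplier certifying that `y` is normal to the feasible set at `x`. -/
def IsKKT (φ : ι → E → F → ℝ) (x : E) (p : F) (lam : ι → ℝ) (y : E) : Prop :=
  (∀ i, 0 ≤ lam i) ∧ (∀ i, φ i x p ≤ 0) ∧ (∀ i, lam i * φ i x p = 0) ∧
    y = ∑ i, lam i • pgrad (φ i) x p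

section Normals

variable {φ : ι → E → F → ℝ} {xb : E} {pb : F}

theorem IsKKT.of_tendsto {κ : Type*} {l : Filter κ} [l.NeBot] {x : κ → E} {p : κ → F}
    {lam : κ → ι → ℝ} {y : κ → E} {x₀ : E} {p₀ : F} {lam₀ : ι → ℝ} {y₀ : E}
    (hφ : ∀ i, ContinuousAt (fun t : E × F => φ i t.1 t.2) (x₀, p₀))
    (hg : ∀ i, ContinuousAt (fun t : E × F => pgrad (φ i) t.1 t.2) (x₀, p₀))
    (hx : Tendsto x l (𝓝 x₀)) (hp : Tendsto p l (𝓝 p₀)) (hlam : Tendsto lam l (𝓝 lam₀))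
    (hy : Tendsto y l (𝓝 y₀)) (h : ∀ᶠ k in l, IsKKT φ (x k) (p k) (lam k) (y k)) :
    IsKKT φ x₀ p₀ lam₀ y₀ := by
  have hxp := hx.prodMk_nhds hp
  have hlam' := tendsto_pi_nhds.1 hlam
  have hφ' : ∀ i, Tendsto (fun k => φ i (x k) (p k)) l (𝓝 (φ i x₀ p₀)) :=
    fun i => (hφ i).tendsto.comp hxp
  have hg' : ∀ i, Tendsto (fun k => pgrad (φ i) (x k) (p k)) l (𝓝 (pgrad (φ i) x₀ p₀)) :=
    fun i => (hg i).tendsto.comp hxp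
  refine ⟨fun i => ge_of_tendsto (hlam' i) (h.mono fun k hk => hk.1 i),
    fun i => le_of_tendsto (hφ' i) (h.mono fun k hk => hk.2.1 i), fun i => ?_, ?_⟩
  · exact tendsto_nhds_unique (((hlam' i).mul (hφ' i)).congr' (h.mono fun k hk => hk.2.2.1 i))
      tendsto_const_nhds
  · exact tendsto_nhds_unique hy ((tendsto_finsetSum _ fun i _ =>
      (hlam' i).smul (hg' i)).congr' (h.mono fun k hk => hk.2.2.2.symm))

omit [Fintype ι] in
theorem exists_tendsto_of_bounded_multipliers {κ : Type*} (l : Ultrafilter κ) {lam : κ → ι → ℝ}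
    {B : ℝ} (h : ∀ᶠ k in l, ∀ i, 0 ≤ lam k i ∧ lam k i ≤ B) :
    ∃ lam₀, Tendsto lam l (𝓝 lam₀) := by
  have hK : IsCompact (Set.univ.pi fun _ : ι => Icc (0 : ℝ) B) :=
    isCompact_univ_pi fun _ => isCompact_Icc
  obtain ⟨a, -, ha⟩ := hK.ultrafilter_le_nhds (l.map lam)
    (by
      rw [le_principal_iff]
      exact h.mono fun k hk i _ => hk i)
  exact ⟨a, ha⟩

theorem IsKKT.le_of_slater {x : E} {p : F} {lam : ι → ℝ} {y d : E} {c : ℝ} (hc : 0 < c)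
    (hd : ∀ i, φ i x p = 0 → ⟪pgrad (φ i) x p, d⟫ < -c) (h : IsKKT φ x p lam y) (i : ι) :
    lam i ≤ ‖d‖ / c * ‖y‖ := by
  obtain ⟨h0, -, hcomp, rfl⟩ := h
  have hterm : ∀ j, lam j * ⟪pgrad (φ j) x p, d⟫ ≤ -c * lam j := by
    intro j
    rcases mul_eq_zero.1 (hcomp j) with hj | hj
    · simp [hj]
    · nlinarith [hd j hj, h0 j]
  have h1 : ⟪∑ j, lam j • pgrad (φ j) x p, d⟫ ≤ -c * lam i := by
    rw [sum_inner]
    simp only [inner_smul_left, RCLike.conj_to_real]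
    refine (Finset.sum_le_sum fun j _ => hterm j).trans ?_
    rw [← Finset.mul_sum]
    have := Finset.single_le_sum (f := lam) (fun j _ => h0 j) (Finset.mem_univ i)
    nlinarith
  have h2 := (abs_le.1 (abs_real_inner_le_norm (∑ j, lam j • pgrad (φ j) x p) d)).1
  rw [div_mul_eq_mul_div, le_div_iff₀ hc]
  linarith [mul_comm ‖∑ j, lam j • pgrad (φ j) x p‖ ‖d‖]

theorem IsKKT.mem_regNC {x : E} {p : F} {lam : ι → ℝ} {y : E}
    (hg : ∀ i, HasGradientAt (fun z => φ i z p) (pgrad (φ i) x p) x) (h : IsKKT φ x p lam y) :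
    y ∈ regNC (feas φ p) x := by
  intro ε hε
  obtain ⟨h0, -, hcomp, rfl⟩ := h
  have h1 : (fun z => ∑ i, lam i * (φ i z p - φ i x p - ⟪pgrad (φ i) x p, z - x⟫))
      =o[𝓝 x] fun z => z - x := by
    refine Asymptotics.IsLittleO.fun_sum fun i _ => ?_
    have h2 := hasGradientAt_iff_isLittleO.1 (hg i)
    exact h2.const_mul_left (lam i)
  filter_upwards [(h1.def hε).filter_mono nhdsWithin_le_nhds, self_mem_nhdsWithin] with z hz hzf
  rw [sum_inner]
  simp only [inner_smul_left, RCLike.conj_to_real]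
  have h2 : ∑ i, lam i * (φ i z p - φ i x p - ⟪pgrad (φ i) x p, z - x⟫)
      ≤ - ∑ i, lam i * ⟪pgrad (φ i) x p, z - x⟫ := by
    rw [← Finset.sum_neg_distrib]
    refine Finset.sum_le_sum fun i _ => ?_
    have := hcomp i
    nlinarith [mul_nonneg (h0 i) (neg_nonneg.2 (hzf i))]
  have h3 := (abs_le.1 hz).1
  linarith

theorem regNC_subset_limNC {Ω : Set E} {x : E} (hx : x ∈ Ω) : regNC Ω x ⊆ limNC Ω x :=
  fun v hv => ⟨fun _ => x, fun _ => v, fun _ => hx, tendsto_const_nhds, fun _ => hv,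
    tendsto_const_nhds⟩

theorem IsKKT.mem_limNC {x : E} {p : F} {lam : ι → ℝ} {y : E}
    (hg : ∀ i, HasGradientAt (fun z => φ i z p) (pgrad (φ i) x p) x) (h : IsKKT φ x p lam y) :
    y ∈ limNC (feas φ p) x :=
  regNC_subset_limNC (Ω := feas φ p) h.2.1 (h.mem_regNC hg)

theorem eventually_feasible_of_gradient_neg {x : E} {p : F} {w : E} (hx : x ∈ feas φ p)
    (hg : ∀ i, HasGradientAt (fun z => φ i z p) (pgrad (φ i) x p) x)
    (hw : ∀ i, φ i x p = 0 → ⟪pgrad (φ i) x p, w⟫ < 0) :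
    ∀ᶠ t : ℝ in 𝓝[>] 0, ∀ i, φ i (x + t • w) p < 0 := by
  rw [eventually_all]
  intro i
  have hl : HasDerivAt (fun t : ℝ => x + t • w) w 0 := by
    simpa using ((hasDerivAt_id (0 : ℝ)).smul_const w).const_add x
  have h1 : HasDerivAt (fun t : ℝ => φ i (x + t • w) p) ⟪pgrad (φ i) x p, w⟫ 0 := by
    have h2 : HasFDerivAt (fun z => φ i z p) (InnerProductSpace.toDual ℝ E (pgrad (φ i) x p))
        (x + (0 : ℝ) • w) := by simpa using (hg i).hasFDerivAt
    simpa [Function.comp_def] using h2.comp_hasDerivAt 0 hl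
  rcases (hx i).lt_or_eq with hi | hi
  · have h2 : Tendsto (fun t : ℝ => φ i (x + t • w) p) (𝓝 0) (𝓝 (φ i x p)) := by
      simpa using h1.continuousAt.tendsto
    exact (h2.eventually (gt_mem_nhds hi)).filter_mono nhdsWithin_le_nhds
  · have h2 := (hasDerivAt_iff_tendsto_slope.1 h1).mono_left
      (nhdsWithin_mono (0 : ℝ) (fun t (ht : 0 < t) => ht.ne' : Ioi (0 : ℝ) ⊆ {0}ᶜ))
    filter_upwards [h2.eventually (gt_mem_nhds (hw i hi)), self_mem_nhdsWithin] with t ht ht0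
    simp only [slope_def_field, zero_smul, add_zero, hi, sub_zero] at ht
    exact (div_neg_iff.1 ht).resolve_left (fun h => absurd h.2 (not_lt.2 (le_of_lt ht0))) |>.1

theorem isClosed_setOf_isKKT {x d : E} {p : F} {c : ℝ} (hc : 0 < c)
    (hd : ∀ i, φ i x p = 0 → ⟪pgrad (φ i) x p, d⟫ < -c) :
    IsClosed {y | ∃ lam, IsKKT φ x p lam y} := by
  rw [isClosed_iff_ultrafilter]
  intro y l hl hmem
  have hl' : Tendsto id (l : Filter E) (𝓝 y) := hl
  choose! lam hlam using fun (y : E) (hy : y ∈ {y | ∃ lam, IsKKT φ x p lam y}) => hy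
  have hev : ∀ᶠ z in (l : Filter E), IsKKT φ x p (lam z) z := mem_of_superset hmem hlam
  have hb : ∀ᶠ z in (l : Filter E), ∀ i, 0 ≤ lam z i ∧ lam z i ≤ ‖d‖ / c * (‖y‖ + 1) := by
    filter_upwards [hev, hl'.norm.eventually (gt_mem_nhds (lt_add_one ‖y‖))] with z hz hz1 i
    refine ⟨hz.1 i, (hz.le_of_slater hc hd i).trans ?_⟩
    have : 0 ≤ ‖d‖ / c := by positivity
    exact mul_le_mul_of_nonneg_left hz1.le this
  obtain ⟨lam₀, h0⟩ := exists_tendsto_of_bounded_multipliers l hb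
  have h0' := tendsto_pi_nhds.1 h0
  refine ⟨lam₀, fun i => ge_of_tendsto (h0' i) (hev.mono fun k hk => hk.1 i), ?_, fun i => ?_, ?_⟩
  · obtain ⟨z, hz⟩ := hev.exists
    exact hz.2.1
  · exact tendsto_nhds_unique (((h0' i).mul_const (φ i x p)).congr'
      (hev.mono fun k hk => hk.2.2.1 i)) tendsto_const_nhds
  · exact tendsto_nhds_unique hl' ((tendsto_finsetSum _ fun i _ =>
      (h0' i).smul_const (pgrad (φ i) x p)).congr' (hev.mono fun k hk => hk.2.2.2.symm))

theorem IsKKT.add {x : E} {p : F} {lam mu : ι → ℝ} {y z : E} (hy : IsKKT φ x p lam y)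
    (hz : IsKKT φ x p mu z) : IsKKT φ x p (lam + mu) (y + z) := by
  refine ⟨fun i => add_nonneg (hy.1 i) (hz.1 i), hy.2.1, fun i => ?_, ?_⟩
  · simp [add_mul, hy.2.2.1 i, hz.2.2.1 i]
  · simp [add_smul, Finset.sum_add_distrib, ← hy.2.2.2, ← hz.2.2.2]

theorem IsKKT.smul {x : E} {p : F} {lam : ι → ℝ} {y : E} (hy : IsKKT φ x p lam y) {r : ℝ}
    (hr : 0 ≤ r) : IsKKT φ x p (r • lam) (r • y) := by
  refine ⟨fun i => mul_nonneg hr (hy.1 i), hy.2.1, fun i => ?_, ?_⟩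
  · simp [mul_assoc, hy.2.2.1 i]
  · simp [mul_smul, ← Finset.smul_sum, ← hy.2.2.2]

/-- Under a Slater-type direction, regular normals are generated by the active gradients. -/
theorem exists_isKKT_of_mem_regNC {x d v : E} {p : F} {c : ℝ} (hc : 0 < c)
    (hd : ∀ i, φ i x p = 0 → ⟪pgrad (φ i) x p, d⟫ < -c) (hx : x ∈ feas φ p)
    (hg : ∀ i, HasGradientAt (fun z => φ i z p) (pgrad (φ i) x p) x)
    (hv : v ∈ regNC (feas φ p) x) : ∃ lam, IsKKT φ x p lam v := by
  classical
  by_contra hcon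
  set K : Set E := {y | ∃ lam, IsKKT φ x p lam y} with hK
  have hconv : Convex ℝ K := by
    rintro y ⟨l₁, h₁⟩ z ⟨l₂, h₂⟩ a b ha hb -
    exact ⟨_, (h₁.smul ha).add (h₂.smul hb)⟩
  obtain ⟨f, u, hfu, hfv⟩ := geometric_hahn_banach_closed_point hconv
    (isClosed_setOf_isKKT hc hd) (show v ∉ K from hcon)
  set w := (InnerProductSpace.toDual ℝ E).symm f with hw
  have hfw : ∀ z, f z = ⟪z, w⟫ := fun z => by
    rw [real_inner_comm, hw, InnerProductSpace.toDual_symm_apply]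
  have hzero : IsKKT φ x p 0 0 := ⟨by simp, hx, by simp, by simp⟩
  have hu : 0 < u := by simpa using hfu 0 ⟨0, hzero⟩
  have hgen : ∀ i, φ i x p = 0 → ⟪pgrad (φ i) x p, w⟫ ≤ 0 := by
    intro i hi
    by_contra! hpos
    have hk : IsKKT φ x p (Pi.single i (u / ⟪pgrad (φ i) x p, w⟫))
        ((u / ⟪pgrad (φ i) x p, w⟫) • pgrad (φ i) x p) := by
      refine ⟨fun j => ?_, hx, fun j => ?_, ?_⟩
      · by_cases hj : j = i
        · subst hj; simp; positivity
        · simp [hj]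
      · by_cases hj : j = i
        · subst hj; simp [hi]
        · simp [hj]
      · simp [Pi.single_apply]
    have := hfu _ ⟨_, hk⟩
    rw [map_smul, hfw, smul_eq_mul, div_mul_cancel₀ _ hpos.ne'] at this
    exact lt_irrefl _ this
  have hvw : 0 < ⟪v, w⟫ := by rw [← hfw]; exact hu.trans hfv
  have hη : ∀ᶠ η : ℝ in 𝓝[>] 0, 0 < ⟪v, w + η • d⟫ := by
    have : Tendsto (fun η : ℝ => ⟪v, w + η • d⟫) (𝓝 0) (𝓝 ⟪v, w⟫) := by
      refine Continuous.tendsto' (by fun_prop) _ _ (by simp)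
    exact (this.eventually (lt_mem_nhds hvw)).filter_mono nhdsWithin_le_nhds
  obtain ⟨η, hη, hη0⟩ := (hη.and self_mem_nhdsWithin).exists
  have hη0 : 0 < η := hη0
  have hw' : ∀ i, φ i x p = 0 → ⟪pgrad (φ i) x p, w + η • d⟫ < 0 := by
    intro i hi
    rw [inner_add_right, inner_smul_right]
    nlinarith [hgen i hi, hd i hi]
  have hfeas := eventually_feasible_of_gradient_neg hx hg hw'
  set w' := w + η • d
  have hw0 : 0 < ‖w'‖ := by
    rw [norm_pos_iff]
    rintro h
    simp [h] at hη
  have htend : Tendsto (fun t : ℝ => x + t • w') (𝓝[>] 0) (𝓝[feas φ p] x) := by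
    refine tendsto_nhdsWithin_iff.2 ⟨?_, hfeas.mono fun t ht i => (ht i).le⟩
    exact (Continuous.tendsto' (by fun_prop) _ _ (by simp)).mono_left nhdsWithin_le_nhds
  have hfin := htend.eventually (hv (⟪v, w'⟫ / (2 * ‖w'‖)) (by positivity))
  obtain ⟨t, ht, ht0⟩ := (hfin.and self_mem_nhdsWithin).exists
  have ht0 : 0 < t := ht0
  rw [add_sub_cancel_left, inner_smul_right, norm_smul, Real.norm_eq_abs, abs_of_pos ht0] at ht
  have e : ⟪v, w'⟫ / (2 * ‖w'‖) * (t * ‖w'‖) = t * ⟪v, w'⟫ / 2 := by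
    field_simp
  rw [e] at ht
  nlinarith [mul_pos ht0 hη]

end Normals

/-- Pointwise regularity of the system at `t = (x, p)` with uniform Slater direction `d`. -/
structure SlaterRegularAt (φ : ι → E → F → ℝ) (d : E) (c : ℝ) (t : E × F) : Prop where
  hasGradientAt : ∀ i, HasGradientAt (fun z => φ i z t.2) (pgrad (φ i) t.1 t.2) t.1
  continuousAt : ∀ i, ContinuousAt (fun t : E × F => φ i t.1 t.2) t
  continuousAt_pgrad : ∀ i, ContinuousAt (fun t : E × F => pgrad (φ i) t.1 t.2) t
  slater : ∀ i, φ i t.1 t.2 = 0 → ⟪pgrad (φ i) t.1 t.2, d⟫ < -c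

section LocalNormals

variable {φ : ι → E → F → ℝ} {xb : E} {pb : F}

theorem eventually_slaterRegularAt {d : E}
    (hφ : ∀ i, ContDiffAt ℝ 2 (fun t : E × F => φ i t.1 t.2) (xb, pb))
    (hd : ∀ i, φ i xb pb = 0 → ⟪pgrad (φ i) xb pb, d⟫ < 0) :
    ∃ c > 0, ∀ᶠ t in 𝓝 (xb, pb), SlaterRegularAt φ d c t := by
  have h1 : ∀ᶠ c : ℝ in 𝓝[>] 0, ∀ i, φ i xb pb = 0 → ⟪pgrad (φ i) xb pb, d⟫ < -c := by
    rw [eventually_all]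
    intro i
    by_cases hi : φ i xb pb = 0
    · have : Tendsto (fun c : ℝ => -c) (𝓝 0) (𝓝 0) := Continuous.tendsto' (by fun_prop) _ _ (by simp)
      filter_upwards [(this.eventually (lt_mem_nhds (hd i hi))).filter_mono nhdsWithin_le_nhds]
        with c hc _ using hc
    · exact Eventually.of_forall fun c h => absurd h hi
  obtain ⟨c, hc, hc0⟩ := (h1.and self_mem_nhdsWithin).exists
  have h2 : ∀ᶠ t in 𝓝 (xb, pb), ∀ i,
      DifferentiableAt ℝ (fun t : E × F => φ i t.1 t.2) t :=
    eventually_all.2 fun i => eventually_differentiableAt_of_contDiffAt (hφ i)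
  have h3 : ∀ᶠ t in 𝓝 (xb, pb), ∀ i,
      ContinuousAt (fun t : E × F => pgrad (φ i) t.1 t.2) t :=
    eventually_all.2 fun i => eventually_continuousAt_pgrad (hφ i)
  have h4 : ∀ᶠ t in 𝓝 (xb, pb), ∀ i, φ i t.1 t.2 = 0 → ⟪pgrad (φ i) t.1 t.2, d⟫ < -c := by
    refine eventually_all.2 fun i => ?_
    by_cases hi : φ i xb pb = 0
    · have h5 : ContinuousAt (fun t : E × F => ⟪pgrad (φ i) t.1 t.2, d⟫) (xb, pb) :=
        (h3.self_of_nhds i).inner continuousAt_const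
      exact (h5.eventually (gt_mem_nhds (hc i hi))).mono fun t ht _ => ht
    · have h5 : ContinuousAt (fun t : E × F => φ i t.1 t.2) (xb, pb) :=
        (h2.self_of_nhds i).continuousAt
      exact (h5.eventually_ne hi).mono fun t ht h => absurd h ht
  refine ⟨c, hc0, ?_⟩
  filter_upwards [h2, h3, h4] with t h2 h3 h4
  exact ⟨fun i => hasGradientAt_pgrad (h2 i), fun i => (h2 i).continuousAt, h3, h4⟩

theorem SlaterRegularAt.isKKT_of_tendsto {κ : Type*} {l : Ultrafilter κ} {d : E} {c : ℝ}
    (hc : 0 < c) {x : κ → E} {p : κ → F} {y : κ → E} {lam : κ → ι → ℝ} {x₀ : E} {p₀ : F} {y₀ : E}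
    (hreg : ∀ᶠ t in 𝓝 (x₀, p₀), SlaterRegularAt φ d c t)
    (hx : Tendsto x l (𝓝 x₀)) (hp : Tendsto p l (𝓝 p₀)) (hy : Tendsto y l (𝓝 y₀))
    (h : ∀ᶠ k in l, IsKKT φ (x k) (p k) (lam k) (y k)) :
    ∃ lam₀, Tendsto lam l (𝓝 lam₀) ∧ IsKKT φ x₀ p₀ lam₀ y₀ := by
  have hb : ∀ᶠ k in (l : Filter κ), ∀ i, 0 ≤ lam k i ∧ lam k i ≤ ‖d‖ / c * (‖y₀‖ + 1) := by
    filter_upwards [h, (hx.prodMk_nhds hp).eventually hreg,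
      hy.norm.eventually (gt_mem_nhds (lt_add_one ‖y₀‖))] with k hk hr hk1 i
    refine ⟨hk.1 i, (hk.le_of_slater hc hr.slater i).trans ?_⟩
    exact mul_le_mul_of_nonneg_left hk1.le (by positivity)
  obtain ⟨lam₀, h0⟩ := exists_tendsto_of_bounded_multipliers l hb
  have hr := hreg.self_of_nhds
  exact ⟨lam₀, h0, IsKKT.of_tendsto hr.continuousAt hr.continuousAt_pgrad hx hp h0 hy h⟩

theorem eventually_mem_limNC_iff {d : E} {c : ℝ} (hc : 0 < c)
    (hreg : ∀ᶠ t in 𝓝 (xb, pb), SlaterRegularAt φ d c t) :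
    ∀ᶠ t in 𝓝 (xb, pb), ∀ y, y ∈ limNC (feas φ t.2) t.1 ↔ ∃ lam, IsKKT φ t.1 t.2 lam y := by
  filter_upwards [eventually_eventually_nhds.2 hreg] with ⟨x, p⟩ ht y
  constructor
  · rintro ⟨xs, vs, hxs, hxlim, hvs, hvlim⟩
    have h1 : ∀ᶠ k in (hyperfilter ℕ : Filter ℕ), ∃ lam, IsKKT φ (xs k) p lam (vs k) := by
      have h2 := ((hxlim.prodMk_nhds (tendsto_const_nhds (x := p))).eventually ht).filter_mono
        Nat.hyperfilter_le_atTop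
      filter_upwards [h2] with k hk
      exact exists_isKKT_of_mem_regNC hc hk.slater (hxs k) hk.hasGradientAt (hvs k)
    obtain ⟨lam, hlam⟩ := h1.choice
    obtain ⟨lam₀, -, h⟩ := SlaterRegularAt.isKKT_of_tendsto hc ht
      (hxlim.mono_left Nat.hyperfilter_le_atTop) tendsto_const_nhds
      (hvlim.mono_left Nat.hyperfilter_le_atTop) hlam
    exact ⟨lam₀, h⟩
  · rintro ⟨lam, h⟩
    exact h.mem_limNC ht.self_of_nhds.hasGradientAt

end LocalNormals

/-- Conic Carathéodory theorem. -/
theorem exists_nonneg_linearIndepOn_sum_eq (v : ι → E) (lam : ι → ℝ) (h0 : ∀ i, 0 ≤ lam i) :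
    ∃ mu : ι → ℝ, ∃ J : Finset ι, (∀ i, 0 ≤ mu i) ∧ (∀ i ∉ J, mu i = 0) ∧
      (∀ i ∈ J, lam i ≠ 0) ∧ ∑ i, mu i • v i = ∑ i, lam i • v i ∧
      LinearIndepOn ℝ v (J : Set ι) := by
  classical
  induction hn : (Finset.univ.filter fun i => lam i ≠ 0).card using Nat.strong_induction_on
    generalizing lam with
  | _ n ih =>
    set J := Finset.univ.filter fun i => lam i ≠ 0 with hJ
    by_cases hli : LinearIndepOn ℝ v (J : Set ι)
    · exact ⟨lam, J, h0, by simp [hJ], by simp [hJ], rfl, hli⟩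
    obtain ⟨g₀, hg₀, j₀, hj₀, hj₀'⟩ : ∃ g : ι → ℝ, ∑ i ∈ J, g i • v i = 0 ∧ ∃ i ∈ J, g i ≠ 0 := by
      rw [linearIndepOn_finset_iff] at hli
      push Not at hli
      exact hli
    obtain ⟨g, hg, j, hj, hgj⟩ : ∃ g : ι → ℝ, ∑ i ∈ J, g i • v i = 0 ∧ ∃ i ∈ J, 0 < g i := by
      rcases hj₀'.lt_or_gt with h | h
      · exact ⟨-g₀, by simp [hg₀], j₀, hj₀, by simpa using h⟩
      · exact ⟨g₀, hg₀, j₀, hj₀, h⟩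
    obtain ⟨k, hk, hmin⟩ := (J.filter fun i => 0 < g i).exists_min_image (fun i => lam i / g i)
      ⟨j, by simp [hj, hgj]⟩
    simp only [Finset.mem_filter] at hk hmin
    set mu : ι → ℝ := fun i => if i ∈ J then lam i - lam k / g k * g i else 0 with hmu
    have hmu0 : ∀ i, 0 ≤ mu i := by
      intro i
      by_cases hi : i ∈ J
      · simp only [hmu, hi, if_true]
        rcases lt_or_ge 0 (g i) with hgi | hgi
        · have := hmin i ⟨hi, hgi⟩
          rw [le_div_iff₀ hgi] at this
          linarith
        · have : 0 ≤ lam k / g k := div_nonneg (h0 k) hk.2.le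
          nlinarith [h0 i]
      · simp [hmu, hi]
    have hsub : (Finset.univ.filter fun i => mu i ≠ 0) ⊂ J := by
      refine Finset.ssubset_iff_subset_ne.2 ⟨fun i hi => ?_, fun h => ?_⟩
      · by_contra hiJ
        simp [hmu, hiJ] at hi
      · have : k ∈ Finset.univ.filter fun i => mu i ≠ 0 := h ▸ hk.1
        simp [hmu, hk.1, div_mul_cancel₀ _ hk.2.ne'] at this
    have hsum : ∑ i, mu i • v i = ∑ i, lam i • v i := by
      have e1 : ∑ i, mu i • v i = ∑ i ∈ J, (lam i - lam k / g k * g i) • v i := by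
        exact (Finset.sum_subset (Finset.subset_univ J)
          (fun i _ hi => by simp [hmu, hi])).symm.trans
          (Finset.sum_congr rfl fun i hi => by simp [hmu, hi])
      have e2 : ∑ i, lam i • v i = ∑ i ∈ J, lam i • v i := by
        refine (Finset.sum_subset (Finset.subset_univ J) fun i _ hi => ?_).symm
        simp [hJ] at hi
        simp [hi]
      rw [e1, e2]
      simp only [sub_smul, mul_smul, Finset.sum_sub_distrib, ← Finset.smul_sum, hg, smul_zero,
        sub_zero]
    obtain ⟨nu, J', hnu0, hnuJ, hJ', hs, hli'⟩ := ih _ (hn ▸ Finset.card_lt_card hsub) mu hmu0 rfl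
    refine ⟨nu, J', hnu0, hnuJ, fun i hi => ?_, hs.trans hsum, hli'⟩
    have : i ∈ J := hsub.1 (by simpa using hJ' i hi)
    simpa [hJ] using this

section ConstantRank

variable {φ : ι → E → F → ℝ} {xb : E} {pb : F}

/-- Under the constant rank condition, multipliers near the reference point can be supported on
families of gradients that are linearly independent at the reference point. -/
theorem eventually_exists_isKKT_linearIndepOn
    (hφ : ∀ i, ContinuousAt (fun t : E × F => φ i t.1 t.2) (xb, pb))
    (hcr : ∃ Wn ∈ 𝓝 (xb, pb), ∀ J : Finset ι, (∀ i ∈ J, φ i xb pb = 0) →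
        ∀ t₁ ∈ Wn, ∀ t₂ ∈ Wn,
          Module.finrank ℝ ↥(Submodule.span ℝ ((fun i => pgrad (φ i) t₁.1 t₁.2) '' (J : Set ι)))
            = Module.finrank ℝ
              ↥(Submodule.span ℝ ((fun i => pgrad (φ i) t₂.1 t₂.2) '' (J : Set ι)))) :
    ∀ᶠ t in 𝓝 (xb, pb), ∀ lam y, IsKKT φ t.1 t.2 lam y → ∃ J : Finset ι,
      LinearIndepOn ℝ (fun i => pgrad (φ i) xb pb) (J : Set ι) ∧ ∃ mu, IsKKT φ t.1 t.2 mu y ∧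
        (∀ i ∉ J, mu i = 0) ∧ ∀ i ∈ J, φ i t.1 t.2 = 0 := by
  obtain ⟨Wn, hWn, hcr⟩ := hcr
  have h1 : ∀ᶠ t in 𝓝 (xb, pb), ∀ i, φ i t.1 t.2 = 0 → φ i xb pb = 0 := by
    refine eventually_all.2 fun i => ?_
    by_cases hi : φ i xb pb = 0
    · exact Eventually.of_forall fun _ _ => hi
    · exact ((hφ i).eventually_ne hi).mono fun t ht h => absurd h ht
  filter_upwards [h1, hWn] with t h1 htW lam y h
  obtain ⟨mu, J, hmu0, hmuJ, hJ, hs, hli⟩ :=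
    exists_nonneg_linearIndepOn_sum_eq (fun i => pgrad (φ i) t.1 t.2) lam h.1
  have hact : ∀ i ∈ J, φ i t.1 t.2 = 0 := fun i hi =>
    (mul_eq_zero.1 (h.2.2.1 i)).resolve_left (hJ i hi)
  refine ⟨J, ?_, mu, ⟨hmu0, h.2.1, fun i => ?_, h.2.2.2.trans hs.symm⟩, hmuJ, hact⟩
  · have hr := hcr J (fun i hi => h1 i (hact i hi)) t htW (xb, pb) (mem_of_mem_nhds hWn)
    rw [LinearIndepOn, linearIndependent_iff_card_eq_finrank_span, Set.finrank] at hli ⊢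
    have hrange : ∀ v : ι → E, Set.range (fun i : (J : Set ι) => v i) = v '' (J : Set ι) :=
      fun v => by rw [Set.image_eq_range]
    rw [hrange (fun i => pgrad (φ i) xb pb)]
    rw [hrange (fun i => pgrad (φ i) t.1 t.2)] at hli
    rw [hli, hr]
  · by_cases hi : i ∈ J
    · simp [hact i hi]
    · simp [hmuJ i hi]

end ConstantRank

/-- The general strong second-order sufficient condition, with `A` the partial Jacobian of the
base map and `yb` the reference normal. -/
def GSSOSC (φ : ι → E → F → ℝ) (xb : E) (pb : F) (A : E →L[ℝ] E) (yb : E) : Prop :=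
  ∀ lam, IsKKT φ xb pb lam yb → ∀ u : E, u ≠ 0 →
    (∀ i, 0 < lam i → ⟪pgrad (φ i) xb pb, u⟫ = 0) →
    0 < ⟪A u, u⟫ + ∑ i, lam i * ⟪phess (φ i) xb pb u, u⟫

theorem exists_tendsto_normalize {κ : Type*} (l : Ultrafilter κ) {w : κ → E}
    (hw : ∀ k, w k ≠ 0) : ∃ u : E, ‖u‖ = 1 ∧ Tendsto (fun k => ‖w k‖⁻¹ • w k) l (𝓝 u) := by
  obtain ⟨u, hu, h⟩ := (isCompact_sphere (0 : E) 1).ultrafilter_le_nhds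
    (l.map fun k => ‖w k‖⁻¹ • w k) (by
      rw [le_principal_iff]
      exact Filter.mem_map.2 (Eventually.of_forall fun k => by simp [norm_smul, hw k]))
  exact ⟨u, by simpa using hu, h⟩

section Growth

variable {φ : ι → E → F → ℝ} {xb yb : E} {pb : F} {A : E →L[ℝ] E}

theorem tendsto_mul_sub_of_tendsto_smul {h : E → F → ℝ} {κ : Type*} {l : Filter κ}
    (hh : ContDiffAt ℝ 2 (fun t : E × F => h t.1 t.2) (xb, pb))
    {x₁ x₂ : κ → E} {p : κ → F} {c : κ → ℝ} {u : E} (h₁ : Tendsto x₁ l (𝓝 xb))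
    (h₂ : Tendsto x₂ l (𝓝 xb)) (hp : Tendsto p l (𝓝 pb))
    (hc : Tendsto (fun k => c k • (x₁ k - x₂ k)) l (𝓝 u)) :
    Tendsto (fun k => c k * (h (x₁ k) (p k) - h (x₂ k) (p k))) l
      (𝓝 ⟪pgrad h xb pb, u⟫) := by
  have h3 := tendsto_smul_sub_of_hasStrictFDerivAt (hh.hasStrictFDerivAt (by simp))
    (h₁.prodMk_nhds hp) (h₂.prodMk_nhds hp) (c := c) (w := (u, 0)) (by
      simpa using hc.prodMk_nhds (tendsto_const_nhds (x := (0 : F))))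
  rwa [fderiv_inl_eq_inner_pgrad (hh.differentiableAt (by simp))] at h3

theorem GSSOSC.exists_uniform_growth {d : E} {c : ℝ} (hc : 0 < c)
    (hφ : ∀ i, ContDiffAt ℝ 2 (fun t : E × F => φ i t.1 t.2) (xb, pb))
    (hreg : ∀ᶠ t in 𝓝 (xb, pb), SlaterRegularAt φ d c t) (hG : GSSOSC φ xb pb A yb) :
    ∃ κ > 0, ∃ ε > 0, ∀ x₁ x₂ p lam y, ‖x₁ - xb‖ < ε → ‖x₂ - xb‖ < ε → ‖p - pb‖ < ε →
      ‖y - yb‖ < ε → x₁ ∈ feas φ p → IsKKT φ x₂ p lam y →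
      κ * ‖x₁ - x₂‖ ^ 2 ≤ ⟪A (x₁ - x₂), x₁ - x₂⟫ / 2 - ⟪y, x₁ - x₂⟫ := by
  by_contra hcon
  push Not at hcon
  have hpos : ∀ k : ℕ, (0 : ℝ) < 1 / (k + 1) := fun k => by positivity
  choose x₁ x₂ p lam y hx₁ hx₂ hp hy hfeas hK hlt using
    fun k : ℕ => hcon (1 / (k + 1)) (hpos k) (1 / (k + 1)) (hpos k)
  set l : Ultrafilter ℕ := hyperfilter ℕ with hl
  have hzero : Tendsto (fun k : ℕ => (1 : ℝ) / (k + 1)) l (𝓝 0) :=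
    tendsto_one_div_add_atTop_nhds_zero_nat.mono_left Nat.hyperfilter_le_atTop
  have lim : ∀ {V : Type _} [NormedAddCommGroup V] {a : ℕ → V} {b : V},
      (∀ k : ℕ, ‖a k - b‖ < 1 / (k + 1)) → Tendsto a l (𝓝 b) := fun h =>
    tendsto_iff_norm_sub_tendsto_zero.2
      (squeeze_zero (fun _ => norm_nonneg _) (fun k => (h k).le) hzero)
  have hx₁' : Tendsto x₁ l (𝓝 xb) := lim hx₁
  have hx₂' : Tendsto x₂ l (𝓝 xb) := lim hx₂
  have hy' : Tendsto y l (𝓝 yb) := lim hy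
  have hp' : Tendsto p l (𝓝 pb) :=
    tendsto_iff_norm_sub_tendsto_zero.2
      (squeeze_zero (fun _ => norm_nonneg _) (fun k => (hp k).le) hzero)
  have hne : ∀ k, x₁ k - x₂ k ≠ 0 := by
    intro k h0
    have := hlt k
    simp [h0] at this
  obtain ⟨u, hu, hlim⟩ := exists_tendsto_normalize l hne
  have hu0 : u ≠ 0 := by
    rintro rfl
    simp at hu
  obtain ⟨lam₀, hlam, hK₀⟩ := SlaterRegularAt.isKKT_of_tendsto hc hreg hx₂' hp' hy'
    (Eventually.of_forall hK)
  set r : ℕ → ℝ := fun k => ‖x₁ k - x₂ k‖⁻¹ with hr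
  have hrpos : ∀ k, 0 < r k := fun k => inv_pos.2 (norm_pos_iff.2 (hne k))
  set T : ι → ℕ → ℝ := fun i k => r k ^ 2 * (φ i (x₁ k) (p k) - φ i (x₂ k) (p k)
      - ⟪pgrad (φ i) (x₂ k) (p k), x₁ k - x₂ k⟫) with hT
  have hTlim : ∀ i, Tendsto (T i) l (𝓝 (⟪phess (φ i) xb pb u, u⟫ / 2)) :=
    fun i => tendsto_sq_mul_taylor (hφ i) hx₁' hx₂' hp' hlim
  set R : ι → ℕ → ℝ := fun i k => -(r k ^ 2 * (lam k i * φ i (x₁ k) (p k))) with hR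
  have hR0 : ∀ i k, 0 ≤ R i k := fun i k => by
    have : lam k i * φ i (x₁ k) (p k) ≤ 0 :=
      mul_nonpos_of_nonneg_of_nonpos ((hK k).1 i) (hfeas k i)
    have := mul_nonneg (sq_nonneg (r k)) (neg_nonneg.2 this)
    simp only [hR]
    linarith
  set B : ℕ → ℝ := fun k => 1 / (k + 1) - (⟪A (r k • (x₁ k - x₂ k)), r k • (x₁ k - x₂ k)⟫ / 2
      + ∑ i, lam k i * T i k) with hB
  have hlam' := tendsto_pi_nhds.1 hlam
  have hBlim : Tendsto B l (𝓝 (0 - (⟪A u, u⟫ / 2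
      + ∑ i, lam₀ i * (⟪phess (φ i) xb pb u, u⟫ / 2)))) := by
    refine hzero.sub (Tendsto.add ?_ ?_)
    · exact (((A.continuous.tendsto u).comp hlim).inner hlim).div_const 2
    · exact tendsto_finsetSum _ fun i _ => (hlam' i).mul (hTlim i)
  have hRB : ∀ k, ∑ i, R i k ≤ B k := by
    intro k
    have h1 : r k ^ 2 * ‖x₁ k - x₂ k‖ ^ 2 = 1 := by
      rw [← mul_pow, inv_mul_cancel₀ (norm_ne_zero_iff.2 (hne k)), one_pow]
    have h2 := mul_lt_mul_of_pos_left (hlt k) (pow_pos (hrpos k) 2)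
    have h3 : ⟪A (r k • (x₁ k - x₂ k)), r k • (x₁ k - x₂ k)⟫
        = r k ^ 2 * ⟪A (x₁ k - x₂ k), x₁ k - x₂ k⟫ := by
      rw [map_smul, real_inner_smul_left, real_inner_smul_right]
      ring
    have h4 : r k ^ 2 * ⟪y k, x₁ k - x₂ k⟫ = - ∑ i, R i k - ∑ i, lam k i * T i k := by
      rw [(hK k).2.2.2, sum_inner, Finset.mul_sum, ← Finset.sum_neg_distrib,
        ← Finset.sum_sub_distrib]
      refine Finset.sum_congr rfl fun i _ => ?_
      rw [real_inner_smul_left]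
      simp only [hR, hT]
      linear_combination (-(r k ^ 2)) * (hK k).2.2.1 i
    have h5 : r k ^ 2 * (1 / ((k : ℝ) + 1) * ‖x₁ k - x₂ k‖ ^ 2) = 1 / ((k : ℝ) + 1) := by
      linear_combination (1 / ((k : ℝ) + 1)) * h1
    simp only [hB, h3]
    nlinarith
  have hRi : ∀ i k, R i k ≤ B k := fun i k =>
    (Finset.single_le_sum (f := fun i => R i k) (fun j _ => hR0 j k) (Finset.mem_univ i)).trans
      (hRB k)
  have hn0 : Tendsto (fun k => ‖x₁ k - x₂ k‖) l (𝓝 0) := by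
    simpa using (hx₁'.sub hx₂').norm
  have horth : ∀ i, 0 < lam₀ i → ⟪pgrad (φ i) xb pb, u⟫ = 0 := by
    intro i hi
    have h1 := (hlam' i).mul (tendsto_mul_sub_of_tendsto_smul (hφ i) hx₁' hx₂' hp' hlim)
    have h2 : Tendsto (fun k => -(R i k * ‖x₁ k - x₂ k‖)) l (𝓝 0) := by
      rw [← neg_zero]
      refine Tendsto.neg (squeeze_zero (fun k => mul_nonneg (hR0 i k) (norm_nonneg _))
        (fun k => mul_le_mul_of_nonneg_right (hRi i k) (norm_nonneg _)) ?_)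
      simpa using hBlim.mul hn0
    have h3 : (fun k => lam k i * (‖x₁ k - x₂ k‖⁻¹ * (φ i (x₁ k) (p k) - φ i (x₂ k) (p k))))
        = fun k => -(R i k * ‖x₁ k - x₂ k‖) := by
      funext k
      have h4 : r k * ‖x₁ k - x₂ k‖ = 1 := inv_mul_cancel₀ (norm_ne_zero_iff.2 (hne k))
      simp only [hR]
      change lam k i * (r k * _) = _
      linear_combination (-r k) * (hK k).2.2.1 i
        - (r k * (lam k i * φ i (x₁ k) (p k))) * h4
    rw [h3] at h1
    exact (mul_eq_zero.1 (tendsto_nhds_unique h1 h2)).resolve_left hi.ne'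
  have hfin : 0 ≤ 0 - (⟪A u, u⟫ / 2 + ∑ i, lam₀ i * (⟪phess (φ i) xb pb u, u⟫ / 2)) :=
    ge_of_tendsto' hBlim fun k => (Finset.sum_nonneg fun i _ => hR0 i k).trans (hRB k)
  have hpos' := hG lam₀ hK₀ u hu0 horth
  have hsum : ∑ i, lam₀ i * (⟪phess (φ i) xb pb u, u⟫ / 2)
      = (∑ i, lam₀ i * ⟪phess (φ i) xb pb u, u⟫) / 2 := by
    rw [Finset.sum_div]
    exact Finset.sum_congr rfl fun i _ => by ring
  rw [hsum] at hfin
  linarith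

/-- The monotonicity estimate encoded by two growth inequalities. -/
def LocMonotone (φ : ι → E → F → ℝ) (xb : E) (pb : F) (A : E →L[ℝ] E) (yb : E) (κ ε : ℝ) : Prop :=
  ∀ x₁ x₂ p lam₁ lam₂ y₁ y₂, ‖x₁ - xb‖ < ε → ‖x₂ - xb‖ < ε → ‖p - pb‖ < ε →
    ‖y₁ - yb‖ < ε → ‖y₂ - yb‖ < ε → IsKKT φ x₁ p lam₁ y₁ → IsKKT φ x₂ p lam₂ y₂ →
    2 * κ * ‖x₁ - x₂‖ ^ 2 ≤ ⟪A (x₁ - x₂), x₁ - x₂⟫ + ⟪y₁ - y₂, x₁ - x₂⟫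

theorem GSSOSC.exists_growth_and_locMonotone {d : E} {c : ℝ} (hc : 0 < c)
    (hφ : ∀ i, ContDiffAt ℝ 2 (fun t : E × F => φ i t.1 t.2) (xb, pb))
    (hreg : ∀ᶠ t in 𝓝 (xb, pb), SlaterRegularAt φ d c t) (hG : GSSOSC φ xb pb A yb) :
    ∃ κ > 0, ∃ ε > 0, (∀ x₁ x₂ p lam y, ‖x₁ - xb‖ < ε → ‖x₂ - xb‖ < ε → ‖p - pb‖ < ε →
      ‖y - yb‖ < ε → x₁ ∈ feas φ p → IsKKT φ x₂ p lam y →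
      κ * ‖x₁ - x₂‖ ^ 2 ≤ ⟪A (x₁ - x₂), x₁ - x₂⟫ / 2 - ⟪y, x₁ - x₂⟫) ∧
      LocMonotone φ xb pb A yb κ ε := by
  obtain ⟨κ, hκ, ε, hε, h⟩ := hG.exists_uniform_growth hc hφ hreg
  refine ⟨κ, hκ, ε, hε, h, fun x₁ x₂ p lam₁ lam₂ y₁ y₂ h₁ h₂ hp hy₁ hy₂ hK₁ hK₂ => ?_⟩
  have e1 := h x₁ x₂ p lam₂ y₂ h₁ h₂ hp hy₂ hK₁.2.1 hK₂
  have e2 := h x₂ x₁ p lam₁ y₁ h₂ h₁ hp hy₁ hK₂.2.1 hK₁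
  have e3 : x₂ - x₁ = -(x₁ - x₂) := by abel
  rw [e3, map_neg, inner_neg_neg, inner_neg_right, norm_neg] at e2
  rw [inner_sub_left y₁]
  linarith

end Growth

/-- Local solvability of the linearized variational condition `z ∈ A (x - xb) + N (x)`. -/
def LocSolvable (φ : ι → E → F → ℝ) (xb : E) (pb : F) (A : E →L[ℝ] E) (yb : E) : Prop :=
  ∀ ε > 0, ∃ δ > 0, ∀ z p, ‖z - yb‖ < δ → ‖p - pb‖ < δ →
    ∃ x lam, ‖x - xb‖ < ε ∧ IsKKT φ x p lam (z - A (x - xb))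

section Solvability

variable {φ : ι → E → F → ℝ} {xb yb : E} {pb : F} {A : E →L[ℝ] E}

theorem mem_regNC_of_isLocalMin {S : E →L[ℝ] E} (hS : ∀ a b, ⟪S a, b⟫ = ⟪a, S b⟫) {Ω : Set E}
    {x z : E} (h : ∀ᶠ y in 𝓝[Ω] x, ⟪S (x - xb), x - xb⟫ / 2 - ⟪z, x - xb⟫
      ≤ ⟪S (y - xb), y - xb⟫ / 2 - ⟪z, y - xb⟫) :
    z - S (x - xb) ∈ regNC Ω x := by
  intro ε hε
  have h1 : Tendsto (fun y => ‖S‖ / 2 * ‖y - x‖) (𝓝[Ω] x) (𝓝 0) :=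
    tendsto_nhdsWithin_of_tendsto_nhds (Continuous.tendsto' (by fun_prop) _ _ (by simp))
  filter_upwards [h, h1.eventually (gt_mem_nhds hε)] with y hy hy1
  have e1 : y - xb = (y - x) + (x - xb) := by abel
  have e2 : ⟪S (y - xb), y - xb⟫
      = ⟪S (y - x), y - x⟫ + 2 * ⟪S (x - xb), y - x⟫ + ⟪S (x - xb), x - xb⟫ := by
    rw [e1, map_add, inner_add_left, inner_add_right, inner_add_right, hS (y - x) (x - xb),
      real_inner_comm (S (x - xb)) (y - x)]
    ring
  have e3 : ⟪z, y - xb⟫ = ⟪z, y - x⟫ + ⟪z, x - xb⟫ := by rw [e1, inner_add_right]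
  have e4 : ⟪S (y - x), y - x⟫ ≤ ‖S‖ * ‖y - x‖ * ‖y - x‖ :=
    (real_inner_le_norm _ _).trans
      (mul_le_mul_of_nonneg_right (S.le_opNorm _) (norm_nonneg _))
  rw [inner_sub_left]
  nlinarith [mul_le_mul_of_nonneg_right hy1.le (norm_nonneg (y - x))]

theorem isCompact_feas_inter_closedBall {p : F} {r : ℝ}
    (h : ∀ x ∈ closedBall xb r, ∀ i, ContinuousAt (fun t : E × F => φ i t.1 t.2) (x, p)) :
    IsCompact (closedBall xb r ∩ feas φ p) := by
  refine (isCompact_closedBall xb r).of_isClosed_subset ?_ inter_subset_left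
  have h1 : closedBall xb r ∩ feas φ p
      = closedBall xb r ∩ ⋂ i, closedBall xb r ∩ (fun x => φ i x p) ⁻¹' Iic 0 := by
    ext x
    simp only [feas, mem_inter_iff, mem_ofPred_eq, mem_iInter, mem_preimage, mem_Iic]
    exact ⟨fun hx => ⟨hx.1, fun i => ⟨hx.1, hx.2 i⟩⟩, fun hx => ⟨hx.1, fun i => (hx.2 i).2⟩⟩
  rw [h1]
  refine isClosed_closedBall.inter (isClosed_iInter fun i => ?_)
  refine ContinuousOn.preimage_isClosed_of_isClosed (fun x hx => ?_) isClosed_closedBall isClosed_Iic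
  have h2 : ContinuousAt (fun y : E => (y, p)) x := by fun_prop
  exact (ContinuousAt.comp (f := fun y : E => (y, p)) (h x hx i) h2).continuousWithinAt

/-- Solvability in the variational case: minimize the quadratic model over the feasible set. -/
theorem locSolvable_of_growth {S : E →L[ℝ] E} (hS : ∀ a b, ⟪S a, b⟫ = ⟪a, S b⟫) {d : E} {c : ℝ}
    (hc : 0 < c) (hreg : ∀ᶠ t in 𝓝 (xb, pb), SlaterRegularAt φ d c t)
    (hxb : xb ∈ feas φ pb) {κ ε₀ : ℝ} (hκ : 0 < κ) (hε₀ : 0 < ε₀)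
    (hgr : ∀ x, ‖x - xb‖ < ε₀ → x ∈ feas φ pb →
      κ * ‖x - xb‖ ^ 2 ≤ ⟪S (x - xb), x - xb⟫ / 2 - ⟪yb, x - xb⟫) :
    LocSolvable φ xb pb S yb := by
  intro ε hε
  obtain ⟨ρ, hρ, hball⟩ := Metric.eventually_nhds_iff.1 hreg
  have hreg' : ∀ x p, ‖x - xb‖ < ρ → ‖p - pb‖ < ρ → SlaterRegularAt φ d c (x, p) := by
    intro x p hx hp
    refine hball ?_
    rw [Prod.dist_eq, max_lt_iff, dist_eq_norm, dist_eq_norm]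
    exact ⟨hx, hp⟩
  obtain ⟨r, hr0, hr⟩ := exists_between (lt_min hε (lt_min hε₀ hρ))
  obtain ⟨hrε, hrε₀, hrρ⟩ : r < ε ∧ r < ε₀ ∧ r < ρ := by simpa using hr
  set θ : E → E → ℝ := fun z x => ⟪S (x - xb), x - xb⟫ / 2 - ⟪z, x - xb⟫ with hθ
  have hθc : Continuous fun t : E × E => θ t.1 t.2 := by
    simp only [hθ]
    fun_prop
  obtain ⟨xt, hxtr, hxtf, hxtθ⟩ : ∃ xt, ‖xt - xb‖ < r ∧ (∀ i, φ i xt pb < 0) ∧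
      θ yb xt < κ * r ^ 2 := by
    have hr0' := hreg' xb pb (by simpa using hρ) (by simpa using hρ)
    have h1 := eventually_feasible_of_gradient_neg (w := d) hxb hr0'.hasGradientAt
      fun i hi => (hr0'.slater i hi).trans (neg_neg_of_pos hc)
    have h2 : Tendsto (fun t : ℝ => ‖xb + t • d - xb‖) (𝓝[>] 0) (𝓝 0) :=
      tendsto_nhdsWithin_of_tendsto_nhds (Continuous.tendsto' (by fun_prop) _ _ (by simp))
    have h3 : Tendsto (fun t : ℝ => θ yb (xb + t • d)) (𝓝[>] 0) (𝓝 0) :=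
      tendsto_nhdsWithin_of_tendsto_nhds (Continuous.tendsto'
        (hθc.comp (by fun_prop : Continuous fun t : ℝ => (yb, xb + t • d))) _ _ (by simp [hθ]))
    obtain ⟨t, h1, h2, h3⟩ := (h1.and ((h2.eventually (gt_mem_nhds hr0)).and
      (h3.eventually (gt_mem_nhds (mul_pos hκ (pow_pos hr0 2)))))).exists
    exact ⟨_, h2, h1, h3⟩
  have hφc : ∀ x p, ‖x - xb‖ < ρ → ‖p - pb‖ < ρ → ∀ i,
      ContinuousAt (fun t : E × F => φ i t.1 t.2) (x, p) := fun x p hx hp =>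
    (hreg' x p hx hp).continuousAt
  have hsphere : ∀ᶠ s : E × F in 𝓝 (yb, pb), ∀ x ∈ sphere xb r,
      (∃ i, 0 < φ i x s.2) ∨ θ s.1 xt < θ s.1 x := by
    refine (isCompact_sphere xb r).eventually_forall_of_forall_eventually fun x hx => ?_
    have hxr : ‖x - xb‖ = r := by simpa [dist_eq_norm] using hx
    by_cases hf : x ∈ feas φ pb
    · have h1 : θ yb xt < θ yb x := by
        have := hgr x (hxr.trans_lt hrε₀) hf
        rw [hxr] at this
        exact hxtθ.trans_le this
      have h2 : Continuous fun t : (E × F) × E => θ t.1.1 xt :=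
        hθc.comp (by fun_prop : Continuous fun t : (E × F) × E => (t.1.1, xt))
      have h3 : Continuous fun t : (E × F) × E => θ t.1.1 t.2 :=
        hθc.comp (by fun_prop : Continuous fun t : (E × F) × E => (t.1.1, t.2))
      have h4 := h2.continuousAt.eventually_lt h3.continuousAt (x₀ := ((yb, pb), x)) h1
      exact h4.mono fun t ht => Or.inr ht
    · have hf' : ∃ i, 0 < φ i x pb := by simpa [feas] using hf
      obtain ⟨i, hi⟩ := hf'
      have h1 : ContinuousAt (fun t : (E × F) × E => φ i t.2 t.1.2) ((yb, pb), x) :=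
        ContinuousAt.comp (f := fun t : (E × F) × E => (t.2, t.1.2))
          (g := fun t : E × F => φ i t.1 t.2) (x := ((yb, pb), x))
          (hφc x pb (hxr.trans_lt hrρ) (by simpa using hρ) i) (by fun_prop)
      exact (h1.eventually (lt_mem_nhds hi)).mono fun t ht => Or.inl ⟨i, ht⟩
  have hxtp : ∀ᶠ s : E × F in 𝓝 (yb, pb), ∀ i, φ i xt s.2 < 0 := by
    refine eventually_all.2 fun i => ?_
    have h1 : ContinuousAt (fun s : E × F => φ i xt s.2) (yb, pb) :=
      ContinuousAt.comp (f := fun s : E × F => (xt, s.2))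
        (g := fun t : E × F => φ i t.1 t.2) (x := (yb, pb))
        (hφc xt pb (hxtr.trans hrρ) (by simpa using hρ) i) (by fun_prop)
    exact h1.eventually (gt_mem_nhds (hxtf i))
  obtain ⟨δ, hδ, hδ'⟩ := Metric.eventually_nhds_iff.1 (hsphere.and hxtp)
  refine ⟨min δ ρ, lt_min hδ hρ, fun z p hz hp => ?_⟩
  obtain ⟨hs, hxp⟩ := hδ' (y := (z, p)) (by
    rw [Prod.dist_eq, max_lt_iff, dist_eq_norm, dist_eq_norm]
    exact ⟨hz.trans_le (min_le_left _ _), hp.trans_le (min_le_left _ _)⟩)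
  have hp' : ‖p - pb‖ < ρ := hp.trans_le (min_le_right _ _)
  have hK : IsCompact (closedBall xb r ∩ feas φ p) :=
    isCompact_feas_inter_closedBall fun x hx i =>
      hφc x p ((mem_closedBall_iff_norm.1 hx).trans_lt hrρ) hp' i
  have hθz : Continuous (θ z) := hθc.comp (by fun_prop : Continuous fun x : E => (z, x))
  have hxtK : xt ∈ closedBall xb r ∩ feas φ p :=
    ⟨mem_closedBall_iff_norm.2 hxtr.le, fun i => (hxp i).le⟩
  obtain ⟨x, hxK, hmin⟩ := hK.exists_isMinOn ⟨xt, hxtK⟩ hθz.continuousOn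
  have hxr : ‖x - xb‖ < r := by
    refine lt_of_le_of_ne (mem_closedBall_iff_norm.1 hxK.1) fun h => ?_
    rcases hs x (mem_sphere_iff_norm.2 h) with ⟨i, hi⟩ | h1
    · exact absurd (hxK.2 i) (not_le.2 hi)
    · exact absurd (hmin hxtK) (not_le.2 h1)
  have hrx := hreg' x p (hxr.trans hrρ) hp'
  have hN : z - S (x - xb) ∈ regNC (feas φ p) x := by
    refine mem_regNC_of_isLocalMin hS ?_
    have h1 : ∀ᶠ y in 𝓝[feas φ p] x, y ∈ ball xb r :=
      mem_nhdsWithin_of_mem_nhds (isOpen_ball.mem_nhds (mem_ball_iff_norm.2 hxr))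
    filter_upwards [h1, self_mem_nhdsWithin] with y hy hyf
    exact hmin ⟨ball_subset_closedBall hy, hyf⟩
  obtain ⟨lam, hlam⟩ := exists_isKKT_of_mem_regNC hc hrx.slater hxK.2 hrx.hasGradientAt hN
  exact ⟨x, lam, hxr.trans hrε, hlam⟩

theorem LocMonotone.congr {B : E →L[ℝ] E} {κ ε : ℝ} (h : LocMonotone φ xb pb A yb κ ε)
    (hAB : ∀ u, ⟪B u, u⟫ = ⟪A u, u⟫) : LocMonotone φ xb pb B yb κ ε := by
  intro x₁ x₂ p lam₁ lam₂ y₁ y₂ h₁ h₂ hp hy₁ hy₂ hK₁ hK₂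
  rw [hAB]
  exact h x₁ x₂ p lam₁ lam₂ y₁ y₂ h₁ h₂ hp hy₁ hy₂ hK₁ hK₂

/-- Solvability is stable under perturbations of the right-hand side with small Lipschitz
constant. -/
theorem LocSolvable.exists_isKKT_of_lipschitz (hA : LocSolvable φ xb pb A yb) {κ ε₀ : ℝ}
    (hκ : 0 < κ) (hε₀ : 0 < ε₀) (hM : LocMonotone φ xb pb A yb κ ε₀) {ε : ℝ} (hε : 0 < ε) :
    ∃ δ > 0, ∀ p (R : E → E), ‖p - pb‖ < δ → ‖R xb - yb‖ < δ →
      (∀ x x', ‖x - xb‖ ≤ ε → ‖x' - xb‖ ≤ ε → ‖R x - R x'‖ ≤ κ * ‖x - x'‖) →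
      ∃ x lam, ‖x - xb‖ ≤ ε ∧ IsKKT φ x p lam (R x - A (x - xb)) := by
  set a : ℝ := ‖A‖ + 1 with ha
  have ha0 : 0 < a := by positivity
  set ε₂ : ℝ := min ε₀ (ε₀ / (2 * a)) with hε₂
  have hε₂0 : 0 < ε₂ := by positivity
  have haε₂ : a * ε₂ ≤ ε₀ / 2 := by
    have := mul_le_mul_of_nonneg_left (min_le_right ε₀ (ε₀ / (2 * a))) ha0.le
    refine this.trans_eq ?_
    field_simp
  have hyb : ∀ z x : E, ‖z - yb‖ < ε₀ / 2 → ‖x - xb‖ < ε₂ → ‖z - A (x - xb) - yb‖ < ε₀ := by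
    intro z x hz hx
    have h1 : z - A (x - xb) - yb = (z - yb) - A (x - xb) := by abel
    have h2 : ‖A (x - xb)‖ ≤ a * ε₂ := (A.le_opNorm _).trans
      (mul_le_mul (by simp [ha]) hx.le (norm_nonneg _) ha0.le)
    rw [h1]
    linarith [norm_sub_le (z - yb) (A (x - xb))]
  have hLip : ∀ p, ‖p - pb‖ < ε₀ → ∀ z₁ z₂ x₁ x₂ lam₁ lam₂, ‖z₁ - yb‖ < ε₀ / 2 →
      ‖z₂ - yb‖ < ε₀ / 2 → ‖x₁ - xb‖ < ε₂ → ‖x₂ - xb‖ < ε₂ →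
      IsKKT φ x₁ p lam₁ (z₁ - A (x₁ - xb)) → IsKKT φ x₂ p lam₂ (z₂ - A (x₂ - xb)) →
      2 * κ * ‖x₁ - x₂‖ ≤ ‖z₁ - z₂‖ := by
    intro p hp z₁ z₂ x₁ x₂ lam₁ lam₂ hz₁ hz₂ hx₁ hx₂ hK₁ hK₂
    have h1 := hM x₁ x₂ p lam₁ lam₂ _ _ (hx₁.trans_le (min_le_left _ _))
      (hx₂.trans_le (min_le_left _ _)) hp (hyb _ _ hz₁ hx₁) (hyb _ _ hz₂ hx₂) hK₁ hK₂
    have h2 : z₁ - A (x₁ - xb) - (z₂ - A (x₂ - xb)) = (z₁ - z₂) - A (x₁ - x₂) := by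
      simp only [map_sub]
      abel
    rw [h2, inner_sub_left] at h1
    have h3 := real_inner_le_norm (z₁ - z₂) (x₁ - x₂)
    rcases (norm_nonneg (x₁ - x₂)).eq_or_lt with h0 | h0
    · rw [← h0]
      simp
    · refine le_of_mul_le_mul_right ?_ h0
      nlinarith
  obtain ⟨δ₂, hδ₂, hsol₂⟩ := hA ε₂ hε₂0
  set η : ℝ := min δ₂ (ε₀ / 2) with hη
  have hη0 : 0 < η := by positivity
  set ε₁ : ℝ := min ε (η / (4 * κ)) with hε₁
  have hε₁0 : 0 < ε₁ := by positivity
  have hκε₁ : κ * ε₁ ≤ η / 4 := by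
    have := mul_le_mul_of_nonneg_left (min_le_right ε (η / (4 * κ))) hκ.le
    refine this.trans_eq ?_
    field_simp
  obtain ⟨δ₃, hδ₃, hsol₃⟩ := hA (min ε₂ (ε₁ / 2)) (by positivity)
  refine ⟨min (min δ₂ δ₃) (min ε₀ (η / 2)), by positivity, fun p R hp hRb hRL => ?_⟩
  simp only [lt_min_iff] at hp hRb
  obtain ⟨⟨hp₂, hp₃⟩, hp₀, -⟩ := hp
  obtain ⟨⟨hR₂, hR₃⟩, hR₀, hRη⟩ := hRb
  have hRx : ∀ x ∈ closedBall xb ε₁, ‖R x - yb‖ < η := by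
    intro x hx
    have hx' := mem_closedBall_iff_norm.1 hx
    have h1 := hRL x xb (hx'.trans (min_le_left _ _)) (by simpa using hε.le)
    have h2 : R x - yb = (R x - R xb) + (R xb - yb) := by abel
    rw [h2]
    have h3 := mul_le_mul_of_nonneg_left hx' hκ.le
    linarith [norm_add_le (R x - R xb) (R xb - yb)]
  choose! Θ mu hΘ using fun (x : E) (hx : x ∈ closedBall xb ε₁) =>
    hsol₂ (R x) p ((hRx x hx).trans_le (min_le_left _ _)) hp₂
  have hΘL : ∀ x ∈ closedBall xb ε₁, ∀ x' ∈ closedBall xb ε₁,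
      ‖Θ x - Θ x'‖ ≤ 1 / 2 * ‖x - x'‖ := by
    intro x hx x' hx'
    have h1 := hLip p hp₀ _ _ _ _ _ _ ((hRx x hx).trans_le (min_le_right _ _))
      ((hRx x' hx').trans_le (min_le_right _ _)) (hΘ x hx).1 (hΘ x' hx').1 (hΘ x hx).2
      (hΘ x' hx').2
    have h2 := hRL x x' ((mem_closedBall_iff_norm.1 hx).trans (min_le_left _ _))
      ((mem_closedBall_iff_norm.1 hx').trans (min_le_left _ _))
    have h3 : κ * (2 * ‖Θ x - Θ x'‖) ≤ κ * ‖x - x'‖ := by linarith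
    linarith [le_of_mul_le_mul_left h3 hκ]
  have hxbm : xb ∈ closedBall xb ε₁ := mem_closedBall_self hε₁0.le
  have hΘb : ‖Θ xb - xb‖ ≤ ε₁ / 2 := by
    obtain ⟨x₀, lam₀, hx₀, hK₀⟩ := hsol₃ (R xb) p hR₃ hp₃
    have h0 := (hRx xb hxbm).trans_le (min_le_right _ _)
    have h1 := hLip p hp₀ _ _ _ _ _ _ h0 h0 (hΘ xb hxbm).1
      (hx₀.trans_le (min_le_left _ _)) (hΘ xb hxbm).2 hK₀
    rw [sub_self, norm_zero] at h1
    have h2 : Θ xb - x₀ = 0 := by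
      rw [← norm_le_zero_iff]
      by_contra hcon
      nlinarith [mul_pos hκ (not_le.1 hcon)]
    rw [sub_eq_zero.1 h2]
    exact (hx₀.trans_le (min_le_right _ _)).le
  have hmaps : MapsTo Θ (closedBall xb ε₁) (closedBall xb ε₁) := by
    intro x hx
    rw [mem_closedBall_iff_norm]
    have h1 := hΘL x hx xb hxbm
    have h2 : Θ x - xb = (Θ x - Θ xb) + (Θ xb - xb) := by abel
    rw [h2]
    have h3 := mem_closedBall_iff_norm.1 hx
    linarith [norm_add_le (Θ x - Θ xb) (Θ xb - xb)]
  have hcontr : ContractingWith (1 / 2) (hmaps.restrict Θ _ _) := by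
    refine ⟨by norm_num, LipschitzWith.of_dist_le_mul fun x x' => ?_⟩
    have := hΘL x x.2 x' x'.2
    rw [Subtype.dist_eq, Subtype.dist_eq, dist_eq_norm, dist_eq_norm]
    simpa using this
  obtain ⟨x, hx, hfix, -⟩ := ContractingWith.exists_fixedPoint' isClosed_closedBall.isComplete
    hmaps hcontr hxbm (edist_ne_top _ _)
  have hfix' : Θ x = x := hfix
  refine ⟨x, mu x, (mem_closedBall_iff_norm.1 hx).trans (min_le_left _ _), ?_⟩
  have := (hΘ x hx).2
  rwa [hfix'] at this

theorem LocSolvable.of_norm_sub_le (hA : LocSolvable φ xb pb A yb) {κ ε₀ : ℝ}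
    (hκ : 0 < κ) (hε₀ : 0 < ε₀) (hM : LocMonotone φ xb pb A yb κ ε₀) {B : E →L[ℝ] E}
    (hB : ‖B - A‖ ≤ κ) : LocSolvable φ xb pb B yb := by
  intro ε hε
  obtain ⟨δ, hδ, h⟩ := hA.exists_isKKT_of_lipschitz hκ hε₀ hM (half_pos hε)
  refine ⟨δ, hδ, fun z p hz hp => ?_⟩
  obtain ⟨x, lam, hx, hK⟩ := h p (fun x => z - (B - A) (x - xb)) hp (by simpa using hz) (by
    intro x x' _ _
    have h1 : z - (B - A) (x - xb) - (z - (B - A) (x' - xb)) = -((B - A) (x - x')) := by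
      simp only [map_sub]
      abel
    rw [h1, norm_neg]
    exact ((B - A).le_opNorm _).trans (mul_le_mul_of_nonneg_right hB (norm_nonneg _)))
  refine ⟨x, lam, by linarith, ?_⟩
  have h1 : z - (B - A) (x - xb) - A (x - xb) = z - B (x - xb) := by
    rw [sub_apply]
    abel
  rwa [h1] at hK

theorem LocSolvable.of_inner_eq {S : E →L[ℝ] E} (hS : LocSolvable φ xb pb S yb) {κ ε₀ : ℝ}
    (hκ : 0 < κ) (hε₀ : 0 < ε₀) (hM : LocMonotone φ xb pb S yb κ ε₀)
    (hAS : ∀ u, ⟪A u, u⟫ = ⟪S u, u⟫) : LocSolvable φ xb pb A yb := by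
  obtain ⟨N, hN⟩ := exists_nat_gt (‖A - S‖ / κ)
  have hN0 : (0 : ℝ) < N := lt_of_le_of_lt (by positivity) hN
  have hstep : ∀ j : ℕ, LocSolvable φ xb pb (S + ((j : ℝ) / N) • (A - S)) yb := by
    intro j
    induction j with
    | zero => simpa using hS
    | succ j ih =>
      refine ih.of_norm_sub_le hκ hε₀ (hM.congr fun u => ?_) ?_
      · simp [inner_add_left, inner_sub_left, real_inner_smul_left, hAS]
      · have h1 : S + (((j + 1 : ℕ) : ℝ) / N) • (A - S) - (S + ((j : ℝ) / N) • (A - S))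
            = (1 / (N : ℝ)) • (A - S) := by
          rw [add_sub_add_left_eq_sub, ← sub_smul]
          congr 1
          push_cast
          ring
        rw [h1, norm_smul, Real.norm_eq_abs, abs_of_pos (by positivity), one_div,
          inv_mul_le_iff₀ hN0, mul_comm]
        rw [div_lt_iff₀ hκ] at hN
        linarith
  simpa [div_self hN0.ne'] using hstep N

theorem GSSOSC.locSolvable {d : E} {c : ℝ} (hc : 0 < c)
    (hφ : ∀ i, ContDiffAt ℝ 2 (fun t : E × F => φ i t.1 t.2) (xb, pb))
    (hreg : ∀ᶠ t in 𝓝 (xb, pb), SlaterRegularAt φ d c t) {lamb : ι → ℝ}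
    (hb : IsKKT φ xb pb lamb yb) (hG : GSSOSC φ xb pb A yb) : LocSolvable φ xb pb A yb := by
  obtain ⟨κ, hκ, ε, hε, hgr, hM⟩ := hG.exists_growth_and_locMonotone hc hφ hreg
  set S : E →L[ℝ] E := (1 / 2 : ℝ) • (A + ContinuousLinearMap.adjoint A) with hS
  have hSA : ∀ u, ⟪A u, u⟫ = ⟪S u, u⟫ := by
    intro u
    simp only [hS, smul_apply, add_apply,
      real_inner_smul_left, inner_add_left, ContinuousLinearMap.adjoint_inner_left]
    rw [real_inner_comm]
    ring
  refine LocSolvable.of_inner_eq (S := S) ?_ hκ hε (hM.congr fun u => (hSA u).symm) hSA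
  refine locSolvable_of_growth (fun a b => ?_) hc hreg hb.2.1 hκ hε fun x hx hxf => ?_
  · simp only [hS, smul_apply, add_apply,
      real_inner_smul_left, real_inner_smul_right, inner_add_left, inner_add_right,
      ContinuousLinearMap.adjoint_inner_left, ContinuousLinearMap.adjoint_inner_right]
    ring
  · rw [← hSA]
    exact hgr x xb pb lamb yb hx (by simpa using hε) (by simpa using hε) (by simpa using hε) hxf hb

end Solvability

section Lipschitz

variable {G : Type*} [NormedAddCommGroup G] [NormedSpace ℝ G]
variable {φ : ι → E → F → ℝ} {xb yb vb : E} {pb : F} {qb : G}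
  {f : E → F → G → E} {Df : E → F → G → E →L[ℝ] E}

theorem A4.exists_norm_sub_sub_le (hA4 : A4 f Df xb pb qb) {ε : ℝ} (hε : 0 < ε) :
    ∃ δ > 0, ∀ x x' p q, ‖x - xb‖ < δ → ‖x' - xb‖ < δ → ‖p - pb‖ < δ → ‖q - qb‖ < δ →
      ‖f x p q - f x' p q - Df xb pb qb (x - x')‖ ≤ ε * ‖x - x'‖ := by
  obtain ⟨⟨η, hη, h1⟩, h2⟩ := hA4
  obtain ⟨δ₁, hδ₁, h1⟩ := h1 (ε / 2) (half_pos hε)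
  obtain ⟨δ₂, hδ₂, h2⟩ := Metric.tendsto_nhds_nhds.1 h2 (ε / 2) (half_pos hε)
  refine ⟨min (min η δ₂) (δ₁ / 2), by positivity, fun x x' p q hx hx' hp hq => ?_⟩
  simp only [lt_min_iff] at hx hx' hp hq
  have h3 := h1 x' p q hx'.1.1 (by simpa [dist_eq_norm] using hp.1.1)
    (by simpa [dist_eq_norm] using hq.1.1) x (by
      have : x - x' = (x - xb) - (x' - xb) := by abel
      rw [this]
      linarith [norm_sub_le (x - xb) (x' - xb)])
  have h4 : ‖Df x' p q - Df xb pb qb‖ < ε / 2 := by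
    have := @h2 (x', p, q) (by
      rw [Prod.dist_eq, Prod.dist_eq]
      simp only [max_lt_iff, dist_eq_norm]
      exact ⟨hx'.1.2, hp.1.2, hq.1.2⟩)
    simpa [dist_eq_norm] using this
  have h5 : f x p q - f x' p q - Df xb pb qb (x - x')
      = (f x p q - f x' p q - Df x' p q (x - x')) + (Df x' p q - Df xb pb qb) (x - x') := by
    rw [sub_apply]
    abel
  rw [h5]
  have h6 := (Df x' p q - Df xb pb qb).le_opNorm (x - x')
  have h7 := mul_le_mul_of_nonneg_right h4.le (norm_nonneg (x - x'))
  linarith [norm_add_le (f x p q - f x' p q - Df x' p q (x - x'))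
    ((Df x' p q - Df xb pb qb) (x - x'))]

theorem A1.exists_norm_sub_le (hA1 : A1 f xb pb qb) :
    ∃ L > 0, ∃ δ > 0, ∀ x₁ x₂ p₁ p₂ q₁ q₂, ‖x₁ - xb‖ < δ → ‖x₂ - xb‖ < δ → ‖p₁ - pb‖ < δ →
      ‖p₂ - pb‖ < δ → ‖q₁ - qb‖ < δ → ‖q₂ - qb‖ < δ →
      ‖f x₁ p₁ q₁ - f x₂ p₂ q₂‖ ≤ L * (‖x₁ - x₂‖ + ‖p₁ - p₂‖ + ‖q₁ - q₂‖) := by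
  obtain ⟨L, hL, δ, hδ, h⟩ := hA1
  simp only [dist_eq_norm] at h
  exact ⟨L, hL, δ, hδ, h⟩

theorem _root_.LinearIndepOn.exists_abs_le {g₀ : ι → E} {J : Finset ι}
    (h : LinearIndepOn ℝ g₀ (J : Set ι)) :
    ∃ K > 0, ∀ᶠ g in 𝓝 g₀, ∀ mu : ι → ℝ, (∀ i ∉ J, mu i = 0) →
      ∀ i, |mu i| ≤ K * ‖∑ i, mu i • g i‖ := by
  classical
  obtain ⟨K, hK, hanti⟩ := LinearMap.exists_antilipschitzWith
    (Fintype.linearCombination ℝ (fun i : (J : Set ι) => g₀ i))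
    (LinearMap.ker_eq_bot.2 (linearIndependent_iff_injective_fintypeLinearCombination.1 h))
  have hK0 : (0 : ℝ) < K := hK
  set N : ℝ := (Fintype.card ι : ℝ) with hN
  have hN0 : (0 : ℝ) ≤ N := Nat.cast_nonneg _
  have hη : 0 < 1 / (2 * K * (N + 1)) := by positivity
  refine ⟨2 * K, by positivity, ?_⟩
  filter_upwards [Metric.ball_mem_nhds g₀ hη] with g hg mu hmu i
  have h1 : ∀ i, ‖g i - g₀ i‖ ≤ 1 / (2 * K * (N + 1)) := fun i => by
    rw [← dist_eq_norm]
    exact (dist_le_pi_dist g g₀ i).trans (le_of_lt hg)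
  set m : ℝ := ‖mu‖ with hm
  have hmi : ∀ i, |mu i| ≤ m := fun i => norm_le_pi_norm mu i
  have hsumJ : ∑ i, mu i • g₀ i = ∑ i : (J : Set ι), mu i • g₀ i := by
    exact ((Finset.sum_coe_sort J fun i => mu i • g₀ i).trans
      (Finset.sum_subset (Finset.subset_univ J) fun i _ hi => by simp [hmu i hi])).symm
  have h2 : m ≤ K * ‖∑ i, mu i • g₀ i‖ := by
    have h3 := hanti.le_mul_dist (fun i : (J : Set ι) => mu i) 0
    rw [map_zero, dist_zero_right, dist_zero_right, Fintype.linearCombination_apply] at h3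
    rw [hsumJ]
    refine le_trans ?_ h3
    refine (pi_norm_le_iff_of_nonneg (norm_nonneg _)).2 fun i => ?_
    by_cases hi : i ∈ J
    · exact norm_le_pi_norm (fun i : (J : Set ι) => mu i) ⟨i, hi⟩
    · simp [hmu i hi]
  have h4 : ‖∑ i, mu i • g₀ i‖ ≤ ‖∑ i, mu i • g i‖ + N * (m * (1 / (2 * K * (N + 1)))) := by
    have h5 : ∑ i, mu i • g₀ i = ∑ i, mu i • g i - ∑ i, mu i • (g i - g₀ i) := by
      simp only [smul_sub, Finset.sum_sub_distrib]
      abel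
    rw [h5]
    refine (norm_sub_le _ _).trans (add_le_add le_rfl ?_)
    refine (norm_sum_le_of_le _ (n := fun _ => m * (1 / (2 * K * (N + 1)))) fun i _ => ?_).trans ?_
    · rw [norm_smul]
      exact mul_le_mul (hmi i) (h1 i) (norm_nonneg _) (norm_nonneg _)
    · simp [hN]
  have h6 : K * (N * (m * (1 / (2 * K * (N + 1))))) ≤ m / 2 := by
    have : K * (N * (m * (1 / (2 * K * (N + 1))))) = m / 2 * (N / (N + 1)) := by
      field_simp
    rw [this]
    refine mul_le_of_le_one_right (by positivity) ?_
    rw [div_le_one (by positivity)]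
    linarith
  have h7 := mul_le_mul_of_nonneg_left h4 hK0.le
  linarith [hmi i]

theorem tendsto_smul_sub_pgrad {h : E → F → ℝ}
    (hh : ContDiffAt ℝ 2 (fun t : E × F => h t.1 t.2) (xb, pb)) {κ : Type*} {l : Filter κ}
    {x₁ x₂ : κ → E} {p₁ p₂ : κ → F} {r : κ → ℝ} {u : E} (hx₁ : Tendsto x₁ l (𝓝 xb))
    (hp₁ : Tendsto p₁ l (𝓝 pb)) (hx₂ : Tendsto x₂ l (𝓝 xb)) (hp₂ : Tendsto p₂ l (𝓝 pb))
    (hr : Tendsto (fun k => r k • ((x₁ k, p₁ k) - (x₂ k, p₂ k))) l (𝓝 (u, 0))) :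
    Tendsto (fun k => r k • (pgrad h (x₁ k) (p₁ k) - pgrad h (x₂ k) (p₂ k))) l
      (𝓝 (phess h xb pb u)) := by
  unfold phess
  have hg := hasStrictFDerivAt_pgrad hh
  generalize fderiv ℝ (fun t : E × F => pgrad h t.1 t.2) (xb, pb) = g' at hg ⊢
  exact tendsto_smul_sub_of_hasStrictFDerivAt (g := fun t : E × F => pgrad h t.1 t.2)
    (a₁ := fun k => (x₁ k, p₁ k)) (a₂ := fun k => (x₂ k, p₂ k)) hg (hx₁.prodMk_nhds hp₁)
    (hx₂.prodMk_nhds hp₂) hr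

theorem exists_eventually_eq_of_finite {κ β : Type*} [Finite β] (l : Ultrafilter κ)
    (J : κ → β) : ∃ j, ∀ᶠ k in l, J k = j := by
  obtain ⟨j, hj⟩ := (l.map J).eq_pure_of_finite
  refine ⟨j, ?_⟩
  have : ({j} : Set β) ∈ l.map J := by
    rw [hj]
    exact Filter.mem_pure.2 rfl
  exact this

set_option maxHeartbeats 400000 in
theorem GSSOSC.false_of_common_support {d : E} {c : ℝ} (hc : 0 < c)
    (hφ : ∀ i, ContDiffAt ℝ 2 (fun t : E × F => φ i t.1 t.2) (xb, pb))
    (hreg : ∀ᶠ t in 𝓝 (xb, pb), SlaterRegularAt φ d c t)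
    (hA1 : A1 f xb pb qb) (hA4 : A4 f Df xb pb qb)
    (hG : GSSOSC φ xb pb (Df xb pb qb) (vb - f xb pb qb))
    {x₁ x₂ : ℕ → E} {p₁ p₂ : ℕ → F} {q₁ q₂ : ℕ → G} {v : ℕ → E} {lam₁ lam₂ : ℕ → ι → ℝ}
    {J : ℕ → Finset ι} (hx₁ : ∀ k : ℕ, ‖x₁ k - xb‖ < 1 / ((k : ℝ) + 1))
    (hx₂ : ∀ k : ℕ, ‖x₂ k - xb‖ < 1 / ((k : ℝ) + 1))
    (hp₁ : ∀ k : ℕ, ‖p₁ k - pb‖ < 1 / ((k : ℝ) + 1))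
    (hp₂ : ∀ k : ℕ, ‖p₂ k - pb‖ < 1 / ((k : ℝ) + 1))
    (hq₁ : ∀ k : ℕ, ‖q₁ k - qb‖ < 1 / ((k : ℝ) + 1))
    (hq₂ : ∀ k : ℕ, ‖q₂ k - qb‖ < 1 / ((k : ℝ) + 1))
    (hv : ∀ k : ℕ, ‖v k - vb‖ < 1 / ((k : ℝ) + 1))
    (hJ : ∀ k, LinearIndepOn ℝ (fun i => pgrad (φ i) xb pb) (J k : Set ι))
    (hK₁ : ∀ k, IsKKT φ (x₁ k) (p₁ k) (lam₁ k) (v k - f (x₁ k) (p₁ k) (q₁ k)))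
    (hK₂ : ∀ k, IsKKT φ (x₂ k) (p₂ k) (lam₂ k) (v k - f (x₂ k) (p₂ k) (q₂ k)))
    (hJ₁ : ∀ k, ∀ i ∉ J k, lam₁ k i = 0) (hJ₂ : ∀ k, ∀ i ∉ J k, lam₂ k i = 0)
    (hφ₁ : ∀ k, ∀ i ∈ J k, φ i (x₁ k) (p₁ k) = 0) (hφ₂ : ∀ k, ∀ i ∈ J k, φ i (x₂ k) (p₂ k) = 0)
    (hlt : ∀ k : ℕ, ((k : ℝ) + 1) * (‖p₁ k - p₂ k‖ + ‖q₁ k - q₂ k‖) < ‖x₁ k - x₂ k‖) :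
    False := by
  set l : Ultrafilter ℕ := hyperfilter ℕ with hl
  have hzero : Tendsto (fun k : ℕ => (1 : ℝ) / (k + 1)) l (𝓝 0) :=
    tendsto_one_div_add_atTop_nhds_zero_nat.mono_left Nat.hyperfilter_le_atTop
  have limE : ∀ {a : ℕ → E} {b : E}, (∀ k : ℕ, ‖a k - b‖ < 1 / (k + 1)) → Tendsto a l (𝓝 b) :=
    fun h => tendsto_iff_norm_sub_tendsto_zero.2
      (squeeze_zero (fun _ => norm_nonneg _) (fun k => (h k).le) hzero)
  have limF : ∀ {a : ℕ → F} {b : F}, (∀ k : ℕ, ‖a k - b‖ < 1 / (k + 1)) → Tendsto a l (𝓝 b) :=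
    fun h => tendsto_iff_norm_sub_tendsto_zero.2
      (squeeze_zero (fun _ => norm_nonneg _) (fun k => (h k).le) hzero)
  have limG : ∀ {a : ℕ → G} {b : G}, (∀ k : ℕ, ‖a k - b‖ < 1 / (k + 1)) → Tendsto a l (𝓝 b) :=
    fun h => tendsto_iff_norm_sub_tendsto_zero.2
      (squeeze_zero (fun _ => norm_nonneg _) (fun k => (h k).le) hzero)
  have hx₁' := limE hx₁
  have hx₂' := limE hx₂
  have hv' := limE hv
  have hp₁' := limF hp₁
  have hp₂' := limF hp₂
  have hne : ∀ k, x₁ k - x₂ k ≠ 0 := by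
    intro k h0
    have h1 := hlt k
    rw [h0, norm_zero] at h1
    have : 0 ≤ ((k : ℝ) + 1) * (‖p₁ k - p₂ k‖ + ‖q₁ k - q₂ k‖) := by positivity
    linarith
  obtain ⟨u, hu, hlim⟩ := exists_tendsto_normalize l hne
  have hu0 : u ≠ 0 := by
    rintro rfl
    simp at hu
  set r : ℕ → ℝ := fun k => ‖x₁ k - x₂ k‖⁻¹ with hr
  have hrpos : ∀ k, 0 < r k := fun k => inv_pos.2 (norm_pos_iff.2 (hne k))
  have hrn : ∀ k, r k * ‖x₁ k - x₂ k‖ = 1 := fun k =>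
    inv_mul_cancel₀ (norm_ne_zero_iff.2 (hne k))
  have hpq : ∀ k, r k * (‖p₁ k - p₂ k‖ + ‖q₁ k - q₂ k‖) ≤ 1 / (k + 1) := by
    intro k
    have h1 := mul_lt_mul_of_pos_left (hlt k) (hrpos k)
    rw [hrn k] at h1
    rw [le_div_iff₀ (by positivity)]
    linarith [h1, mul_left_comm (r k) ((k : ℝ) + 1) (‖p₁ k - p₂ k‖ + ‖q₁ k - q₂ k‖),
      mul_comm ((k : ℝ) + 1) (r k * (‖p₁ k - p₂ k‖ + ‖q₁ k - q₂ k‖))]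
  have hdp : Tendsto (fun k => r k • (p₁ k - p₂ k)) l (𝓝 0) := by
    refine squeeze_zero_norm (fun k => ?_) hzero
    rw [norm_smul, Real.norm_eq_abs, abs_of_pos (hrpos k)]
    refine le_trans ?_ (hpq k)
    exact mul_le_mul_of_nonneg_left (le_add_of_nonneg_right (norm_nonneg _)) (hrpos k).le
  have hdxp : Tendsto (fun k => r k • ((x₁ k, p₁ k) - (x₂ k, p₂ k))) l (𝓝 (u, 0)) := by
    simpa using hlim.prodMk_nhds hdp
  obtain ⟨Lf, hLf, δf, hδf, hfL⟩ := hA1.exists_norm_sub_le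
  have small : ∀ {δ : ℝ}, 0 < δ → ∀ᶠ k : ℕ in (l : Filter ℕ), (1 : ℝ) / ((k : ℝ) + 1) < δ := fun hδ =>
    hzero.eventually (gt_mem_nhds hδ)
  have hfx : Tendsto (fun k => r k • (f (x₁ k) (p₁ k) (q₁ k) - f (x₂ k) (p₂ k) (q₂ k))) l
      (𝓝 (Df xb pb qb u)) := by
    have e1 : Tendsto (fun k => r k • (f (x₁ k) (p₁ k) (q₁ k) - f (x₂ k) (p₁ k) (q₁ k)
        - Df xb pb qb (x₁ k - x₂ k))) l (𝓝 0) := by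
      rw [Metric.tendsto_nhds]
      intro ε hε
      obtain ⟨δ, hδ, h⟩ := hA4.exists_norm_sub_sub_le (half_pos hε)
      filter_upwards [small hδ] with k hk
      have h1 := h (x₁ k) (x₂ k) (p₁ k) (q₁ k) ((hx₁ k).trans hk) ((hx₂ k).trans hk)
        ((hp₁ k).trans hk) ((hq₁ k).trans hk)
      rw [dist_zero_right, norm_smul, Real.norm_eq_abs, abs_of_pos (hrpos k)]
      have h2 := mul_le_mul_of_nonneg_left h1 (hrpos k).le
      have h3 : r k * (ε / 2 * ‖x₁ k - x₂ k‖) = ε / 2 := by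
        linear_combination (ε / 2) * hrn k
      linarith
    have e2 : Tendsto (fun k => r k • (f (x₂ k) (p₁ k) (q₁ k) - f (x₂ k) (p₂ k) (q₂ k))) l
        (𝓝 0) := by
      refine squeeze_zero_norm' ?_ (a := fun k : ℕ => Lf * ((1 : ℝ) / (k + 1))) ?_
      · filter_upwards [small hδf] with k hk
        have h1 := hfL (x₂ k) (x₂ k) (p₁ k) (p₂ k) (q₁ k) (q₂ k) ((hx₂ k).trans hk)
          ((hx₂ k).trans hk) ((hp₁ k).trans hk) ((hp₂ k).trans hk) ((hq₁ k).trans hk)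
          ((hq₂ k).trans hk)
        rw [sub_self, norm_zero, zero_add] at h1
        rw [norm_smul, Real.norm_eq_abs, abs_of_pos (hrpos k)]
        have h2 := mul_le_mul_of_nonneg_left h1 (hrpos k).le
        have h3 := mul_le_mul_of_nonneg_left (hpq k) hLf.le
        linarith
      · simpa using hzero.const_mul Lf
    have e3 := (e1.add e2).add (((Df xb pb qb).continuous.tendsto u).comp hlim)
    simp only [add_zero, zero_add] at e3
    refine e3.congr fun k => ?_
    change _ + _ + Df xb pb qb (r k • (x₁ k - x₂ k)) = _
    rw [map_smul, ← smul_add, ← smul_add]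
    congr 1
    abel
  have hfb : ∀ {x : ℕ → E} {p : ℕ → F} {q : ℕ → G}, (∀ k : ℕ, ‖x k - xb‖ < 1 / (k + 1)) →
      (∀ k : ℕ, ‖p k - pb‖ < 1 / (k + 1)) → (∀ k : ℕ, ‖q k - qb‖ < 1 / (k + 1)) →
      Tendsto (fun k => v k - f (x k) (p k) (q k)) l (𝓝 (vb - f xb pb qb)) := by
    intro x p q hx hp hq
    refine hv'.sub (tendsto_iff_norm_sub_tendsto_zero.2 (squeeze_zero' (Eventually.of_forall
      fun _ => norm_nonneg _) (g := fun k : ℕ => Lf * (3 * ((1 : ℝ) / (k + 1)))) ?_ ?_))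
    · filter_upwards [small hδf] with k hk
      refine (hfL (x k) xb (p k) pb (q k) qb ((hx k).trans hk) (by simpa using hδf)
        ((hp k).trans hk) (by simpa using hδf) ((hq k).trans hk) (by simpa using hδf)).trans ?_
      refine mul_le_mul_of_nonneg_left ?_ hLf.le
      linarith [hx k, hp k, hq k]
    · simpa using (hzero.const_mul 3).const_mul Lf
  obtain ⟨mu₁, hmu₁, hKb⟩ := SlaterRegularAt.isKKT_of_tendsto hc hreg hx₁' hp₁'
    (hfb hx₁ hp₁ hq₁) (Eventually.of_forall hK₁)
  have hmu₁' := tendsto_pi_nhds.1 hmu₁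
  obtain ⟨J₀, hJ₀⟩ := exists_eventually_eq_of_finite l J
  have hJind : LinearIndepOn ℝ (fun i => pgrad (φ i) xb pb) (J₀ : Set ι) := by
    obtain ⟨k, hk⟩ := hJ₀.exists
    exact hk ▸ hJ k
  have horth : ∀ i ∈ J₀, ⟪pgrad (φ i) xb pb, u⟫ = 0 := by
    intro i hi
    have h1 := tendsto_smul_sub_of_hasStrictFDerivAt ((hφ i).hasStrictFDerivAt (by simp))
      (hx₁'.prodMk_nhds hp₁') (hx₂'.prodMk_nhds hp₂') hdxp
    rw [fderiv_inl_eq_inner_pgrad ((hφ i).differentiableAt (by simp))] at h1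
    have h2 : ∀ᶠ k in l, r k • (φ i (x₁ k) (p₁ k) - φ i (x₂ k) (p₂ k)) = 0 := by
      filter_upwards [hJ₀] with k hk
      have hi' : i ∈ J k := by rw [hk]; exact hi
      rw [hφ₁ k i hi', hφ₂ k i hi', sub_self, smul_zero]
    exact tendsto_nhds_unique (h1.congr' h2) tendsto_const_nhds
  have horth' : ∀ i, 0 < mu₁ i → ⟪pgrad (φ i) xb pb, u⟫ = 0 := by
    intro i hi
    refine horth i ?_
    by_contra hiJ
    have : Tendsto (fun k => lam₁ k i) l (𝓝 0) := by
      refine tendsto_const_nhds.congr' ?_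
      filter_upwards [hJ₀] with k hk
      have hi' : i ∉ J k := by rw [hk]; exact hiJ
      rw [hJ₁ k i hi']
    exact hi.ne' (tendsto_nhds_unique (hmu₁' i) this)
  have hgr : ∀ i, Tendsto (fun k => r k • (pgrad (φ i) (x₁ k) (p₁ k)
      - pgrad (φ i) (x₂ k) (p₂ k))) l (𝓝 (phess (φ i) xb pb u)) := fun i =>
    tendsto_smul_sub_pgrad (hφ i) hx₁' hp₁' hx₂' hp₂' hdxp
  set w : ℕ → E := fun k => ∑ i, (r k * (lam₁ k i - lam₂ k i)) • pgrad (φ i) (x₂ k) (p₂ k) with hw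
  have hwlim : Tendsto w l
      (𝓝 (-(Df xb pb qb u + ∑ i, mu₁ i • phess (φ i) xb pb u))) := by
    have h1 := (hfx.add (tendsto_finsetSum Finset.univ fun i _ => (hmu₁' i).smul (hgr i))).neg
    refine h1.congr fun k => ?_
    have h2 : f (x₁ k) (p₁ k) (q₁ k) - f (x₂ k) (p₂ k) (q₂ k)
        = ∑ i, lam₂ k i • pgrad (φ i) (x₂ k) (p₂ k)
          - ∑ i, lam₁ k i • pgrad (φ i) (x₁ k) (p₁ k) := by
      rw [← (hK₁ k).2.2.2, ← (hK₂ k).2.2.2]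
      abel
    rw [h2, ← Finset.sum_sub_distrib, Finset.smul_sum, ← Finset.sum_add_distrib,
      ← Finset.sum_neg_distrib]
    refine Finset.sum_congr rfl fun i _ => ?_
    module
  obtain ⟨K, hK, hbd⟩ := hJind.exists_abs_le
  have hg₂ : ∀ i, Tendsto (fun k => pgrad (φ i) (x₂ k) (p₂ k)) l (𝓝 (pgrad (φ i) xb pb)) := fun i =>
    ((hreg.self_of_nhds.continuousAt_pgrad i).tendsto).comp (hx₂'.prodMk_nhds hp₂')
  have hwu : Tendsto (fun k => ⟪w k, u⟫) l (𝓝 0) := by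
    have h1 : Tendsto (fun k => ∑ i ∈ J₀, K * ‖w k‖ * |⟪pgrad (φ i) (x₂ k) (p₂ k), u⟫|) l
        (𝓝 (∑ i ∈ J₀, 0)) := by
      refine tendsto_finsetSum _ fun i hi => ?_
      have h2 := ((hg₂ i).inner (𝕜 := ℝ) (tendsto_const_nhds (x := u))).abs
      rw [horth i hi, abs_zero] at h2
      simpa using (hwlim.norm.const_mul K).mul h2
    rw [Finset.sum_const_zero] at h1
    refine squeeze_zero_norm' ?_ h1
    filter_upwards [hJ₀, (tendsto_pi_nhds.2 hg₂).eventually hbd] with k hk hb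
    have hoff : ∀ i ∉ J₀, r k * (lam₁ k i - lam₂ k i) = 0 := fun i hi => by
      have hi' : i ∉ J k := by rw [hk]; exact hi
      rw [hJ₁ k i hi', hJ₂ k i hi', sub_self, mul_zero]
    have h3 := hb _ hoff
    have h4 : ⟪w k, u⟫
        = ∑ i ∈ J₀, (r k * (lam₁ k i - lam₂ k i)) * ⟪pgrad (φ i) (x₂ k) (p₂ k), u⟫ := by
      simp only [hw, sum_inner, real_inner_smul_left]
      exact (Finset.sum_subset (Finset.subset_univ J₀) fun i _ hi => by simp [hoff i hi]).symm
    rw [h4]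
    refine norm_sum_le_of_le _ fun i _ => ?_
    rw [Real.norm_eq_abs, abs_mul]
    exact mul_le_mul_of_nonneg_right (h3 i) (abs_nonneg _)
  have hfin := tendsto_nhds_unique hwu (hwlim.inner tendsto_const_nhds)
  have hgood := hG mu₁ hKb u hu0 horth'
  rw [inner_neg_left, inner_add_left, sum_inner] at hfin
  simp only [real_inner_smul_left] at hfin
  linarith

/-- Solutions sharing an independent support of their multipliers depend on the parameters in a
Lipschitzian way. -/
theorem GSSOSC.exists_lipschitz_of_common_support {d : E} {c : ℝ} (hc : 0 < c)
    (hφ : ∀ i, ContDiffAt ℝ 2 (fun t : E × F => φ i t.1 t.2) (xb, pb))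
    (hreg : ∀ᶠ t in 𝓝 (xb, pb), SlaterRegularAt φ d c t)
    (hA1 : A1 f xb pb qb) (hA4 : A4 f Df xb pb qb)
    (hG : GSSOSC φ xb pb (Df xb pb qb) (vb - f xb pb qb)) :
    ∃ L > 0, ∃ ε > 0, ∀ x₁ x₂ p₁ p₂ q₁ q₂ v lam₁ lam₂ (J : Finset ι), ‖x₁ - xb‖ < ε →
      ‖x₂ - xb‖ < ε → ‖p₁ - pb‖ < ε → ‖p₂ - pb‖ < ε → ‖q₁ - qb‖ < ε → ‖q₂ - qb‖ < ε →
      ‖v - vb‖ < ε → LinearIndepOn ℝ (fun i => pgrad (φ i) xb pb) (J : Set ι) →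
      IsKKT φ x₁ p₁ lam₁ (v - f x₁ p₁ q₁) → IsKKT φ x₂ p₂ lam₂ (v - f x₂ p₂ q₂) →
      (∀ i ∉ J, lam₁ i = 0) → (∀ i ∉ J, lam₂ i = 0) →
      (∀ i ∈ J, φ i x₁ p₁ = 0) → (∀ i ∈ J, φ i x₂ p₂ = 0) →
      ‖x₁ - x₂‖ ≤ L * (‖p₁ - p₂‖ + ‖q₁ - q₂‖) := by
  by_contra hcon
  push Not at hcon
  choose x₁ x₂ p₁ p₂ q₁ q₂ v lam₁ lam₂ J hx₁ hx₂ hp₁ hp₂ hq₁ hq₂ hv hJ hK₁ hK₂ hJ₁ hJ₂ hφ₁ hφ₂ hlt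
    using fun k : ℕ => hcon ((k : ℝ) + 1) (by positivity) (1 / ((k : ℝ) + 1)) (by positivity)
  exact hG.false_of_common_support hc hφ hreg hA1 hA4 hx₁ hx₂ hp₁ hp₂ hq₁ hq₂ hv hJ hK₁ hK₂ hJ₁
    hJ₂ hφ₁ hφ₂ hlt

end Lipschitz

section Localization

variable {G : Type*} [NormedAddCommGroup G] [NormedSpace ℝ G]
variable {φ : ι → E → F → ℝ} {xb yb vb : E} {pb : F} {qb : G}
  {f : E → F → G → E} {Df : E → F → G → E →L[ℝ] E}

/-- A map which is calm with the same modulus at each point of a convex set is Lipschitz. -/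
theorem norm_sub_le_of_forall_eventually {Z Z' : Type*} [NormedAddCommGroup Z] [NormedSpace ℝ Z]
    [NormedAddCommGroup Z'] {S : Set Z} (hS : Convex ℝ S) {h : Z → Z'} {K : ℝ}
    (hh : ∀ z ∈ S, ∀ᶠ z' in 𝓝[S] z, ‖h z' - h z‖ ≤ K * ‖z' - z‖) {a b : Z} (ha : a ∈ S)
    (hb : b ∈ S) : ‖h b - h a‖ ≤ K * ‖b - a‖ := by
  set γ : ℝ → Z := fun t => a + t • (b - a) with hγ
  have hγS : ∀ t ∈ Icc (0 : ℝ) 1, γ t ∈ S := fun t ht => hS.add_smul_sub_mem ha hb ht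
  have hγd : ∀ t t', ‖γ t' - γ t‖ = |t' - t| * ‖b - a‖ := fun t t' => by
    rw [← Real.norm_eq_abs, ← norm_smul]
    congr 1
    simp only [hγ]
    module
  have hγc : Continuous γ := by fun_prop
  have hloc : ∀ t ∈ Icc (0 : ℝ) 1, ∀ᶠ t' in 𝓝[Icc 0 1] t,
      ‖h (γ t') - h (γ t)‖ ≤ K * ‖b - a‖ * |t' - t| := by
    intro t ht
    have h1 : Tendsto γ (𝓝[Icc 0 1] t) (𝓝[S] γ t) :=
      hγc.continuousWithinAt.tendsto_nhdsWithin hγS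
    filter_upwards [h1.eventually (hh _ (hγS t ht))] with t' ht'
    rw [hγd] at ht'
    linarith
  have hcont : ContinuousOn (fun t => ‖h (γ t) - h a‖) (Icc 0 1) := by
    intro t ht
    have h1 : Tendsto (fun t' => h (γ t')) (𝓝[Icc 0 1] t) (𝓝 (h (γ t))) := by
      refine tendsto_iff_norm_sub_tendsto_zero.2 (squeeze_zero' (Eventually.of_forall fun _ =>
        norm_nonneg _) (hloc t ht) ?_)
      refine Tendsto.mono_left ?_ nhdsWithin_le_nhds
      exact Continuous.tendsto' (by fun_prop) _ _ (by simp)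
    exact (h1.sub tendsto_const_nhds).norm
  have hfin := image_le_of_liminf_slope_right_le_deriv_boundary (f := fun t => ‖h (γ t) - h a‖)
    (B := fun t => K * ‖b - a‖ * t) (B' := fun _ => K * ‖b - a‖) hcont (by simp [hγ])
    (by fun_prop) (fun t _ => by
      simpa using ((hasDerivAt_id t).const_mul (K * ‖b - a‖)).hasDerivWithinAt) (by
      intro t ht r hr
      refine Eventually.frequently ?_
      have h1 : 𝓝[>] t ≤ 𝓝[Icc 0 1] t :=
        nhdsWithin_le_of_mem (mem_of_superset (Ioc_mem_nhdsGT ht.2)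
          fun s hs => ⟨ht.1.trans hs.1.le, hs.2⟩)
      filter_upwards [h1 (hloc t ⟨ht.1, ht.2.le⟩), self_mem_nhdsWithin] with z hz htz
      have h2 : 0 < z - t := sub_pos.2 htz
      rw [slope_def_field, div_lt_iff₀ h2]
      rw [abs_of_pos h2] at hz
      have h3 := norm_sub_norm_le (h (γ z) - h a) (h (γ t) - h a)
      rw [sub_sub_sub_cancel_right] at h3
      linarith [mul_lt_mul_of_pos_right hr h2]) (right_mem_Icc.2 zero_le_one)
  simpa [hγ] using hfin

theorem LocMonotone.exists_mul_sq_le {κ ε₀ : ℝ} (hκ : 0 < κ) (hε₀ : 0 < ε₀)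
    (hM : LocMonotone φ xb pb (Df xb pb qb) (vb - f xb pb qb) κ ε₀)
    (hA1 : A1 f xb pb qb) (hA4 : A4 f Df xb pb qb) :
    ∃ δ > 0, ∀ x₁ x₂ p q v₁ v₂ lam₁ lam₂, ‖x₁ - xb‖ < δ → ‖x₂ - xb‖ < δ → ‖p - pb‖ < δ →
      ‖q - qb‖ < δ → ‖v₁ - vb‖ < δ → ‖v₂ - vb‖ < δ →
      IsKKT φ x₁ p lam₁ (v₁ - f x₁ p q) → IsKKT φ x₂ p lam₂ (v₂ - f x₂ p q) →
      κ * ‖x₁ - x₂‖ ^ 2 ≤ ⟪v₁ - v₂, x₁ - x₂⟫ := by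
  obtain ⟨δ₁, hδ₁, h4⟩ := hA4.exists_norm_sub_sub_le hκ
  obtain ⟨L, hL, δ₂, hδ₂, h1⟩ := hA1.exists_norm_sub_le
  set δ : ℝ := min (min δ₁ δ₂) (ε₀ / (3 * L + 1)) with hδ
  have hδ0 : 0 < δ := by positivity
  have hδε : (3 * L + 1) * δ ≤ ε₀ := by
    have := min_le_right (min δ₁ δ₂) (ε₀ / (3 * L + 1))
    rw [← hδ, le_div_iff₀ (by positivity)] at this
    linarith
  have hδε₀ : δ ≤ ε₀ := by nlinarith
  have hδ1 : δ ≤ δ₁ := (min_le_left _ _).trans (min_le_left _ _)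
  have hδ2 : δ ≤ δ₂ := (min_le_left _ _).trans (min_le_right _ _)
  refine ⟨δ, hδ0, fun x₁ x₂ p q v₁ v₂ lam₁ lam₂ hx₁ hx₂ hp hq hv₁ hv₂ hK₁ hK₂ => ?_⟩
  have hy : ∀ x v, ‖x - xb‖ < δ → ‖v - vb‖ < δ →
      ‖(v - f x p q) - (vb - f xb pb qb)‖ < ε₀ := by
    intro x v hx hv
    have h2 := h1 x xb p pb q qb (hx.trans_le hδ2) (by simpa using hδ₂) (hp.trans_le hδ2)
      (by simpa using hδ₂) (hq.trans_le hδ2) (by simpa using hδ₂)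
    have h3 : (v - f x p q) - (vb - f xb pb qb) = (v - vb) - (f x p q - f xb pb qb) := by abel
    rw [h3]
    have h4 := norm_sub_le (v - vb) (f x p q - f xb pb qb)
    have h5 : L * (‖x - xb‖ + ‖p - pb‖ + ‖q - qb‖) ≤ L * (3 * δ) :=
      mul_le_mul_of_nonneg_left (by linarith) hL.le
    linarith
  have h2 := hM x₁ x₂ p lam₁ lam₂ _ _ (hx₁.trans_le hδε₀) (hx₂.trans_le hδε₀) (hp.trans_le hδε₀)
    (hy x₁ v₁ hx₁ hv₁) (hy x₂ v₂ hx₂ hv₂) hK₁ hK₂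
  have h3 := h4 x₁ x₂ p q (hx₁.trans_le hδ1) (hx₂.trans_le hδ1) (hp.trans_le hδ1)
    (hq.trans_le hδ1)
  have h5 := (abs_le.1 (abs_real_inner_le_norm
    (f x₁ p q - f x₂ p q - Df xb pb qb (x₁ - x₂)) (x₁ - x₂))).1
  have h6 := mul_le_mul_of_nonneg_right h3 (norm_nonneg (x₁ - x₂))
  have h7 : ⟪v₁ - f x₁ p q - (v₂ - f x₂ p q), x₁ - x₂⟫ = ⟪v₁ - v₂, x₁ - x₂⟫
      - ⟪f x₁ p q - f x₂ p q - Df xb pb qb (x₁ - x₂), x₁ - x₂⟫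
      - ⟪Df xb pb qb (x₁ - x₂), x₁ - x₂⟫ := by
    rw [← inner_sub_left, ← inner_sub_left]
    congr 1
    abel
  rw [h7] at h2
  linarith

theorem LocSolvable.exists_isKKT {κ ε₀ : ℝ}
    (hA : LocSolvable φ xb pb (Df xb pb qb) (vb - f xb pb qb)) (hκ : 0 < κ) (hε₀ : 0 < ε₀)
    (hM : LocMonotone φ xb pb (Df xb pb qb) (vb - f xb pb qb) κ ε₀)
    (hA1 : A1 f xb pb qb) (hA4 : A4 f Df xb pb qb) {ε : ℝ} (hε : 0 < ε) :
    ∃ δ > 0, ∀ v p q, ‖v - vb‖ < δ → ‖p - pb‖ < δ → ‖q - qb‖ < δ →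
      ∃ x lam, ‖x - xb‖ ≤ ε ∧ IsKKT φ x p lam (v - f x p q) := by
  obtain ⟨δ₁, hδ₁, h4⟩ := hA4.exists_norm_sub_sub_le hκ
  obtain ⟨L, hL, δ₂, hδ₂, h1⟩ := hA1.exists_norm_sub_le
  have hε' : 0 < min ε (δ₁ / 2) := by positivity
  obtain ⟨δ₃, hδ₃, h3⟩ := hA.exists_isKKT_of_lipschitz hκ hε₀ hM hε'
  set δ : ℝ := min (min δ₁ δ₂) (δ₃ / (2 * L + 1)) with hδ
  have hδ0 : 0 < δ := by positivity
  have hδε : (2 * L + 1) * δ ≤ δ₃ := by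
    have := min_le_right (min δ₁ δ₂) (δ₃ / (2 * L + 1))
    rw [← hδ, le_div_iff₀ (by positivity)] at this
    linarith
  have hδ3 : δ ≤ δ₃ := by nlinarith
  have hδ1 : δ ≤ δ₁ := (min_le_left _ _).trans (min_le_left _ _)
  have hδ2 : δ ≤ δ₂ := (min_le_left _ _).trans (min_le_right _ _)
  refine ⟨δ, hδ0, fun v p q hv hp hq => ?_⟩
  obtain ⟨x, lam, hx, hK⟩ := h3 p (fun x => v - f x p q + Df xb pb qb (x - xb))
    (hp.trans_le hδ3) (by
      have h2 := h1 xb xb p pb q qb (by simpa using hδ₂) (by simpa using hδ₂) (hp.trans_le hδ2)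
        (by simpa using hδ₂) (hq.trans_le hδ2) (by simpa using hδ₂)
      rw [sub_self, norm_zero, zero_add] at h2
      have h5 : v - f xb p q + Df xb pb qb (xb - xb) - (vb - f xb pb qb)
          = (v - vb) - (f xb p q - f xb pb qb) := by
        rw [sub_self, map_zero]
        abel
      change ‖v - f xb p q + Df xb pb qb (xb - xb) - (vb - f xb pb qb)‖ < δ₃
      rw [h5]
      have h6 := norm_sub_le (v - vb) (f xb p q - f xb pb qb)
      have h7 : L * (‖p - pb‖ + ‖q - qb‖) ≤ L * (2 * δ) :=
        mul_le_mul_of_nonneg_left (by linarith) hL.le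
      linarith)
    (by
      intro x x' hx hx'
      have hlt : min ε (δ₁ / 2) < δ₁ := (min_le_right _ _).trans_lt (half_lt_self hδ₁)
      have h2 := h4 x x' p q (hx.trans_lt hlt) (hx'.trans_lt hlt) (hp.trans_le hδ1)
        (hq.trans_le hδ1)
      rw [← norm_neg]
      refine le_trans (le_of_eq ?_) h2
      congr 1
      simp only [map_sub]
      abel)
  refine ⟨x, lam, hx.trans (min_le_left _ _), ?_⟩
  simpa using hK

end Localization

section FullStability

variable {G : Type*} [NormedAddCommGroup G] [NormedSpace ℝ G]
variable {φ : ι → E → F → ℝ} {xb yb vb : E} {pb : F} {qb : G}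
  {f : E → F → G → E} {Df : E → F → G → E →L[ℝ] E}

theorem GSSOSC.exists_lipschitz_localization {d : E} {c : ℝ} (hc : 0 < c)
    (hφ : ∀ i, ContDiffAt ℝ 2 (fun t : E × F => φ i t.1 t.2) (xb, pb))
    (hreg : ∀ᶠ t in 𝓝 (xb, pb), SlaterRegularAt φ d c t)
    (hcr : ∃ Wn ∈ 𝓝 (xb, pb), ∀ J : Finset ι, (∀ i ∈ J, φ i xb pb = 0) →
      ∀ t₁ ∈ Wn, ∀ t₂ ∈ Wn,
        Module.finrank ℝ ↥(Submodule.span ℝ ((fun i => pgrad (φ i) t₁.1 t₁.2) '' (J : Set ι)))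
          = Module.finrank ℝ
            ↥(Submodule.span ℝ ((fun i => pgrad (φ i) t₂.1 t₂.2) '' (J : Set ι))))
    (hA1 : A1 f xb pb qb) (hA4 : A4 f Df xb pb qb)
    (hG : GSSOSC φ xb pb (Df xb pb qb) (vb - f xb pb qb)) {lamb : ι → ℝ}
    (hb : IsKKT φ xb pb lamb (vb - f xb pb qb)) :
    ∃ κ > 0, ∃ L > 0, ∃ ε > 0, ∃ δ > 0,
      (∀ x p, ‖x - xb‖ < ε → ‖p - pb‖ < δ → ∀ y,
        y ∈ limNC (feas φ p) x ↔ ∃ lam, IsKKT φ x p lam y) ∧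
      (∀ x₁ x₂ p q v₁ v₂ lam₁ lam₂, ‖x₁ - xb‖ < ε → ‖x₂ - xb‖ < ε → ‖p - pb‖ < δ →
        ‖q - qb‖ < δ → ‖v₁ - vb‖ < δ → ‖v₂ - vb‖ < δ →
        IsKKT φ x₁ p lam₁ (v₁ - f x₁ p q) → IsKKT φ x₂ p lam₂ (v₂ - f x₂ p q) →
        κ * ‖x₁ - x₂‖ ^ 2 ≤ ⟪v₁ - v₂, x₁ - x₂⟫) ∧
      ∃ ϑ : E → F → G → E, (∀ v p q, ‖v - vb‖ < δ → ‖p - pb‖ < δ → ‖q - qb‖ < δ →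
        ‖ϑ v p q - xb‖ < ε ∧ ∃ lam, IsKKT φ (ϑ v p q) p lam (v - f (ϑ v p q) p q)) ∧
      ∀ v p₁ p₂ q₁ q₂, ‖v - vb‖ < δ → ‖p₁ - pb‖ < δ → ‖p₂ - pb‖ < δ → ‖q₁ - qb‖ < δ →
        ‖q₂ - qb‖ < δ → ‖ϑ v p₁ q₁ - ϑ v p₂ q₂‖ ≤ L * (‖p₁ - p₂‖ + ‖q₁ - q₂‖) := by
  obtain ⟨κ, hκ, ε₀, hε₀, -, hM⟩ := hG.exists_growth_and_locMonotone hc hφ hreg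
  obtain ⟨δ₁, hδ₁, hmono⟩ := hM.exists_mul_sq_le hκ hε₀ hA1 hA4
  obtain ⟨L, hL, δ₂, hδ₂, hlip⟩ := hG.exists_lipschitz_of_common_support hc hφ hreg hA1 hA4
  obtain ⟨Lf, hLf, δ₃, hδ₃, hf⟩ := hA1.exists_norm_sub_le
  obtain ⟨δ₄, hδ₄, hnear⟩ := Metric.eventually_nhds_iff.1 ((eventually_mem_limNC_iff hc hreg).and
    ((eventually_exists_isKKT_linearIndepOn (fun i => (hφ i).continuousAt) hcr).and
      (eventually_eventually_nhds.2 hreg)))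
  have hnear' : ∀ x p, ‖x - xb‖ < δ₄ → ‖p - pb‖ < δ₄ → _ := fun x p hx hp =>
    @hnear (x, p) (by
      rw [Prod.dist_eq, max_lt_iff, dist_eq_norm, dist_eq_norm]
      exact ⟨hx, hp⟩)
  set ε : ℝ := min (min δ₁ δ₂) (min δ₃ δ₄) with hε
  have hε0 : 0 < ε := by positivity
  have hε1 : ε ≤ δ₁ := (min_le_left _ _).trans (min_le_left _ _)
  have hε2 : ε ≤ δ₂ := (min_le_left _ _).trans (min_le_right _ _)
  have hε3 : ε ≤ δ₃ := (min_le_right _ _).trans (min_le_left _ _)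
  have hε4 : ε ≤ δ₄ := (min_le_right _ _).trans (min_le_right _ _)
  obtain ⟨δ₅, hδ₅, hex⟩ := (hG.locSolvable hc hφ hreg hb).exists_isKKT hκ hε₀ hM hA1 hA4
    (half_pos hε0)
  set δ : ℝ := min δ₅ ε with hδ
  have hδ0 : 0 < δ := by positivity
  have hδε : δ ≤ ε := min_le_right _ _
  have hex' : ∀ v p q, ∃ x, ‖v - vb‖ < δ → ‖p - pb‖ < δ → ‖q - qb‖ < δ →
      ‖x - xb‖ ≤ ε / 2 ∧ ∃ lam, IsKKT φ x p lam (v - f x p q) := by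
    intro v p q
    by_cases h : ‖v - vb‖ < δ ∧ ‖p - pb‖ < δ ∧ ‖q - qb‖ < δ
    · obtain ⟨x, lam, hx, hK⟩ := hex v p q (h.1.trans_le (min_le_left _ _))
        (h.2.1.trans_le (min_le_left _ _)) (h.2.2.trans_le (min_le_left _ _))
      exact ⟨x, fun _ _ _ => ⟨hx, lam, hK⟩⟩
    · exact ⟨xb, fun h₁ h₂ h₃ => absurd ⟨h₁, h₂, h₃⟩ h⟩
  choose ϑ hϑ using hex'
  have hϑε : ∀ v p q, ‖v - vb‖ < δ → ‖p - pb‖ < δ → ‖q - qb‖ < δ → ‖ϑ v p q - xb‖ < ε :=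
    fun v p q h₁ h₂ h₃ => (hϑ v p q h₁ h₂ h₃).1.trans_lt (half_lt_self hε0)
  have hmono' : ∀ x₁ x₂ p q v₁ v₂ lam₁ lam₂, ‖x₁ - xb‖ < ε → ‖x₂ - xb‖ < ε → ‖p - pb‖ < δ →
        ‖q - qb‖ < δ → ‖v₁ - vb‖ < δ → ‖v₂ - vb‖ < δ →
        IsKKT φ x₁ p lam₁ (v₁ - f x₁ p q) → IsKKT φ x₂ p lam₂ (v₂ - f x₂ p q) →
        κ * ‖x₁ - x₂‖ ^ 2 ≤ ⟪v₁ - v₂, x₁ - x₂⟫ := by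
    intro x₁ x₂ p q v₁ v₂ lam₁ lam₂ h₁ h₂ h₃ h₄ h₅ h₆
    have hδ1 := hδε.trans hε1
    exact hmono x₁ x₂ p q v₁ v₂ lam₁ lam₂ (h₁.trans_le hε1) (h₂.trans_le hε1) (h₃.trans_le hδ1)
      (h₄.trans_le hδ1) (h₅.trans_le hδ1) (h₆.trans_le hδ1)
  refine ⟨κ, hκ, 2 * L, by positivity, ε, hε0, δ, hδ0, fun x p hx hp =>
    (hnear' x p (hx.trans_le hε4) (hp.trans_le (hδε.trans hε4))).1, hmono', ϑ,
    fun v p q h₁ h₂ h₃ => ⟨hϑε v p q h₁ h₂ h₃, (hϑ v p q h₁ h₂ h₃).2⟩, ?_⟩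
  intro v p₁ p₂ q₁ q₂ hv hp₁ hp₂ hq₁ hq₂
  have hcalm : ∀ z ∈ ball pb δ ×ˢ ball qb δ, ∀ᶠ z' in 𝓝[ball pb δ ×ˢ ball qb δ] z,
      ‖ϑ v z'.1 z'.2 - ϑ v z.1 z.2‖ ≤ 2 * L * ‖z' - z‖ := by
    rintro ⟨p₀, q₀⟩ ⟨hp₀, hq₀⟩
    rw [mem_ball_iff_norm] at hp₀ hq₀
    change ‖p₀ - pb‖ < δ at hp₀
    change ‖q₀ - qb‖ < δ at hq₀
    refine Filter.mem_iff_ultrafilter.2 fun l hl => ?_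
    have hlS : ∀ᶠ z : F × G in l, ‖z.1 - pb‖ < δ ∧ ‖z.2 - qb‖ < δ := by
      filter_upwards [hl self_mem_nhdsWithin] with z hz
      exact ⟨mem_ball_iff_norm.1 hz.1, mem_ball_iff_norm.1 hz.2⟩
    have hlz : Tendsto (fun z : F × G => z) l (𝓝 (p₀, q₀)) := hl.trans nhdsWithin_le_nhds
    have hlp : Tendsto (fun z : F × G => z.1) l (𝓝 p₀) := (continuous_fst.tendsto _).comp hlz
    have hlq : Tendsto (fun z : F × G => z.2) l (𝓝 q₀) := (continuous_snd.tendsto _).comp hlz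
    have hred : ∀ z : F × G, ∃ J : Finset ι, ∃ mu : ι → ℝ,
        ‖z.1 - pb‖ < δ ∧ ‖z.2 - qb‖ < δ →
        LinearIndepOn ℝ (fun i => pgrad (φ i) xb pb) (J : Set ι) ∧
        IsKKT φ (ϑ v z.1 z.2) z.1 mu (v - f (ϑ v z.1 z.2) z.1 z.2) ∧ (∀ i ∉ J, mu i = 0) ∧
        ∀ i ∈ J, φ i (ϑ v z.1 z.2) z.1 = 0 := by
      intro z
      by_cases h : ‖z.1 - pb‖ < δ ∧ ‖z.2 - qb‖ < δ
      · obtain ⟨lam, hK⟩ := (hϑ v z.1 z.2 hv h.1 h.2).2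
        obtain ⟨J, hJ, mu, h⟩ := (hnear' _ _ ((hϑε v z.1 z.2 hv h.1 h.2).trans_le hε4)
          (h.1.trans_le (hδε.trans hε4))).2.1 lam _ hK
        exact ⟨J, mu, fun _ => ⟨hJ, h⟩⟩
      · exact ⟨∅, 0, fun h' => absurd h' h⟩
    choose J mu hJ using hred
    obtain ⟨J₀, hJ₀⟩ := exists_eventually_eq_of_finite l J
    have hlball : ∀ᶠ z : F × G in l, ϑ v z.1 z.2 ∈ closedBall xb (ε / 2) := by
      filter_upwards [hlS] with z hz
      exact mem_closedBall_iff_norm.2 (hϑ v z.1 z.2 hv hz.1 hz.2).1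
    obtain ⟨x₀, hx₀, hlx⟩ := (isCompact_closedBall xb (ε / 2)).ultrafilter_le_nhds'
      (l.map fun z : F × G => ϑ v z.1 z.2) hlball
    have hlx : Tendsto (fun z : F × G => ϑ v z.1 z.2) l (𝓝 x₀) := hlx
    have hx₀ε : ‖x₀ - xb‖ < ε := (mem_closedBall_iff_norm.1 hx₀).trans_lt (half_lt_self hε0)
    have hlf : Tendsto (fun z : F × G => f (ϑ v z.1 z.2) z.1 z.2) l (𝓝 (f x₀ p₀ q₀)) := by
      refine tendsto_iff_norm_sub_tendsto_zero.2 (squeeze_zero' (Eventually.of_forall fun _ =>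
        norm_nonneg _) (g := fun z : F × G =>
          Lf * (‖ϑ v z.1 z.2 - x₀‖ + ‖z.1 - p₀‖ + ‖z.2 - q₀‖)) ?_ ?_)
      · filter_upwards [hlS] with z hz
        have hδ3 := hδε.trans hε3
        exact hf _ _ _ _ _ _ ((hϑε v z.1 z.2 hv hz.1 hz.2).trans_le hε3) (hx₀ε.trans_le hε3)
          (hz.1.trans_le hδ3) (hp₀.trans_le hδ3) (hz.2.trans_le hδ3) (hq₀.trans_le hδ3)
      · simpa using (((tendsto_iff_norm_sub_tendsto_zero.1 hlx).add
          (tendsto_iff_norm_sub_tendsto_zero.1 hlp)).add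
          (tendsto_iff_norm_sub_tendsto_zero.1 hlq)).const_mul Lf
    have hreg₀ := (hnear' x₀ p₀ (hx₀ε.trans_le hε4) (hp₀.trans_le (hδε.trans hε4))).2.2
    obtain ⟨lam₀, hlam₀, hK₀⟩ := SlaterRegularAt.isKKT_of_tendsto hc hreg₀ hlx hlp
      (tendsto_const_nhds.sub hlf) (by
        filter_upwards [hlS] with z hz
        exact (hJ z hz).2.1)
    have hx₀eq : ϑ v p₀ q₀ = x₀ := by
      obtain ⟨lam, hK⟩ := (hϑ v p₀ q₀ hv hp₀ hq₀).2
      have h1 := hmono' _ _ _ _ _ _ _ _ (hϑε v p₀ q₀ hv hp₀ hq₀) hx₀ε hp₀ hq₀ hv hv hK hK₀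
      rw [sub_self, inner_zero_left] at h1
      have h2 : ‖ϑ v p₀ q₀ - x₀‖ ^ 2 = 0 :=
        le_antisymm (nonpos_of_mul_nonpos_right h1 hκ) (sq_nonneg _)
      exact sub_eq_zero.1 (norm_eq_zero.1 (pow_eq_zero_iff two_ne_zero |>.1 h2))
    have hoff : ∀ i ∉ J₀, lam₀ i = 0 := by
      intro i hi
      refine tendsto_nhds_unique (tendsto_pi_nhds.1 hlam₀ i) (tendsto_const_nhds.congr' ?_)
      filter_upwards [hlS, hJ₀] with z hz hzJ
      exact ((hJ z hz).2.2.1 i (by rw [hzJ]; exact hi)).symm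
    have hact : ∀ i ∈ J₀, φ i x₀ p₀ = 0 := by
      intro i hi
      have h1 : Tendsto (fun z : F × G => φ i (ϑ v z.1 z.2) z.1) l (𝓝 (φ i x₀ p₀)) :=
        ((hreg₀.self_of_nhds.continuousAt i).tendsto).comp (hlx.prodMk_nhds hlp)
      refine tendsto_nhds_unique h1 (tendsto_const_nhds.congr' ?_)
      filter_upwards [hlS, hJ₀] with z hz hzJ
      exact ((hJ z hz).2.2.2 i (by rw [hzJ]; exact hi)).symm
    filter_upwards [hlS, hJ₀] with z hz hzJ
    obtain ⟨h1, h2, h3, h4⟩ := hJ z hz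
    rw [hzJ] at h1 h3 h4
    have hδ2 := hδε.trans hε2
    change ‖ϑ v z.1 z.2 - ϑ v p₀ q₀‖ ≤ 2 * L * ‖z - (p₀, q₀)‖
    rw [hx₀eq]
    refine (hlip _ _ _ _ _ _ v _ _ J₀ ((hϑε v z.1 z.2 hv hz.1 hz.2).trans_le hε2)
      (hx₀ε.trans_le hε2) (hz.1.trans_le hδ2) (hp₀.trans_le hδ2) (hz.2.trans_le hδ2)
      (hq₀.trans_le hδ2) (hv.trans_le hδ2) h1 h2 hK₀ h3 hoff h4 hact).trans ?_
    have h5 := mul_le_mul_of_nonneg_left (norm_fst_le (z - (p₀, q₀))) hL.le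
    have h6 := mul_le_mul_of_nonneg_left (norm_snd_le (z - (p₀, q₀))) hL.le
    change L * ‖z.1 - p₀‖ ≤ _ at h5
    change L * ‖z.2 - q₀‖ ≤ _ at h6
    linarith
  have hfin := norm_sub_le_of_forall_eventually ((convex_ball pb δ).prod (convex_ball qb δ))
    (h := fun z : F × G => ϑ v z.1 z.2) hcalm (a := (p₂, q₂)) (b := (p₁, q₁))
    ⟨mem_ball_iff_norm.2 hp₂, mem_ball_iff_norm.2 hq₂⟩
    ⟨mem_ball_iff_norm.2 hp₁, mem_ball_iff_norm.2 hq₁⟩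
  refine hfin.trans (mul_le_mul_of_nonneg_left ?_ (by positivity))
  rw [Prod.mk_sub_mk, Prod.norm_def]
  exact max_le_add_of_nonneg (norm_nonneg _) (norm_nonneg _)

theorem norm_sub_smul_le_of_mul_sq_le {κ : ℝ} (hκ : 0 ≤ κ) {v x : E}
    (h : κ * ‖x‖ ^ 2 ≤ ⟪v, x⟫) : ‖v - (2 * κ) • x‖ ≤ ‖v‖ := by
  refine abs_le_of_sq_le_sq' ?_ (norm_nonneg _) |>.2
  rw [norm_sub_sq_real, real_inner_smul_right, norm_smul, Real.norm_eq_abs,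
    abs_of_nonneg (by positivity)]
  nlinarith [mul_le_mul_of_nonneg_left h hκ]

theorem mul_sq_le_of_norm_sub_smul_le {κ : ℝ} (hκ : 0 < κ) {v x : E}
    (h : ‖v - (2 * κ) • x‖ ≤ ‖v‖) : κ * ‖x‖ ^ 2 ≤ ⟪v, x⟫ := by
  have h1 := pow_le_pow_left₀ (norm_nonneg _) h 2
  rw [norm_sub_sq_real, real_inner_smul_right, norm_smul, Real.norm_eq_abs,
    abs_of_pos (by positivity)] at h1
  have h2 : κ * (κ * ‖x‖ ^ 2) ≤ κ * ⟪v, x⟫ := by linarith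
  exact le_of_mul_le_mul_left h2 hκ

theorem GSSOSC.lipFullStable {d : E} {c : ℝ} (hc : 0 < c)
    (hφ : ∀ i, ContDiffAt ℝ 2 (fun t : E × F => φ i t.1 t.2) (xb, pb))
    (hreg : ∀ᶠ t in 𝓝 (xb, pb), SlaterRegularAt φ d c t)
    (hcr : ∃ Wn ∈ 𝓝 (xb, pb), ∀ J : Finset ι, (∀ i ∈ J, φ i xb pb = 0) →
      ∀ t₁ ∈ Wn, ∀ t₂ ∈ Wn,
        Module.finrank ℝ ↥(Submodule.span ℝ ((fun i => pgrad (φ i) t₁.1 t₁.2) '' (J : Set ι)))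
          = Module.finrank ℝ
            ↥(Submodule.span ℝ ((fun i => pgrad (φ i) t₂.1 t₂.2) '' (J : Set ι))))
    (hA1 : A1 f xb pb qb) (hA4 : A4 f Df xb pb qb)
    (hG : GSSOSC φ xb pb (Df xb pb qb) (vb - f xb pb qb))
    (hsol : vb - f xb pb qb ∈ limNC (feas φ pb) xb) :
    LipFullStable (fun v p q => {x | v - f x p q ∈ limNC (feas φ p) x}) xb vb pb qb := by
  obtain ⟨lamb, hb⟩ := ((eventually_mem_limNC_iff hc hreg).self_of_nhds _).1 hsol
  obtain ⟨κ, hκ, L, hL, ε, hε, δ, hδ, hiff, hmono, ϑ, hϑ, hlip⟩ :=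
    hG.exists_lipschitz_localization hc hφ hreg hcr hA1 hA4 hb
  refine ⟨ball vb δ, ball_mem_nhds _ hδ, ball pb δ, ball_mem_nhds _ hδ, ball qb δ,
    ball_mem_nhds _ hδ, ball xb ε, ball_mem_nhds _ hε, ϑ, ?_, κ, hκ, 2 * κ * L, by positivity, ?_⟩
  · intro v hv p hp q hq
    rw [mem_ball_iff_norm] at hv hp hq
    obtain ⟨h1, lam, hK⟩ := hϑ v p q hv hp hq
    refine ⟨mem_ball_iff_norm.2 h1, (hiff _ _ h1 hp _).2 ⟨lam, hK⟩, fun x hx hxS => ?_⟩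
    rw [mem_ball_iff_norm] at hx
    obtain ⟨mu, hK'⟩ := (hiff _ _ hx hp _).1 hxS
    have h2 := hmono _ _ _ _ _ _ _ _ hx h1 hp hq hv hv hK' hK
    rw [sub_self, inner_zero_left] at h2
    have h3 : ‖x - ϑ v p q‖ ^ 2 = 0 :=
      le_antisymm (nonpos_of_mul_nonpos_right h2 hκ) (sq_nonneg _)
    exact sub_eq_zero.1 (norm_eq_zero.1 (pow_eq_zero_iff two_ne_zero |>.1 h3))
  · intro v₁ hv₁ p₁ hp₁ q₁ hq₁ v₂ hv₂ p₂ hp₂ q₂ hq₂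
    rw [mem_ball_iff_norm] at hv₁ hp₁ hq₁ hv₂ hp₂ hq₂
    obtain ⟨h1, lam₁, hK₁⟩ := hϑ v₁ p₁ q₁ hv₁ hp₁ hq₁
    obtain ⟨h2, lam₂, hK₂⟩ := hϑ v₂ p₁ q₁ hv₂ hp₁ hq₁
    have h3 := norm_sub_smul_le_of_mul_sq_le hκ.le
      (hmono _ _ _ _ _ _ _ _ h1 h2 hp₁ hq₁ hv₁ hv₂ hK₁ hK₂)
    have h4 := hlip v₂ p₁ p₂ q₁ q₂ hv₂ hp₁ hp₂ hq₁ hq₂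
    have h5 : v₁ - v₂ - (2 * κ) • (ϑ v₁ p₁ q₁ - ϑ v₂ p₂ q₂)
        = (v₁ - v₂ - (2 * κ) • (ϑ v₁ p₁ q₁ - ϑ v₂ p₁ q₁))
          - (2 * κ) • (ϑ v₂ p₁ q₁ - ϑ v₂ p₂ q₂) := by module
    rw [h5, dist_eq_norm, dist_eq_norm]
    refine (norm_sub_le _ _).trans (add_le_add h3 ?_)
    rw [norm_smul, Real.norm_eq_abs, abs_of_pos (by positivity), mul_assoc (2 * κ)]
    exact mul_le_mul_of_nonneg_left h4 (by positivity)

end FullStability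

section Independence

theorem _root_.LinearIndependent.exists_inner_eq {κ : Type*} [Finite κ] {g : κ → E}
    (h : LinearIndependent ℝ g) (b : κ → ℝ) : ∃ d : E, ∀ i, ⟪g i, d⟫ = b i := by
  classical
  have := Fintype.ofFinite κ
  obtain ⟨L, hL⟩ := (Fintype.linearCombination ℝ g).exists_leftInverse_of_injective
    (LinearMap.ker_eq_bot.2 (linearIndependent_iff_injective_fintypeLinearCombination.1 h))
  set ℓ : E →ₗ[ℝ] ℝ := (Fintype.linearCombination ℝ b).comp L with hℓ
  refine ⟨(InnerProductSpace.toDual ℝ E).symm (LinearMap.toContinuousLinearMap ℓ), fun i => ?_⟩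
  rw [real_inner_comm, InnerProductSpace.toDual_symm_apply]
  have h1 : L (g i) = Pi.single i 1 := by
    have h2 := LinearMap.congr_fun hL (Pi.single i 1)
    simpa [Fintype.linearCombination_apply_single] using h2
  simp [hℓ, h1, Fintype.linearCombination_apply_single]

theorem finrank_span_image_eq_card {g : ι → E} {J : Finset ι}
    (h : LinearIndepOn ℝ g (J : Set ι)) :
    Module.finrank ℝ ↥(Submodule.span ℝ (g '' (J : Set ι))) = J.card := by
  rw [Set.image_eq_range]
  have := finrank_span_eq_card (R := ℝ) (b := fun i : (J : Set ι) => g i) h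
  simpa using this

theorem _root_.LinearIndepOn.eventually_nhds {g₀ : ι → E} {J : Finset ι}
    (h : LinearIndepOn ℝ g₀ (J : Set ι)) : ∀ᶠ g in 𝓝 g₀, LinearIndepOn ℝ g (J : Set ι) := by
  classical
  obtain ⟨K, hK, hev⟩ := h.exists_abs_le
  filter_upwards [hev] with g hg
  rw [linearIndepOn_finset_iff]
  intro a ha i hi
  have h1 := hg (fun i => if i ∈ J then a i else 0) (fun i hi => by simp [hi]) i
  have h2 : ∑ i, (if i ∈ J then a i else 0) • g i = 0 := by
    rw [← ha]
    simp [ite_smul]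
  rw [h2, norm_zero, mul_zero] at h1
  simpa [hi] using h1

theorem exists_nhds_finrank_eq_of_linearIndepOn {φ : ι → E → F → ℝ} {xb : E} {pb : F}
    (hφ : ∀ i, ContDiffAt ℝ 2 (fun t : E × F => φ i t.1 t.2) (xb, pb))
    (hli : LinearIndepOn ℝ (fun i => pgrad (φ i) xb pb) {i | φ i xb pb = 0}) :
    ∃ Wn ∈ 𝓝 (xb, pb), ∀ J : Finset ι, (∀ i ∈ J, φ i xb pb = 0) →
      ∀ t₁ ∈ Wn, ∀ t₂ ∈ Wn,
        Module.finrank ℝ ↥(Submodule.span ℝ ((fun i => pgrad (φ i) t₁.1 t₁.2) '' (J : Set ι)))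
          = Module.finrank ℝ
            ↥(Submodule.span ℝ ((fun i => pgrad (φ i) t₂.1 t₂.2) '' (J : Set ι))) := by
  have hcont : ContinuousAt (fun t : E × F => fun i => pgrad (φ i) t.1 t.2) (xb, pb) :=
    continuousAt_pi.2 fun i => (contDiffAt_pgrad (hφ i)).continuousAt
  have hev : ∀ᶠ t in 𝓝 (xb, pb), ∀ J : Finset ι, (∀ i ∈ J, φ i xb pb = 0) →
      LinearIndepOn ℝ (fun i => pgrad (φ i) t.1 t.2) (J : Set ι) := by
    rw [eventually_all]
    intro J
    by_cases hJ : ∀ i ∈ J, φ i xb pb = 0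
    · filter_upwards [hcont.tendsto.eventually (hli.mono fun i hi => hJ i hi).eventually_nhds]
        with t ht _
      exact ht
    · exact Eventually.of_forall fun t h => absurd h hJ
  refine ⟨_, hev, fun J hJ t₁ h₁ t₂ h₂ => ?_⟩
  rw [finrank_span_image_eq_card (h₁ J hJ), finrank_span_image_eq_card (h₂ J hJ)]

end Independence

section Curves

theorem exists_curve_of_inner_eq_zero {κ : Type*} [Finite κ] {h : κ → E → ℝ} {g : κ → E} {xb w : E}
    (hh : ∀ i, HasStrictFDerivAt (h i) (innerSL ℝ (g i)) xb) (hg : LinearIndependent ℝ g)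
    (h0 : ∀ i, h i xb = 0) (hw : ∀ i, ⟪g i, w⟫ = 0) :
    ∃ x : ℝ → E, x 0 = xb ∧ HasDerivAt x w 0 ∧ ∀ᶠ t in 𝓝 0, ∀ i, h i (x t) = 0 := by
  have := Fintype.ofFinite κ
  have := FiniteDimensional.complete ℝ E
  set Φ : E → κ → ℝ := fun x i => h i x with hΦ
  set Φ' : E →L[ℝ] κ → ℝ := ContinuousLinearMap.pi fun i => innerSL ℝ (g i) with hΦ'
  have hd : HasStrictFDerivAt Φ Φ' xb := hasStrictFDerivAt_pi'' fun i => hh i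
  have hr : Φ'.range = ⊤ := by
    refine LinearMap.range_eq_top.2 fun b => ?_
    obtain ⟨d, hd⟩ := hg.exists_inner_eq b
    exact ⟨d, funext fun i => by simp [hΦ', hd i]⟩
  have hwk : w ∈ Φ'.ker := by
    refine LinearMap.mem_ker.2 (funext fun i => ?_)
    simp [hΦ', hw i]
  set ψ := hd.implicitFunction Φ Φ' hr (Φ xb) with hψ
  have hline : HasDerivAt (fun t : ℝ => t • (⟨w, hwk⟩ : Φ'.ker)) ⟨w, hwk⟩ 0 := by
    simpa using (hasDerivAt_id (0 : ℝ)).smul_const (⟨w, hwk⟩ : Φ'.ker)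
  refine ⟨fun t => ψ (t • ⟨w, hwk⟩), by simp [hψ], ?_, ?_⟩
  · have h1 : HasFDerivAt ψ Φ'.ker.subtypeL ((0 : ℝ) • (⟨w, hwk⟩ : Φ'.ker)) := by
      rw [zero_smul]
      exact (hd.to_implicitFunction hr).hasFDerivAt
    exact h1.comp_hasDerivAt (0 : ℝ) hline
  · have h1 : Tendsto (fun t : ℝ => (Φ xb, t • (⟨w, hwk⟩ : Φ'.ker))) (𝓝 0) (𝓝 (Φ xb, 0)) := by
      refine tendsto_const_nhds.prodMk_nhds ?_
      simpa using hline.continuousAt.tendsto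
    filter_upwards [h1.eventually (hd.map_implicitFunction_eq hr)] with t ht i
    have h2 : h i (ψ (t • ⟨w, hwk⟩)) = h i xb := congrFun ht i
    exact h2.trans (h0 i)

variable {φ : ι → E → F → ℝ} {xb : E} {pb : F}

theorem hasStrictFDerivAt_innerSL_pgrad {h : E → F → ℝ}
    (hh : ContDiffAt ℝ 2 (fun t : E × F => h t.1 t.2) (xb, pb)) :
    HasStrictFDerivAt (fun y => h y pb) (innerSL ℝ (pgrad h xb pb)) xb := by
  have h1 : ContDiffAt ℝ 2 (fun y => h y pb) xb :=
    hh.comp (f := fun y : E => (y, pb)) xb (contDiffAt_id.prodMk contDiffAt_const)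
  have h2 := h1.hasStrictFDerivAt (by simp)
  have h3 := (hasGradientAt_pgrad (hh.differentiableAt (by simp))).hasFDerivAt.fderiv
  rw [h3] at h2
  exact h2

theorem exists_feasible_curve
    (hφ : ∀ i, ContDiffAt ℝ 2 (fun t : E × F => φ i t.1 t.2) (xb, pb))
    (hli : LinearIndepOn ℝ (fun i => pgrad (φ i) xb pb) {i | φ i xb pb = 0})
    {lam : ι → ℝ} {yb : E} (hK : IsKKT φ xb pb lam yb) {w : E}
    (hw : ∀ i, 0 < lam i → ⟪pgrad (φ i) xb pb, w⟫ = 0)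
    (hw' : ∀ i, φ i xb pb = 0 → lam i = 0 → ⟪pgrad (φ i) xb pb, w⟫ < 0) :
    ∃ x : ℝ → E, x 0 = xb ∧ HasDerivAt x w 0 ∧
      ∀ᶠ t in 𝓝[>] 0, IsKKT φ (x t) pb lam (∑ i, lam i • pgrad (φ i) (x t) pb) := by
  have hact : ∀ i, 0 < lam i → φ i xb pb = 0 := fun i hi =>
    (mul_eq_zero.1 (hK.2.2.1 i)).resolve_left hi.ne'
  obtain ⟨x, hx0, hxd, hx⟩ := exists_curve_of_inner_eq_zero
    (κ := {i | 0 < lam i}) (h := fun i y => φ i y pb) (g := fun i => pgrad (φ i) xb pb)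
    (fun i => hasStrictFDerivAt_innerSL_pgrad (hφ i)) (hli.mono fun i hi => hact i hi)
    (fun i => hact i i.2) (fun i => hw i i.2)
  have hpos : ∀ i, lam i ≠ 0 → 0 < lam i := fun i hi => (hK.1 i).lt_of_ne' hi
  have hder : ∀ i, HasDerivAt (fun t => φ i (x t) pb) ⟪pgrad (φ i) xb pb, w⟫ 0 := fun i => by
    have h1 : HasFDerivAt (fun y => φ i y pb) (innerSL ℝ (pgrad (φ i) xb pb)) (x 0) :=
      hx0 ▸ (hasStrictFDerivAt_innerSL_pgrad (hφ i)).hasFDerivAt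
    exact h1.comp_hasDerivAt (0 : ℝ) hxd
  have hfeas : ∀ᶠ t in 𝓝[>] (0 : ℝ), ∀ i, φ i (x t) pb ≤ 0 := by
    rw [eventually_all]
    intro i
    by_cases hi : φ i xb pb = 0
    · by_cases hl : lam i = 0
      · have h1 := (hder i).tendsto_slope_zero_right
        filter_upwards [h1.eventually (gt_mem_nhds (hw' i hi hl)), self_mem_nhdsWithin] with t ht ht0
        simp only [zero_add, hx0, hi, sub_zero, smul_eq_mul] at ht
        have h2 : (0 : ℝ) < t⁻¹ := inv_pos.2 ht0
        exact (neg_of_mul_neg_right ht h2.le).le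
      · filter_upwards [hx.filter_mono nhdsWithin_le_nhds] with t ht
        exact (ht ⟨i, hpos i hl⟩).le
    · have h1 : Tendsto (fun t => φ i (x t) pb) (𝓝[>] 0) (𝓝 (φ i xb pb)) := by
        have := (hder i).continuousAt.tendsto
        rw [hx0] at this
        exact this.mono_left nhdsWithin_le_nhds
      filter_upwards [h1.eventually (gt_mem_nhds ((hK.2.1 i).lt_of_ne hi))] with t ht
      exact ht.le
  refine ⟨x, hx0, hxd, ?_⟩
  filter_upwards [hfeas, hx.filter_mono nhdsWithin_le_nhds] with t ht ht'
  refine ⟨hK.1, ht, fun i => ?_, rfl⟩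
  by_cases hl : lam i = 0
  · simp [hl]
  · rw [ht' ⟨i, hpos i hl⟩, mul_zero]

end Curves

section Necessity

variable {G : Type*} [NormedAddCommGroup G] [NormedSpace ℝ G] {φ : ι → E → F → ℝ} {f : E → F → G → E}
  {Df : E → F → G → E →L[ℝ] E} {xb vb : E} {pb : F} {qb : G}

theorem A4.hasFDerivAt (hA4 : A4 f Df xb pb qb) :
    HasFDerivAt (fun x => f x pb qb) (Df xb pb qb) xb := by
  refine .of_isLittleO (Asymptotics.isLittleO_iff.2 fun ε hε => ?_)
  obtain ⟨δ, hδ, h⟩ := hA4.exists_norm_sub_sub_le hε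
  filter_upwards [Metric.ball_mem_nhds xb hδ] with x hx
  exact h x xb pb qb (mem_ball_iff_norm.1 hx) (by simpa) (by simpa) (by simpa)

theorem hasDerivAt_pgrad_comp {h : E → F → ℝ}
    (hh : ContDiffAt ℝ 2 (fun t : E × F => h t.1 t.2) (xb, pb)) {x : ℝ → E} {w : E}
    (hx0 : x 0 = xb) (hx : HasDerivAt x w 0) :
    HasDerivAt (fun t => pgrad h (x t) pb) (phess h xb pb w) 0 := by
  unfold phess
  have hg := (hasStrictFDerivAt_pgrad hh).hasFDerivAt
  generalize fderiv ℝ (fun t : E × F => pgrad h t.1 t.2) (xb, pb) = g' at hg ⊢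
  have h1 : HasDerivAt (fun t => (x t, pb)) (w, (0 : F)) 0 := hx.prodMk (hasDerivAt_const _ _)
  have h2 : HasFDerivAt (fun t : E × F => pgrad h t.1 t.2) g' (x 0, pb) := hx0 ▸ hg
  exact h2.comp_hasDerivAt (0 : ℝ) h1

theorem phess_sub {h : E → F → ℝ} (u v : E) :
    phess h xb pb (u - v) = phess h xb pb u - phess h xb pb v := by
  unfold phess
  generalize fderiv ℝ (fun t : E × F => pgrad h t.1 t.2) (xb, pb) = g'
  rw [← map_sub, Prod.mk_sub_mk, sub_zero]

theorem LipFullStable.exists_eventually_mul_sq_le {S : E → F → G → Set E}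
    (h : LipFullStable S xb vb pb qb) {α : Type*} {l : Filter α} {x₁ x₂ v₁ v₂ : α → E}
    (hx₁ : Tendsto x₁ l (𝓝 xb)) (hx₂ : Tendsto x₂ l (𝓝 xb)) (hv₁ : Tendsto v₁ l (𝓝 vb))
    (hv₂ : Tendsto v₂ l (𝓝 vb)) (h₁ : ∀ᶠ k in l, x₁ k ∈ S (v₁ k) pb qb)
    (h₂ : ∀ᶠ k in l, x₂ k ∈ S (v₂ k) pb qb) :
    ∃ κ > 0, ∀ᶠ k in l, κ * ‖x₂ k - x₁ k‖ ^ 2 ≤ ⟪v₂ k - v₁ k, x₂ k - x₁ k⟫ := by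
  obtain ⟨V, hV, Pn, hP, Qn, hQ, U, hU, ϑ, hloc, κ, hκ, ℓ, hℓ, hst⟩ := h
  refine ⟨κ, hκ, ?_⟩
  filter_upwards [hx₁ hU, hx₂ hU, hv₁ hV, hv₂ hV, h₁, h₂] with k hx₁ hx₂ hv₁ hv₂ h₁ h₂
  have hp := mem_of_mem_nhds hP
  have hq := mem_of_mem_nhds hQ
  have e := hst _ hv₂ _ hp _ hq _ hv₁ _ hp _ hq
  rw [← (hloc _ hv₁ _ hp _ hq).2.2 _ hx₁ h₁, ← (hloc _ hv₂ _ hp _ hq).2.2 _ hx₂ h₂,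
    dist_self, dist_self, add_zero, mul_zero, add_zero] at e
  exact mul_sq_le_of_norm_sub_smul_le hκ e

theorem exists_mul_sq_le_inner_of_hasDerivAt {x₁ x₂ v₁ v₂ : ℝ → E} {w₁ w₂ z₁ z₂ : E} {κ : ℝ}
    (hx₁ : HasDerivAt x₁ w₁ 0) (hx₂ : HasDerivAt x₂ w₂ 0) (hv₁ : HasDerivAt v₁ z₁ 0)
    (hv₂ : HasDerivAt v₂ z₂ 0) (hx : x₁ 0 = x₂ 0) (hv : v₁ 0 = v₂ 0)
    (h : ∀ᶠ t in 𝓝[>] 0, κ * ‖x₂ t - x₁ t‖ ^ 2 ≤ ⟪v₂ t - v₁ t, x₂ t - x₁ t⟫) :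
    κ * ‖w₂ - w₁‖ ^ 2 ≤ ⟪z₂ - z₁, w₂ - w₁⟫ := by
  have hX := (hx₂.sub hx₁).tendsto_slope_zero_right
  have hV := (hv₂.sub hv₁).tendsto_slope_zero_right
  refine le_of_tendsto_of_tendsto ((hX.norm.pow 2).const_mul κ) (hV.inner hX) ?_
  filter_upwards [h] with t ht
  simp only [Pi.sub_apply, zero_add, hx, hv, sub_self, sub_zero, norm_smul, inner_smul_left,
    inner_smul_right, mul_pow, Real.norm_eq_abs, sq_abs, conj_trivial]
  nlinarith [sq_nonneg t⁻¹]

theorem LipFullStable.gssosc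
    (hφ : ∀ i, ContDiffAt ℝ 2 (fun t : E × F => φ i t.1 t.2) (xb, pb))
    (hli : LinearIndepOn ℝ (fun i => pgrad (φ i) xb pb) {i | φ i xb pb = 0})
    (hA4 : A4 f Df xb pb qb)
    (h : LipFullStable (fun v p q => {x | v - f x p q ∈ limNC (feas φ p) x}) xb vb pb qb) :
    GSSOSC φ xb pb (Df xb pb qb) (vb - f xb pb qb) := by
  classical
  intro lam hK u hu horth
  have hact : ∀ i, 0 < lam i → φ i xb pb = 0 := fun i hi =>
    (mul_eq_zero.1 (hK.2.2.1 i)).resolve_left hi.ne'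
  obtain ⟨u₀, hu₀⟩ := LinearIndependent.exists_inner_eq hli
    (fun i : {i | φ i xb pb = 0} => if 0 < lam i then 0 else -1)
  have h₀ : ∀ i, 0 < lam i → ⟪pgrad (φ i) xb pb, u₀⟫ = 0 := fun i hi => by
    simpa [hi] using hu₀ ⟨i, hact i hi⟩
  have h₀' : ∀ i, φ i xb pb = 0 → lam i = 0 → ⟪pgrad (φ i) xb pb, u₀⟫ = -1 := fun i hi hl => by
    simpa [hl] using hu₀ ⟨i, hi⟩
  set M : ℝ := 1 + ∑ i, |⟪pgrad (φ i) xb pb, u⟫| with hM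
  have hMi : ∀ i, |⟪pgrad (φ i) xb pb, u⟫| < M := fun i => by
    have := Finset.single_le_sum (f := fun i => |⟪pgrad (φ i) xb pb, u⟫|)
      (fun j _ => abs_nonneg _) (Finset.mem_univ i)
    linarith
  obtain ⟨x₁, hx₁0, hx₁, hK₁⟩ := exists_feasible_curve hφ hli hK (w := M • u₀)
    (fun i hi => by rw [inner_smul_right, h₀ i hi, mul_zero])
    (fun i hi hl => by
      rw [inner_smul_right, h₀' i hi hl]
      linarith [hMi i, abs_nonneg ⟪pgrad (φ i) xb pb, u⟫])
  obtain ⟨x₂, hx₂0, hx₂, hK₂⟩ := exists_feasible_curve hφ hli hK (w := M • u₀ + u)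
    (fun i hi => by rw [inner_add_right, inner_smul_right, h₀ i hi, horth i hi, mul_zero, add_zero])
    (fun i hi hl => by
      rw [inner_add_right, inner_smul_right, h₀' i hi hl]
      linarith [hMi i, le_abs_self ⟪pgrad (φ i) xb pb, u⟫])
  set v : E → E := fun x => f x pb qb + ∑ i, lam i • pgrad (φ i) x pb with hv
  have hvb : v xb = vb := by
    rw [hv]
    simp only [← hK.2.2.2, add_sub_cancel]
  have hder : ∀ {x : ℝ → E} {w : E}, x 0 = xb → HasDerivAt x w 0 →
      HasDerivAt (fun t => v (x t)) (Df xb pb qb w + ∑ i, lam i • phess (φ i) xb pb w) 0 := by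
    intro x w hx0 hx
    refine HasDerivAt.add ?_ (HasDerivAt.fun_sum fun i _ =>
      (hasDerivAt_pgrad_comp (hφ i) hx0 hx).const_smul (lam i))
    have h1 : HasFDerivAt (fun x => f x pb qb) (Df xb pb qb) (x 0) := hx0 ▸ hA4.hasFDerivAt
    exact h1.comp_hasDerivAt (0 : ℝ) hx
  have htend : ∀ {y : ℝ → E} {w b : E}, y 0 = b → HasDerivAt y w 0 →
      Tendsto y (𝓝[>] 0) (𝓝 b) := fun hy0 hy =>
    hy0 ▸ hy.continuousAt.tendsto.mono_left nhdsWithin_le_nhds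
  have hsol : ∀ {x : ℝ → E}, Tendsto x (𝓝[>] 0) (𝓝 xb) →
      (∀ᶠ t in 𝓝[>] 0, IsKKT φ (x t) pb lam (∑ i, lam i • pgrad (φ i) (x t) pb)) →
      ∀ᶠ t in 𝓝[>] 0, v (x t) - f (x t) pb qb ∈ limNC (feas φ pb) (x t) := by
    intro x hx hKx
    have h1 := (hx.prodMk_nhds (tendsto_const_nhds (x := pb))).eventually
      (eventually_all.2 fun i => eventually_differentiableAt_of_contDiffAt (hφ i))
    filter_upwards [h1, hKx] with t ht hKt
    rw [hv, add_sub_cancel_left]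
    exact IsKKT.mem_limNC (fun i => hasGradientAt_pgrad (ht i)) hKt
  have ht₁ := htend hx₁0 hx₁
  have ht₂ := htend hx₂0 hx₂
  obtain ⟨κ, hκ, hle⟩ := h.exists_eventually_mul_sq_le ht₁ ht₂
    (htend (by simp only [hx₁0, hvb]) (hder hx₁0 hx₁)) (htend (by simp only [hx₂0, hvb])
      (hder hx₂0 hx₂)) (hsol ht₁ hK₁) (hsol ht₂ hK₂)
  have key := exists_mul_sq_le_inner_of_hasDerivAt hx₁ hx₂ (hder hx₁0 hx₁) (hder hx₂0 hx₂)
    (hx₁0.trans hx₂0.symm) (by simp only [hx₁0, hx₂0]) hle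
  rw [add_sub_add_comm, ← map_sub, ← Finset.sum_sub_distrib] at key
  simp only [← smul_sub, ← phess_sub, add_sub_cancel_left, inner_add_left, sum_inner,
    real_inner_smul_left] at key
  exact (by positivity : 0 < κ * ‖u‖ ^ 2).trans_le key

end Necessity

section Equivalence

variable {φ : ι → E → F → ℝ} {xb vb fb : E} {pb : F} {A : E →L[ℝ] E}

theorem gssosc_iff (hφ : ∀ i, ContDiffAt ℝ 2 (fun t : E × F => φ i t.1 t.2) (xb, pb))
    (hfeas : ∀ i, φ i xb pb ≤ 0) :
    GSSOSC φ xb pb A (vb - fb) ↔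
      ∀ lam : ι → ℝ, (∀ i, 0 ≤ lam i) → vb = fb + ∑ i, lam i • pgrad (φ i) xb pb →
        (∀ i, lam i * φ i xb pb = 0) → ∀ u : E, u ≠ 0 →
          (∀ i, φ i xb pb = 0 → 0 < lam i → ⟪pgrad (φ i) xb pb, u⟫ = 0) →
          0 < ⟪A u, u⟫ + ∑ i, lam i * iteratedFDeriv ℝ 2 (fun y => φ i y pb) xb ![u, u] := by
  simp only [iteratedFDeriv_two_eq_inner_phess (hφ _)]
  constructor
  · intro h lam h0 hv hc u hu horth
    exact h lam ⟨h0, hfeas, hc, by rw [hv, add_sub_cancel_left]⟩ u hu fun i hi =>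
      horth i ((mul_eq_zero.1 (hc i)).resolve_left hi.ne') hi
  · rintro h lam ⟨h0, -, hc, hv⟩ u hu horth
    exact h lam h0 (by rw [← hv, add_sub_cancel]) hc u hu fun i _ hi => horth i hi

end Equivalence

end VariationalStability

/-- full stability of parametric variational conditions via GSSOSC
under partial MFCQ+CRCQ, and its characterization under partial LICQ
(Corollary 9.6). -/
theorem statement19 {n l m s : ℕ}
    (φ : Fin s → EuclideanSpace ℝ (Fin n) → EuclideanSpace ℝ (Fin l) → ℝ)
    (f : EuclideanSpace ℝ (Fin n) → EuclideanSpace ℝ (Fin l) → EuclideanSpace ℝ (Fin m) →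
      EuclideanSpace ℝ (Fin n))
    (Df : EuclideanSpace ℝ (Fin n) → EuclideanSpace ℝ (Fin l) → EuclideanSpace ℝ (Fin m) →
      EuclideanSpace ℝ (Fin n) →L[ℝ] EuclideanSpace ℝ (Fin n))
    (C : EuclideanSpace ℝ (Fin l) → Set (EuclideanSpace ℝ (Fin n)))
    (hC : ∀ p, C p = {x | ∀ i, φ i x p ≤ 0})
    (xb vb : EuclideanSpace ℝ (Fin n)) (pb : EuclideanSpace ℝ (Fin l))
    (qb : EuclideanSpace ℝ (Fin m))
    (hsmooth : ∀ i, ContDiffAt ℝ 2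
      (fun t : EuclideanSpace ℝ (Fin n) × EuclideanSpace ℝ (Fin l) => φ i t.1 t.2) (xb, pb))
    (hA1 : A1 f xb pb qb) (hA4 : A4 f Df xb pb qb)
    (hsol : xb ∈ (fun v p q => {x | v - f x p q ∈ limNC (C p) x}) vb pb qb) :
    (((∃ d : EuclideanSpace ℝ (Fin n), ∀ i, φ i xb pb = 0 →
        ⟪gradient (fun y => φ i y pb) xb, d⟫ < 0) →
      (∃ Wn ∈ 𝓝 (xb, pb), ∀ J : Finset (Fin s), (∀ i ∈ J, φ i xb pb = 0) →
        ∀ t₁ ∈ Wn, ∀ t₂ ∈ Wn,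
          Module.finrank ℝ ↥(Submodule.span ℝ
              ((fun i => gradient (fun y => φ i y t₁.2) t₁.1) '' (J : Set (Fin s))))
            = Module.finrank ℝ ↥(Submodule.span ℝ
              ((fun i => gradient (fun y => φ i y t₂.2) t₂.1) '' (J : Set (Fin s))))) →
      (∀ lam : Fin s → ℝ, (∀ i, 0 ≤ lam i) →
        vb = f xb pb qb + ∑ i, lam i • gradient (fun y => φ i y pb) xb →
        (∀ i, lam i * φ i xb pb = 0) →
        ∀ u : EuclideanSpace ℝ (Fin n), u ≠ 0 →
          (∀ i, φ i xb pb = 0 → 0 < lam i → ⟪gradient (fun y => φ i y pb) xb, u⟫ = 0) →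
          0 < ⟪Df xb pb qb u, u⟫
            + ∑ i, lam i * iteratedFDeriv ℝ 2 (fun y => φ i y pb) xb ![u, u]) →
      LipFullStable (fun v p q => {x | v - f x p q ∈ limNC (C p) x}) xb vb pb qb) ∧
    (LinearIndependent ℝ (fun i : {i : Fin s // φ i xb pb = 0} =>
        gradient (fun y => φ i.1 y pb) xb) →
      ((∀ lam : Fin s → ℝ, (∀ i, 0 ≤ lam i) →
        vb = f xb pb qb + ∑ i, lam i • gradient (fun y => φ i y pb) xb →
        (∀ i, lam i * φ i xb pb = 0) →
        ∀ u : EuclideanSpace ℝ (Fin n), u ≠ 0 →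
          (∀ i, φ i xb pb = 0 → 0 < lam i → ⟪gradient (fun y => φ i y pb) xb, u⟫ = 0) →
          0 < ⟪Df xb pb qb u, u⟫
            + ∑ i, lam i * iteratedFDeriv ℝ 2 (fun y => φ i y pb) xb ![u, u]) ↔
        LipFullStable (fun v p q => {x | v - f x p q ∈ limNC (C p) x}) xb vb pb qb))) := by
  obtain rfl : C = feas φ := funext hC
  have hs : vb - f xb pb qb ∈ limNC (feas φ pb) xb := hsol
  have hfeas {d : EuclideanSpace ℝ (Fin n)} {c : ℝ} (hc : 0 < c)
      (hreg : ∀ᶠ t in 𝓝 (xb, pb), SlaterRegularAt φ d c t) : ∀ i, φ i xb pb ≤ 0 := by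
    obtain ⟨lam, hK⟩ := ((eventually_mem_limNC_iff hc hreg).self_of_nhds _).1 hs
    exact hK.2.1
  refine ⟨fun ⟨d, hd⟩ hcr hG => ?_, fun hli => ?_⟩
  · obtain ⟨c, hc, hreg⟩ := eventually_slaterRegularAt hsmooth hd
    exact GSSOSC.lipFullStable hc hsmooth hreg hcr hA1 hA4
      ((gssosc_iff hsmooth (hfeas hc hreg)).2 hG) hs
  · obtain ⟨d, hd⟩ := hli.exists_inner_eq fun _ => -1
    obtain ⟨c, hc, hreg⟩ := eventually_slaterRegularAt (φ := φ) (d := d) hsmooth fun i hi =>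
      (hd ⟨i, hi⟩).trans_lt neg_one_lt_zero
    have hli' : LinearIndepOn ℝ (fun i => pgrad (φ i) xb pb) {i | φ i xb pb = 0} := hli
    refine (gssosc_iff hsmooth (hfeas hc hreg)).symm.trans ⟨fun hG => ?_, fun h => ?_⟩
    · exact GSSOSC.lipFullStable hc hsmooth hreg
        (exists_nhds_finrank_eq_of_linearIndepOn hsmooth hli') hA1 hA4 hG hs
    · exact LipFullStable.gssosc hsmooth hli' hA4 h

end PVS
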